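/- Let d, k ≥ 1, set p₀ = (d+3k)/(d+k), and let S₁, S₂ ⊂ I^d be closed cubes satisfying conditions (C1) and (C2): det(Σ_{i=1}^k t_i Hφ_i(ν)) ≠ 0 for every ν ∈ S₁ ∪ S₂ and |t| = 1, and det[D(ν₁,ν₂)(Σ_{j=1}^k t_j Hφ_j(ν))^{-1} D(ν₁,ν₂)^t] ≠ 0 for every ν₁ ∈ S₁, ν₂ ∈ S₂, |t| = 1 and ν ∈ {ν₁, ν₂}. Then there is a constant C' (independent of δ) with the following property: for every α > 0 and every sufficiently small δ > 0, if there is a constant A such that ‖E₁f · E₂g‖_{L^{p₀}(Q_R)} ≤ A R^α ‖f‖_{L²}‖g‖_{L²} for all R ≥ 2, all cubes Q_R of sidelength R and all f, g ∈ L², then for every ε > 0 there is a constant C_ε such that ‖E₁f · E₂g‖_{L^{p₀}(Q_R)} ≤ C_ε R^{max(α(1−δ), C'δ) + ε} ‖f‖_{L²}‖g‖_{L²} for all R ≥ 2, all cubes Q_R of sidelength R and all f, g ∈ L². -/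

import Mathlib

open MeasureTheory ENNReal Matrix

noncomputable section

/-- The extension (adjoint restriction) operator associated to the surface
`ξ ↦ (ξ, Φ ξ)`, acting on functions supported in `S ⊆ I^d`, evaluated at
`w = (x, t) ∈ ℝ^d × ℝ^k`. -/
def extOp (d k : ℕ) (S : Set (Fin d → ℝ)) (Φ : (Fin d → ℝ) → Fin k → ℝ)
    (f : (Fin d → ℝ) → ℂ) (w : (Fin d → ℝ) × (Fin k → ℝ)) : ℂ :=
  ∫ ξ in S, Complex.exp (2 * Real.pi * Complex.I *
    (((∑ i, w.1 i * ξ i) + ∑ j, w.2 j * Φ ξ j : ℝ) : ℂ)) * f ξ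

/-- `S` is a closed cube in `ℝ^d` (an axis-parallel cube `∏ [aᵢ - r, aᵢ + r]`). -/
def IsClosedCube (d : ℕ) (S : Set (Fin d → ℝ)) : Prop :=
  ∃ (a : Fin d → ℝ) (r : ℝ), 0 ≤ r ∧ S = {x | ∀ i, |x i - a i| ≤ r}

/-- The gradient `∇φ(ν)` of a scalar function on `ℝ^d`, as a vector. -/
def gradPhi (d : ℕ) (φ : (Fin d → ℝ) → ℝ) (ν : Fin d → ℝ) : Fin d → ℝ :=
  fun i => fderiv ℝ φ ν (Pi.single i 1)

/-- The Hessian matrix `Hφ(ν)` of a scalar function on `ℝ^d`. -/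
def hessPhi (d : ℕ) (φ : (Fin d → ℝ) → ℝ) (ν : Fin d → ℝ) : Matrix (Fin d) (Fin d) ℝ :=
  Matrix.of fun i j => fderiv ℝ (fun x => fderiv ℝ φ x (Pi.single j 1)) ν (Pi.single i 1)

/-- The `k × d` matrix `D(ν₁, ν₂)` whose `j`-th row is `∇φⱼ(ν₂) - ∇φⱼ(ν₁)`. -/
def Dmat (d k : ℕ) (Φ : (Fin d → ℝ) → Fin k → ℝ) (ν₁ ν₂ : Fin d → ℝ) :
    Matrix (Fin k) (Fin d) ℝ :=
  Matrix.of fun j i => gradPhi d (fun x => Φ x j) ν₂ i - gradPhi d (fun x => Φ x j) ν₁ i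

/-- The matrix `∑ᵢ tᵢ Hφᵢ(ν)`. -/
def tHess (d k : ℕ) (Φ : (Fin d → ℝ) → Fin k → ℝ) (t : Fin k → ℝ) (ν : Fin d → ℝ) :
    Matrix (Fin d) (Fin d) ℝ :=
  ∑ i, t i • hessPhi d (fun x => Φ x i) ν

/-- The `(k+d) × (k+d)` block matrix `M(t, ν₁, ν₂, ν)` with blocks
`0, D(ν₁,ν₂); D(ν₁,ν₂)ᵗ, ∑ᵢ tᵢ Hφᵢ(ν)`. -/
def Mmat (d k : ℕ) (Φ : (Fin d → ℝ) → Fin k → ℝ) (t : Fin k → ℝ) (ν₁ ν₂ ν : Fin d → ℝ) :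
    Matrix (Fin k ⊕ Fin d) (Fin k ⊕ Fin d) ℝ :=
  Matrix.fromBlocks 0 (Dmat d k Φ ν₁ ν₂) (Dmat d k Φ ν₁ ν₂)ᵀ (tHess d k Φ t ν)

/-- The axis-parallel cube of sidelength `R` in `ℝ^d × ℝ^k` centered at `c`. -/
def cubeQ (d k : ℕ) (R : ℝ) (c : (Fin d → ℝ) × (Fin k → ℝ)) :
    Set ((Fin d → ℝ) × (Fin k → ℝ)) :=
  {w | (∀ i, |w.1 i - c.1 i| ≤ R / 2) ∧ ∀ j, |w.2 j - c.2 j| ≤ R / 2}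

namespace BilinearRestriction

/-- The character `s ↦ e^{2πis}` of the real line. -/
def ex (s : ℝ) : ℂ := Complex.exp (2 * Real.pi * Complex.I * (s : ℂ))

lemma norm_ex (s : ℝ) : ‖ex s‖ = 1 := by
  have : ex s = Complex.exp ((2 * Real.pi * s : ℝ) * Complex.I) := by
    unfold ex; congr 1; push_cast; ring
  rw [this, Complex.norm_exp_ofReal_mul_I]

lemma ex_add (s t : ℝ) : ex (s + t) = ex s * ex t := by
  unfold ex; rw [← Complex.exp_add]; congr 1; push_cast; ring

lemma ex_zero : ex 0 = 1 := by simp [ex]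

lemma conj_ex (s : ℝ) : (starRingEnd ℂ) (ex s) = ex (-s) := by
  unfold ex; rw [← Complex.exp_conj]; congr 1
  simp only [map_mul, Complex.conj_ofReal, Complex.conj_I, map_ofNat]; push_cast; ring

lemma ex_sub (s t : ℝ) : ex (s - t) = ex s * (starRingEnd ℂ) (ex t) := by
  rw [sub_eq_add_neg, ex_add, conj_ex]

lemma contDiff_ex {n : WithTop ℕ∞} : ContDiff ℝ n ex := by
  unfold ex
  exact (contDiff_const.mul Complex.ofRealCLM.contDiff).cexp

lemma continuous_ex : Continuous ex := (contDiff_ex (n := 0)).continuous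

lemma ex_eq_fourierChar (s : ℝ) : ex s = (Real.fourierChar s : ℂ) := by
  rw [Real.fourierChar_apply, ex]; congr 1; push_cast; ring

lemma hasDerivAt_ex (s : ℝ) : HasDerivAt ex (2 * Real.pi * Complex.I * ex s) s := by
  have h1 : HasDerivAt (fun s : ℝ => 2 * Real.pi * Complex.I * (s : ℂ))
      (2 * Real.pi * Complex.I * 1) s := (Complex.ofRealCLM.hasDerivAt (x := s)).const_mul _
  have h2 := h1.cexp
  rw [mul_one] at h2
  rw [mul_comm]
  exact h2

lemma iteratedDeriv_ex (n : ℕ) :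
    iteratedDeriv n ex = fun s => (2 * Real.pi * Complex.I) ^ n * ex s := by
  induction n with
  | zero => simp
  | succ n ih =>
    rw [iteratedDeriv_succ, ih]
    funext s
    rw [((hasDerivAt_ex s).const_mul _).deriv]; ring

lemma norm_iteratedFDeriv_ex (n : ℕ) (s : ℝ) : ‖iteratedFDeriv ℝ n ex s‖ = (2 * Real.pi) ^ n := by
  rw [norm_iteratedFDeriv_eq_norm_iteratedDeriv, iteratedDeriv_ex]
  simp [norm_ex, abs_of_pos Real.pi_pos]

section Oscillatory

variable {V Y : Type*} [NormedAddCommGroup V] [InnerProductSpace ℝ V] [FiniteDimensional ℝ V]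
  [MeasurableSpace V] [BorelSpace V] [NormedAddCommGroup Y] [NormedSpace ℝ Y]

/-- The second order Taylor remainder of `T ∘ F` at `ν`, at scale `r⁻¹`. -/
def remainder (F : V → Y) (T : Y →L[ℝ] ℝ) (ν : V) (r : ℝ) (v : V) : ℝ :=
  T (F (ν + r⁻¹ • v) - F ν - r⁻¹ • fderiv ℝ F ν v)

omit [FiniteDimensional ℝ V] [MeasurableSpace V] [BorelSpace V] in
lemma contDiff_remainder {F : V → Y} (hF : ContDiff ℝ (⊤ : ℕ∞) F) (T : Y →L[ℝ] ℝ) (ν : V) (r : ℝ) :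
    ContDiff ℝ (⊤ : ℕ∞) (remainder F T ν r) := by
  unfold remainder
  fun_prop

omit [FiniteDimensional ℝ V] [MeasurableSpace V] [BorelSpace V] in
lemma fderiv_remainder {F : V → Y} (hF : ContDiff ℝ (⊤ : ℕ∞) F) (T : Y →L[ℝ] ℝ) (ν : V) (r : ℝ) :
    fderiv ℝ (remainder F T ν r) =
      fun v => (r⁻¹ • (ContinuousLinearMap.compL ℝ V Y ℝ T))
        (fderiv ℝ F (ν + r⁻¹ • v) - fderiv ℝ F ν) := by
  funext v
  have hd : Differentiable ℝ F := hF.differentiable (by simp)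
  have h1 : HasFDerivAt (fun v : V => ν + r⁻¹ • v) (r⁻¹ • ContinuousLinearMap.id ℝ V) v :=
    ((hasFDerivAt_id v).const_smul r⁻¹).const_add ν
  have h2 := ((((hd _).hasFDerivAt.comp v h1).sub_const (F ν)).sub
    ((fderiv ℝ F ν).hasFDerivAt.const_smul r⁻¹))
  have h3 := T.hasFDerivAt.comp v h2
  have : fderiv ℝ (remainder F T ν r) v = _ := h3.fderiv
  rw [this]
  ext x
  simp [mul_sub]

omit [MeasurableSpace V] [BorelSpace V] in
lemma norm_iteratedFDeriv_remainder_le {F : V → Y} (hF : ContDiff ℝ (⊤ : ℕ∞) F) (B ρ M : ℝ)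
    (hM : 0 ≤ M) (n : ℕ) :
    ∃ D : ℝ, 1 ≤ D ∧ ∀ r : ℝ, 1 ≤ r → ∀ T : Y →L[ℝ] ℝ, ‖T‖ ≤ M * r ^ 2 → ∀ ν : V, ‖ν‖ ≤ B →
      ∀ v : V, ‖v‖ ≤ ρ → ∀ i, 1 ≤ i → i ≤ n →
        ‖iteratedFDeriv ℝ i (remainder F T ν r) v‖ ≤ D ^ i := by
  have hF' : ContDiff ℝ (⊤ : ℕ∞) (fderiv ℝ F) := hF.fderiv_right (by simp)
  have hcb : ∀ i : ℕ, ∃ C : ℝ, ∀ x : V, ‖x‖ ≤ B + ρ → ‖iteratedFDeriv ℝ i (fderiv ℝ F) x‖ ≤ C := by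
    intro i
    have hc : Continuous (iteratedFDeriv ℝ i (fderiv ℝ F)) :=
      hF'.continuous_iteratedFDeriv (by exact_mod_cast le_top)
    obtain ⟨C, hC⟩ := (isCompact_closedBall (0 : V) (B + ρ)).exists_bound_of_continuousOn
      hc.continuousOn
    exact ⟨C, fun x hx => hC x (by simpa using hx)⟩
  choose C hC using hcb
  set S : ℝ := ∑ i ∈ Finset.range (n + 2), |C i| with hS
  have hCS : ∀ i, i ≤ n + 1 → C i ≤ S := fun i hi => (le_abs_self _).trans
    (Finset.single_le_sum (f := fun i => |C i|) (fun _ _ => abs_nonneg _)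
      (Finset.mem_range.2 (by omega)))
  have hS0 : 0 ≤ S := Finset.sum_nonneg fun _ _ => abs_nonneg _
  refine ⟨1 + M * S * (1 + |ρ|), by
    have : 0 ≤ M * S * (1 + |ρ|) := by positivity
    linarith, ?_⟩
  intro r hr T hT ν hν v hv i hi hin
  have hr0 : 0 < r := by linarith
  have hrinv : r⁻¹ ≤ 1 := inv_le_one_of_one_le₀ hr
  have hD1 : 1 ≤ 1 + M * S * (1 + |ρ|) := by
    have : 0 ≤ M * S * (1 + |ρ|) := by positivity
    linarith
  refine le_trans ?_ (le_self_pow₀ hD1 (by omega))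
  obtain ⟨j, rfl⟩ : ∃ j, i = j + 1 := ⟨i - 1, by omega⟩
  rw [← norm_iteratedFDeriv_fderiv, fderiv_remainder hF]
  have hpt : ∀ u : V, ‖u‖ ≤ ρ → ‖ν + r⁻¹ • u‖ ≤ B + ρ := by
    intro u hu
    calc ‖ν + r⁻¹ • u‖ ≤ ‖ν‖ + ‖r⁻¹ • u‖ := norm_add_le _ _
      _ ≤ B + 1 * ρ := by
        rw [norm_smul, Real.norm_of_nonneg (by positivity)]
        gcongr
      _ = B + ρ := by ring
  have hg : ContDiff ℝ (⊤ : ℕ∞) (fun v => fderiv ℝ F (ν + r⁻¹ • v) - fderiv ℝ F ν) := by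
    fun_prop
  have hinner : ‖iteratedFDeriv ℝ j (fun v => fderiv ℝ F (ν + r⁻¹ • v) - fderiv ℝ F ν) v‖
      ≤ S * (1 + |ρ|) * r⁻¹ := by
    rcases Nat.eq_zero_or_pos j with rfl | hj
    · rw [norm_iteratedFDeriv_zero]
      have hρ : 0 ≤ ρ := (norm_nonneg v).trans hv
      have hmv := (convex_closedBall (0 : V) (B + ρ)).norm_image_sub_le_of_norm_fderiv_le
        (𝕜 := ℝ) (f := fderiv ℝ F) (C := S) (x := ν) (y := ν + r⁻¹ • v)
        (fun x _ => (hF'.differentiable (by simp)) x)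
        (fun x hx => by
          have h1 := hC 1 x (by simpa using hx)
          rw [← norm_iteratedFDeriv_fderiv, norm_iteratedFDeriv_zero] at h1
          exact h1.trans (hCS 1 (by omega)))
        (by simp; linarith) (by simpa using hpt v hv)
      refine hmv.trans ?_
      rw [add_sub_cancel_left, norm_smul, Real.norm_of_nonneg (by positivity : (0 : ℝ) ≤ r⁻¹)]
      have : ‖v‖ ≤ 1 + |ρ| := hv.trans ((le_abs_self ρ).trans (by linarith))
      calc S * (r⁻¹ * ‖v‖) ≤ S * (r⁻¹ * (1 + |ρ|)) := by gcongr
        _ = _ := by ring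
    · have heq : iteratedFDeriv ℝ j (fun v => fderiv ℝ F (ν + r⁻¹ • v) - fderiv ℝ F ν) v
          = iteratedFDeriv ℝ j (fun v => fderiv ℝ F (ν + r⁻¹ • v)) v := by
        have h1 : ContDiff ℝ j (fun v => fderiv ℝ F (ν + r⁻¹ • v)) := by
          have : ContDiff ℝ (⊤ : ℕ∞) (fun v => fderiv ℝ F (ν + r⁻¹ • v)) := by fun_prop
          exact this.of_le (by exact_mod_cast le_top)
        have := iteratedFDeriv_sub_apply (x := v) h1.contDiffAt
          (contDiff_const (c := fderiv ℝ F ν) (n := (j : WithTop ℕ∞)) (𝕜 := ℝ) (E := V)).contDiffAt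
        rw [show (fun v => fderiv ℝ F (ν + r⁻¹ • v) - fderiv ℝ F ν)
          = (fun v => fderiv ℝ F (ν + r⁻¹ • v)) - (fun _ => fderiv ℝ F ν) from rfl, this,
          iteratedFDeriv_const_of_ne (by omega)]
        simp
      rw [heq]
      have h2 : (fun v => fderiv ℝ F (ν + r⁻¹ • v))
          = (fun u => fderiv ℝ F (ν + u)) ∘ (r⁻¹ • ContinuousLinearMap.id ℝ V) := by
        funext u; simp
      have h3 : ContDiff ℝ (⊤ : ℕ∞) (fun u => fderiv ℝ F (ν + u)) := by fun_prop
      rw [h2, ContinuousLinearMap.iteratedFDeriv_comp_right _ h3 _ (by exact_mod_cast le_top),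
        iteratedFDeriv_comp_add_left]
      refine (ContinuousMultilinearMap.norm_compContinuousLinearMap_le _ _).trans ?_
      have h4 := (hC j _ (hpt v hv)).trans (hCS j (by omega))
      have h5 : ‖r⁻¹ • ContinuousLinearMap.id ℝ V‖ ≤ r⁻¹ := by
        rw [norm_smul, Real.norm_of_nonneg (by positivity : (0 : ℝ) ≤ r⁻¹)]
        exact mul_le_of_le_one_right (by positivity) ContinuousLinearMap.norm_id_le
      have h6 : ∏ _i : Fin j, ‖r⁻¹ • ContinuousLinearMap.id ℝ V‖ ≤ r⁻¹ := by
        rw [Finset.prod_const, Finset.card_univ, Fintype.card_fin]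
        calc _ ≤ (r⁻¹) ^ j := by gcongr
          _ ≤ (r⁻¹) ^ 1 := pow_le_pow_of_le_one (by positivity) hrinv hj
          _ = r⁻¹ := pow_one _
      calc _ ≤ S * r⁻¹ := by
            refine mul_le_mul ?_ h6 (by positivity) hS0
            simpa using h4
        _ ≤ _ := by
          have : S * 1 ≤ S * (1 + |ρ|) := by gcongr; linarith [abs_nonneg ρ]
          rw [mul_one] at this
          gcongr
  have hL := (r⁻¹ • (ContinuousLinearMap.compL ℝ V Y ℝ T)).norm_iteratedFDeriv_comp_left
    (f := fun v => fderiv ℝ F (ν + r⁻¹ • v) - fderiv ℝ F ν) (x := v) (N := ((⊤ : ℕ∞) : WithTop ℕ∞))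
    hg.contDiffAt (n := j) (by exact_mod_cast le_top)
  refine hL.trans ?_
  have h7 : ‖r⁻¹ • (ContinuousLinearMap.compL ℝ V Y ℝ T)‖ ≤ r⁻¹ * (M * r ^ 2) := by
    refine ContinuousLinearMap.opNorm_le_bound _ (by positivity) fun A => ?_
    have h8 : ‖T.comp A‖ ≤ (M * r ^ 2) * ‖A‖ := (T.opNorm_comp_le A).trans (by gcongr)
    have h9 : (r⁻¹ • (ContinuousLinearMap.compL ℝ V Y ℝ T)) A = r⁻¹ • T.comp A := rfl
    rw [h9, norm_smul, Real.norm_of_nonneg (by positivity : (0 : ℝ) ≤ r⁻¹), mul_assoc]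
    gcongr
  calc _ ≤ (r⁻¹ * (M * r ^ 2)) * (S * (1 + |ρ|) * r⁻¹) := by gcongr
    _ = M * S * (1 + |ρ|) := by field_simp
    _ ≤ _ := by linarith

omit [MeasurableSpace V] [BorelSpace V] in
/-- Uniform bounds for the derivatives of an amplitude modulated by the Taylor remainder. -/
lemma norm_iteratedFDeriv_modulated_le {F : V → Y} (hF : ContDiff ℝ (⊤ : ℕ∞) F) (B ρ M : ℝ)
    (hM : 0 ≤ M) {χ : V → ℝ} (hχ : ContDiff ℝ (⊤ : ℕ∞) χ) (hsupp : tsupport χ ⊆ Metric.closedBall 0 ρ)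
    (n : ℕ) :
    ∃ C : ℝ, 0 ≤ C ∧ ∀ r : ℝ, 1 ≤ r → ∀ T : Y →L[ℝ] ℝ, ‖T‖ ≤ M * r ^ 2 → ∀ ν : V, ‖ν‖ ≤ B →
      ∀ v : V, ∀ i, i ≤ n →
        ‖iteratedFDeriv ℝ i (fun v => χ v • ex (remainder F T ν r v)) v‖ ≤ C := by
  obtain ⟨D, hD1, hD⟩ := norm_iteratedFDeriv_remainder_le hF B ρ M hM n
  have hχb : ∀ i : ℕ, ∃ C : ℝ, ∀ x : V, ‖iteratedFDeriv ℝ i χ x‖ ≤ C := by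
    intro i
    have hc : Continuous (iteratedFDeriv ℝ i χ) :=
      hχ.continuous_iteratedFDeriv (by exact_mod_cast le_top)
    have hs : HasCompactSupport χ :=
      (isCompact_closedBall (0 : V) ρ).of_isClosed_subset (isClosed_tsupport _) hsupp
    obtain ⟨C, hC⟩ := (hs.iteratedFDeriv (𝕜 := ℝ) i).exists_bound_of_continuous hc
    exact ⟨C, hC⟩
  choose C hC using hχb
  set S : ℝ := ∑ i ∈ Finset.range (n + 1), |C i|
  have hCS : ∀ i, i ≤ n → C i ≤ S := fun i hi => (le_abs_self _).trans
    (Finset.single_le_sum (f := fun i => |C i|) (fun _ _ => abs_nonneg _)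
      (Finset.mem_range.2 (by omega)))
  have hS0 : 0 ≤ S := Finset.sum_nonneg fun _ _ => abs_nonneg _
  set E : ℝ := n.factorial * (2 * Real.pi + 1) ^ n * D ^ n
  have hE0 : 0 ≤ E := by positivity
  refine ⟨2 ^ n * (S * E), by positivity, ?_⟩
  intro r hr T hT ν hν v i hi
  by_cases hv : v ∈ tsupport χ
  · have hvρ : ‖v‖ ≤ ρ := by simpa using hsupp hv
    have hrem := contDiff_remainder hF T ν r
    have hex : ContDiff ℝ (⊤ : ℕ∞) (fun v => ex (remainder F T ν r v)) := contDiff_ex.comp hrem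
    have hcomp : ∀ l, l ≤ n →
        ‖iteratedFDeriv ℝ l (fun v => ex (remainder F T ν r v)) v‖ ≤ E := by
      intro l hl
      have := norm_iteratedFDeriv_comp_le (𝕜 := ℝ) (g := ex) (f := remainder F T ν r) (n := l)
        (N := ((⊤ : ℕ∞) : WithTop ℕ∞)) contDiff_ex hrem (by exact_mod_cast le_top) v
        (C := (2 * Real.pi + 1) ^ n) (D := D)
        (fun i hi' => by
          rw [norm_iteratedFDeriv_ex]
          have hp := Real.pi_pos
          calc (2 * Real.pi) ^ i ≤ (2 * Real.pi + 1) ^ i := by gcongr; linarith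
            _ ≤ (2 * Real.pi + 1) ^ n := pow_le_pow_right₀ (by linarith) (by omega))
        (fun i h1 h2 => hD r hr T hT ν hν v hvρ i h1 (h2.trans hl))
      refine this.trans ?_
      have h1 : (l.factorial : ℝ) ≤ n.factorial := by exact_mod_cast Nat.factorial_le hl
      have h2 : D ^ l ≤ D ^ n := pow_le_pow_right₀ hD1 hl
      have hp := Real.pi_pos
      simp only [E]
      gcongr
    refine (norm_iteratedFDeriv_smul_le (N := ((⊤ : ℕ∞) : WithTop ℕ∞)) hχ hex v
      (n := i) (by exact_mod_cast le_top)).trans ?_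
    calc _ ≤ ∑ l ∈ Finset.range (i + 1), (i.choose l : ℝ) * (S * E) := by
          refine Finset.sum_le_sum fun l hl => ?_
          rw [Finset.mem_range] at hl
          rw [mul_assoc]
          gcongr
          · exact (hC l v).trans (hCS l (by omega))
          · exact hcomp _ (by omega)
      _ = 2 ^ i * (S * E) := by
          rw [← Finset.sum_mul]
          congr 1
          exact_mod_cast Nat.sum_range_choose i
      _ ≤ _ := by
          gcongr
          norm_num
  · have : (fun v => χ v • ex (remainder F T ν r v)) =ᶠ[nhds v] fun _ => 0 := by
      filter_upwards [(isClosed_tsupport χ).isOpen_compl.mem_nhds hv] with u hu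
      rw [image_eq_zero_of_notMem_tsupport hu, zero_smul]
    have h0 : iteratedFDeriv ℝ i (fun v => χ v • ex (remainder F T ν r v)) v = 0 := by
      have := (this.iteratedFDeriv ℝ i).self_of_nhds
      rw [this]
      simp
    rw [h0, norm_zero]
    positivity

open FourierTransform in
/-- Rapid decay of the Fourier transform of a modulated amplitude, uniformly in the parameters. -/
lemma fourier_modulated_decay {F : V → Y} (hF : ContDiff ℝ (⊤ : ℕ∞) F) (B ρ M : ℝ)
    (hM : 0 ≤ M) {χ : V → ℝ} (hχ : ContDiff ℝ (⊤ : ℕ∞) χ)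
    (hsupp : tsupport χ ⊆ Metric.closedBall 0 ρ) (n : ℕ) :
    ∃ C : ℝ, 0 ≤ C ∧ ∀ r : ℝ, 1 ≤ r → ∀ T : Y →L[ℝ] ℝ, ‖T‖ ≤ M * r ^ 2 → ∀ ν : V, ‖ν‖ ≤ B →
      ∀ w : V, ‖w‖ ^ n * ‖𝓕 (fun v => χ v • ex (remainder F T ν r v)) w‖ ≤ C := by
  obtain ⟨C, hC0, hC⟩ := norm_iteratedFDeriv_modulated_le hF B ρ M hM hχ hsupp n
  set vol : ℝ := (volume (Metric.closedBall (0 : V) ρ)).toReal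
  refine ⟨2 ^ n * ∑ p ∈ Finset.range 1 ×ˢ Finset.range (n + 1), C * vol, by positivity, ?_⟩
  intro r hr T hT ν hν w
  set G : V → ℂ := fun v => χ v • ex (remainder F T ν r v)
  have hG : ContDiff ℝ (⊤ : ℕ∞) G := hχ.smul (contDiff_ex.comp (contDiff_remainder hF T ν r))
  have hGs : tsupport G ⊆ Metric.closedBall 0 ρ :=
    (closure_mono (Function.support_smul_subset_left _ _)).trans hsupp
  have hGc : HasCompactSupport G :=
      (isCompact_closedBall (0 : V) ρ).of_isClosed_subset (isClosed_tsupport _) hGs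
  have hinteg : ∀ i : ℕ, Integrable (iteratedFDeriv ℝ i G) := fun i =>
    (hG.continuous_iteratedFDeriv (m := i)
      (by exact_mod_cast le_top)).integrable_of_hasCompactSupport (hGc.iteratedFDeriv (𝕜 := ℝ) i)
  have key := Real.pow_mul_norm_iteratedFDeriv_fourier_le (K := 0) (N := n) (f := G)
    (hG.of_le (by exact_mod_cast le_top))
    (fun k m hk hm => by
      obtain rfl : k = 0 := by simpa using hk
      simpa using (hinteg m).norm) (k := 0) (n := n) le_rfl le_rfl w
  rw [norm_iteratedFDeriv_zero] at key
  refine key.trans ?_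
  simp only [pow_zero, one_mul, Nat.cast_zero, mul_zero, zero_add]
  refine mul_le_mul_of_nonneg_left (Finset.sum_le_sum fun p hp => ?_) (by positivity)
  simp only [Finset.mem_product, Finset.mem_range] at hp
  obtain ⟨p1, p2⟩ := p
  obtain rfl : p1 = 0 := by simp at hp; omega
  simp only [pow_zero, one_mul]
  have hz : ∀ v, v ∉ Metric.closedBall (0 : V) ρ → ‖iteratedFDeriv ℝ p2 G v‖ = 0 := by
    intro v hv
    rw [norm_eq_zero]
    exact image_eq_zero_of_notMem_tsupport
      (fun h => hv (hGs (tsupport_iteratedFDeriv_subset p2 h)))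
  rw [← setIntegral_eq_integral_of_forall_compl_eq_zero hz]
  refine (setIntegral_mono_on (hinteg p2).norm.integrableOn
    (integrableOn_const (C := C) (isCompact_closedBall _ _).measure_lt_top.ne)
    measurableSet_closedBall (fun v _ => hC r hr T hT ν hν v p2 (by omega))).trans ?_
  rw [setIntegral_const, smul_eq_mul, mul_comm]
  rfl

end Oscillatory

variable {d k : ℕ}

/-- The phase of the extension operator. -/
def phase (Φ : (Fin d → ℝ) → Fin k → ℝ) (w : (Fin d → ℝ) × (Fin k → ℝ)) (ξ : Fin d → ℝ) : ℝ :=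
  w.1 ⬝ᵥ ξ + w.2 ⬝ᵥ Φ ξ

/-- The extension operator over the whole space. -/
def extn (Φ : (Fin d → ℝ) → Fin k → ℝ) (f : (Fin d → ℝ) → ℂ)
    (w : (Fin d → ℝ) × (Fin k → ℝ)) : ℂ :=
  ∫ ξ, ex (phase Φ w ξ) * f ξ

/-- The gradient of `t ⬝ Φ` at `ν`. -/
def tg (Φ : (Fin d → ℝ) → Fin k → ℝ) (t : Fin k → ℝ) (ν : Fin d → ℝ) : Fin d → ℝ :=
  fun i => t ⬝ᵥ fderiv ℝ Φ ν (Pi.single i 1)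

lemma dot_fderiv (Φ : (Fin d → ℝ) → Fin k → ℝ) (t : Fin k → ℝ) (ν v : Fin d → ℝ) :
    t ⬝ᵥ fderiv ℝ Φ ν v = tg Φ t ν ⬝ᵥ v := by
  conv_lhs => rw [← Finset.univ_sum_single v]
  rw [map_sum, dotProduct_sum]
  unfold tg
  rw [dotProduct]
  refine Finset.sum_congr rfl fun i _ => ?_
  have : (Pi.single i (v i) : Fin d → ℝ) = v i • Pi.single i 1 := by
    rw [← Pi.single_smul]; simp
  rw [this, map_smul, dotProduct_smul, smul_eq_mul, mul_comm]

/-- A smooth bump function, equal to `1` for `‖v‖ ≤ 1/4` and supported in `‖v‖ ≤ 1/2`. -/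
def bump (d : ℕ) : ContDiffBump (0 : Fin d → ℝ) := ⟨1 / 4, 1 / 2, by norm_num, by norm_num⟩

lemma contDiff_bump : ContDiff ℝ (⊤ : ℕ∞) (bump d) := (bump d).contDiff

lemma bump_eq_zero {v : Fin d → ℝ} (hv : 1 / 2 ≤ ‖v‖) : bump d v = 0 :=
  (bump d).zero_of_le_dist (by simpa [bump] using hv)

lemma bump_eq_one {v : Fin d → ℝ} (hv : ‖v‖ ≤ 1 / 4) : bump d v = 1 :=
  (bump d).one_of_mem_closedBall (by simpa [bump] using hv)

/-- The real vector underlying an integer vector. -/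
def rl {ι : Type*} (n : ι → ℤ) : ι → ℝ := fun i => (n i : ℝ)

/-- Frequency centres of the wave packets at scale `r`. -/
def frq (r : ℝ) (n : Fin d → ℤ) : Fin d → ℝ := (2 * r)⁻¹ • rl n

/-- Rescaled frequency variable of a wave packet. -/
def scl (r : ℝ) (n : Fin d → ℤ) (ξ : Fin d → ℝ) : Fin d → ℝ := r • ξ - (2 : ℝ)⁻¹ • rl n

/-- The wave packet with frequency label `T.1` and position label `T.2`, at scale `r`. -/
def pk (r : ℝ) (T : (Fin d → ℤ) × (Fin d → ℤ)) (ξ : Fin d → ℝ) : ℂ :=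
  (√(r ^ d) * bump d (scl r T.1 ξ) : ℝ) * ex (-(rl T.2 ⬝ᵥ scl r T.1 ξ))

lemma scl_frq_add {r : ℝ} (hr : r ≠ 0) (n : Fin d → ℤ) (v : Fin d → ℝ) :
    scl r n (frq r n + r⁻¹ • v) = v := by
  unfold scl frq
  ext i
  simp
  field_simp
  ring

lemma phase_expand (Φ : (Fin d → ℝ) → Fin k → ℝ) (w : (Fin d → ℝ) × (Fin k → ℝ))
    (r : ℝ) (ν v : Fin d → ℝ) :
    phase Φ w (ν + r⁻¹ • v) = phase Φ w ν + (r⁻¹ • (w.1 + tg Φ w.2 ν)) ⬝ᵥ v +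
      w.2 ⬝ᵥ (Φ (ν + r⁻¹ • v) - Φ ν - r⁻¹ • fderiv ℝ Φ ν v) := by
  unfold phase
  rw [dotProduct_add, dotProduct_sub, dotProduct_sub, dotProduct_smul, dotProduct_smul, dot_fderiv,
    smul_dotProduct, add_dotProduct]
  simp only [smul_eq_mul]
  ring

lemma integral_rescale {r : ℝ} (hr : 0 < r) (ν : Fin d → ℝ) (h : (Fin d → ℝ) → ℂ) :
    ∫ ξ, h ξ = (r ^ d)⁻¹ • ∫ v, h (ν + r⁻¹ • v) := by
  rw [← integral_add_left_eq_self h ν]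
  have := Measure.integral_comp_inv_smul_of_nonneg (volume : Measure (Fin d → ℝ))
    (fun x => h (ν + x)) hr.le
  rw [this]
  simp only [Module.finrank_fin_fun]
  rw [smul_smul, inv_mul_cancel₀ (by positivity), one_smul]

lemma inv_mul_sqrt {r : ℝ} (hr : 0 < r) (d : ℕ) : (r ^ d)⁻¹ * √(r ^ d) = (√(r ^ d))⁻¹ := by
  have h : 0 < r ^ d := by positivity
  have h2 : 0 < √(r ^ d) := by positivity
  conv_lhs => rw [← Real.mul_self_sqrt h.le]
  field_simp
  rw [Real.sqrt_sq h2.le]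

lemma extn_pk (Φ : (Fin d → ℝ) → Fin k → ℝ) {r : ℝ} (hr : 0 < r)
    (T : (Fin d → ℤ) × (Fin d → ℤ)) (w : (Fin d → ℝ) × (Fin k → ℝ)) :
    extn Φ (pk r T) w = ((√(r ^ d))⁻¹ : ℝ) * ex (phase Φ w (frq r T.1)) *
      ∫ v, ex ((r⁻¹ • (w.1 + tg Φ w.2 (frq r T.1)) - rl T.2) ⬝ᵥ v) * (bump d v *
        ex (w.2 ⬝ᵥ (Φ (frq r T.1 + r⁻¹ • v) - Φ (frq r T.1) -
          r⁻¹ • fderiv ℝ Φ (frq r T.1) v))) := by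
  unfold extn
  rw [integral_rescale hr (frq r T.1), ← inv_mul_sqrt hr d]
  rw [Complex.real_smul, ← integral_const_mul, ← integral_const_mul]
  congr 1
  funext v
  unfold pk
  rw [scl_frq_add hr.ne', phase_expand, ex_add, ex_add, sub_dotProduct,
    sub_eq_add_neg (_ ⬝ᵥ _ : ℝ) (_ ⬝ᵥ _), ex_add (_ ⬝ᵥ _)]
  push_cast
  ring

/-- The linear functional `y ↦ t ⬝ y`. -/
def dotL (t : Fin k → ℝ) : (Fin k → ℝ) →L[ℝ] ℝ :=
  LinearMap.toContinuousLinearMap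
    { toFun := fun y => t ⬝ᵥ y
      map_add' := fun _ _ => dotProduct_add _ _ _
      map_smul' := fun _ _ => by simp }

lemma dotL_apply (t y : Fin k → ℝ) : dotL t y = t ⬝ᵥ y := rfl

lemma abs_dotProduct_le (t y : Fin k → ℝ) : |t ⬝ᵥ y| ≤ k * ‖t‖ * ‖y‖ := by
  rw [dotProduct]
  refine (Finset.abs_sum_le_sum_abs _ _).trans ?_
  calc _ ≤ ∑ _i : Fin k, ‖t‖ * ‖y‖ := by
        refine Finset.sum_le_sum fun i _ => ?_
        rw [abs_mul]
        gcongr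
        · exact norm_le_pi_norm t i
        · exact norm_le_pi_norm y i
    _ = _ := by simp; ring

lemma norm_dotL_le (t : Fin k → ℝ) : ‖dotL t‖ ≤ k * ‖t‖ :=
  ContinuousLinearMap.opNorm_le_bound _ (by positivity) fun y => abs_dotProduct_le t y

open FourierTransform in
/-- Rapid decay of wave packets away from their tubes. -/
lemma norm_extn_pk_le {Φ : (Fin d → ℝ) → Fin k → ℝ} (hΦ : ContDiff ℝ (⊤ : ℕ∞) Φ) (B : ℝ) (N : ℕ) :
    ∃ C : ℝ, 0 ≤ C ∧ ∀ r : ℝ, 1 ≤ r → ∀ T : (Fin d → ℤ) × (Fin d → ℤ), ‖frq r T.1‖ ≤ B →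
      ∀ w : (Fin d → ℝ) × (Fin k → ℝ), ‖w.2‖ ≤ r ^ 2 →
        ‖extn Φ (pk r T) w‖ ≤ C * (√(r ^ d))⁻¹ *
          ((1 + ‖r⁻¹ • (w.1 + tg Φ w.2 (frq r T.1)) - rl T.2‖) ^ N)⁻¹ := by
  set e : EuclideanSpace ℝ (Fin d) ≃L[ℝ] (Fin d → ℝ) := EuclideanSpace.equiv (Fin d) ℝ with he
  have hsup : ∀ z, ‖e z‖ ≤ ‖z‖ := fun z => by
    rw [pi_norm_le_iff_of_nonneg (norm_nonneg _)]
    exact fun i => PiLp.norm_apply_le z i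
  set ρ : ℝ := ‖(e.symm : (Fin d → ℝ) →L[ℝ] EuclideanSpace ℝ (Fin d))‖
  have hesymm : ∀ v, ‖e.symm v‖ ≤ ρ * ‖v‖ := fun v =>
    (e.symm : (Fin d → ℝ) →L[ℝ] EuclideanSpace ℝ (Fin d)).le_opNorm v
  have hρ0 : 0 ≤ ρ := norm_nonneg _
  have hF : ContDiff ℝ (⊤ : ℕ∞) (fun z => Φ (e z)) := hΦ.comp e.contDiff
  have hχ : ContDiff ℝ (⊤ : ℕ∞) (fun z => bump d (e z)) := contDiff_bump.comp e.contDiff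
  have hsupp : tsupport (fun z => bump d (e z)) ⊆ Metric.closedBall 0 (ρ * (1 / 2)) := by
    refine closure_minimal (fun z hz => ?_) Metric.isClosed_closedBall
    have h1 : ‖e z‖ < 1 / 2 := by
      by_contra h
      exact hz (bump_eq_zero (not_lt.1 h))
    have h2 := hesymm (e z)
    rw [e.symm_apply_apply] at h2
    rw [mem_closedBall_zero_iff]
    exact h2.trans (by gcongr)
  have key := fun n => fourier_modulated_decay hF (ρ * B) (ρ * (1 / 2)) k (Nat.cast_nonneg k) hχ
    hsupp n
  obtain ⟨C0, hC0, hK0⟩ := key 0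
  obtain ⟨C1, hC1, hK1⟩ := key N
  refine ⟨2 ^ N * (C0 + C1), by positivity, ?_⟩
  intro r hr T hν w hw
  have hr0 : 0 < r := by linarith
  set ν := frq r T.1
  set z := r⁻¹ • (w.1 + tg Φ w.2 ν) - rl T.2
  have hT : ‖dotL w.2‖ ≤ k * r ^ 2 := (norm_dotL_le _).trans (by gcongr)
  have hν' : ‖e.symm ν‖ ≤ ρ * B := (hesymm ν).trans (by gcongr)
  have hK0 := hK0 r hr (dotL w.2) hT (e.symm ν) hν' (e.symm (-z))
  have hK1 := hK1 r hr (dotL w.2) hT (e.symm ν) hν' (e.symm (-z))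
  set X := ‖𝓕 (fun v => bump d (e v) • ex (remainder (fun z => Φ (e z)) (dotL w.2) (e.symm ν) r v))
    (e.symm (-z))‖
  have hX0 : 0 ≤ X := norm_nonneg _
  have hX : ‖extn Φ (pk r T) w‖ = (√(r ^ d))⁻¹ * X := by
    rw [extn_pk Φ hr0, norm_mul, norm_mul, norm_ex, mul_one, Complex.norm_real,
      Real.norm_of_nonneg (by positivity)]
    congr 1
    simp only [X]
    rw [Real.fourier_eq, ← (EuclideanSpace.volume_preserving_symm_measurableEquiv_toLp
      (Fin d)).integral_comp (MeasurableEquiv.measurableEmbedding _)]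
    congr 1
    refine integral_congr_ae (Filter.Eventually.of_forall fun v => ?_)
    have hd : Differentiable ℝ Φ := hΦ.differentiable (by simp)
    have h1 : fderiv ℝ (fun z => Φ (e z)) (e.symm ν) = (fderiv ℝ Φ ν).comp
        (e : EuclideanSpace ℝ (Fin d) →L[ℝ] (Fin d → ℝ)) := by
      have := ((hd (e (e.symm ν))).hasFDerivAt.comp (e.symm ν) e.hasFDerivAt).fderiv
      rw [e.apply_symm_apply] at this
      exact this
    have h2 : remainder (fun z => Φ (e z)) (dotL w.2) (e.symm ν) r v =
        w.2 ⬝ᵥ (Φ (ν + r⁻¹ • e v) - Φ ν - r⁻¹ • fderiv ℝ Φ ν (e v)) := by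
      unfold remainder
      rw [h1, dotL_apply]
      simp
    have h3 : inner ℝ v (e.symm (-z)) = -(z ⬝ᵥ e v) := by
      simp [PiLp.inner_apply, he, dotProduct, mul_comm]
    dsimp only
    rw [h2, h3, neg_neg, Circle.smul_def, ← ex_eq_fourierChar, smul_eq_mul, Complex.real_smul]
    rfl
  rw [hX]
  have hz : ‖z‖ ≤ ‖e.symm (-z)‖ := by
    have := hsup (e.symm (-z))
    rwa [e.apply_symm_apply, norm_neg] at this
  have hmain : (1 + ‖z‖) ^ N * X ≤ 2 ^ N * (C0 + C1) := by
    have h1 : (1 + ‖z‖) ^ N ≤ 2 ^ N * (1 + ‖z‖ ^ N) := by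
      rcases le_total ‖z‖ 1 with h | h
      · calc (1 + ‖z‖) ^ N ≤ (2 : ℝ) ^ N := by gcongr; linarith
          _ ≤ 2 ^ N * (1 + ‖z‖ ^ N) := by
            have : 0 ≤ ‖z‖ ^ N := by positivity
            nlinarith [pow_pos (two_pos : (0 : ℝ) < 2) N]
      · calc (1 + ‖z‖) ^ N ≤ (2 * ‖z‖) ^ N := by gcongr; linarith
          _ = 2 ^ N * ‖z‖ ^ N := mul_pow _ _ _
          _ ≤ _ := by gcongr; linarith
    have h2 : ‖z‖ ^ N * X ≤ C1 := le_trans (by gcongr) hK1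
    have h3 : X ≤ C0 := by simpa using hK0
    calc _ ≤ 2 ^ N * (1 + ‖z‖ ^ N) * X := by gcongr
      _ = 2 ^ N * (X + ‖z‖ ^ N * X) := by ring
      _ ≤ _ := by gcongr
  have hp : 0 < (1 + ‖z‖) ^ N := by positivity
  calc (√(r ^ d))⁻¹ * X = (√(r ^ d))⁻¹ * ((1 + ‖z‖) ^ N * X) * ((1 + ‖z‖) ^ N)⁻¹ := by field_simp
    _ ≤ (√(r ^ d))⁻¹ * (2 ^ N * (C0 + C1)) * ((1 + ‖z‖) ^ N)⁻¹ := by gcongr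
    _ = _ := by ring

lemma card_int_Icc_le (z M : ℝ) (hM : 0 ≤ M) :
    ((Finset.Icc ⌈z - M⌉ ⌊z + M⌋).card : ℝ) ≤ 2 * M + 1 := by
  rw [Int.card_Icc]
  rcases le_total 0 (⌊z + M⌋ + 1 - ⌈z - M⌉) with h | h
  · have : (((⌊z + M⌋ + 1 - ⌈z - M⌉).toNat : ℤ) : ℝ) = ((⌊z + M⌋ + 1 - ⌈z - M⌉ : ℤ) : ℝ) := by
      rw [Int.toNat_of_nonneg h]
    rw [show (((⌊z + M⌋ + 1 - ⌈z - M⌉).toNat : ℕ) : ℝ)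
      = (((⌊z + M⌋ + 1 - ⌈z - M⌉).toNat : ℤ) : ℝ) by push_cast; rfl, this]
    push_cast
    linarith [Int.floor_le (z + M), Int.le_ceil (z - M)]
  · rw [Int.toNat_of_nonpos h]
    push_cast
    linarith

/-- The number of lattice points in a cube. -/
lemma card_lattice_le {ι : Type*} [Fintype ι] (s : Finset (ι → ℤ)) (z : ι → ℝ)
    {M : ℝ} (hM : 0 ≤ M) (h : ∀ n ∈ s, ‖rl n - z‖ ≤ M) :
    (s.card : ℝ) ≤ (2 * M + 1) ^ Fintype.card ι := by
  classical
  have hsub : s ⊆ Fintype.piFinset fun i => Finset.Icc ⌈z i - M⌉ ⌊z i + M⌋ := by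
    intro n hn
    rw [Fintype.mem_piFinset]
    intro i
    have h1 : |(n i : ℝ) - z i| ≤ M := (norm_le_pi_norm (rl n - z) i).trans (h n hn)
    rw [abs_le] at h1
    rw [Finset.mem_Icc]
    exact ⟨Int.ceil_le.2 (by linarith), Int.le_floor.2 (by linarith)⟩
  calc (s.card : ℝ) ≤ (Fintype.piFinset fun i => Finset.Icc ⌈z i - M⌉ ⌊z i + M⌋).card := by
        exact_mod_cast Finset.card_le_card hsub
    _ = ∏ i, ((Finset.Icc ⌈z i - M⌉ ⌊z i + M⌋).card : ℝ) := by
      rw [Fintype.card_piFinset]; push_cast; rfl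
    _ ≤ ∏ _i : ι, (2 * M + 1) := Finset.prod_le_prod (fun _ _ => by positivity)
      fun i _ => card_int_Icc_le _ _ hM
    _ = _ := by simp

lemma exists_sum_int_le : ∃ C : ℝ, 0 ≤ C ∧ ∀ (t : Finset ℤ) (z : ℝ),
    ∑ a ∈ t, ((1 + |z - a|) ^ 2)⁻¹ ≤ C := by
  have hs : Summable fun a : ℤ => 4 * ((1 + |(a : ℝ)|) ^ 2)⁻¹ := by
    refine Summable.mul_left _ ?_
    have h1 : Summable fun n : ℕ => (((1 : ℝ) + n) ^ 2)⁻¹ := by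
      have := (summable_nat_add_iff 1).2 (Real.summable_nat_pow_inv.2 (one_lt_two))
      refine this.congr fun n => ?_
      push_cast; rw [add_comm]
    refine Summable.of_nat_of_neg ?_ ?_
    · simpa using h1
    · simpa using h1
  refine ⟨∑' a : ℤ, 4 * ((1 + |(a : ℝ)|) ^ 2)⁻¹, tsum_nonneg fun _ => by positivity, ?_⟩
  intro t z
  have h1 : ∀ a ∈ t, ((1 + |z - a|) ^ 2)⁻¹ ≤ 4 * ((1 + |((a - ⌊z⌋ : ℤ) : ℝ)|) ^ 2)⁻¹ := by
    intro a _
    have h2 : (1 + |((a - ⌊z⌋ : ℤ) : ℝ)|) ≤ 2 * (1 + |z - a|) := by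
      push_cast
      have h3 : |(a : ℝ) - ⌊z⌋| ≤ |z - a| + 1 := by
        have : (a : ℝ) - ⌊z⌋ = -(z - a) + (z - ⌊z⌋) := by ring
        rw [this]
        refine (abs_add_le _ _).trans ?_
        rw [abs_neg]
        gcongr
        rw [abs_le]
        exact ⟨by linarith [Int.floor_le z], by linarith [Int.lt_floor_add_one z]⟩
      linarith [abs_nonneg (z - a)]
    rw [show (4 : ℝ) * ((1 + |((a - ⌊z⌋ : ℤ) : ℝ)|) ^ 2)⁻¹
      = (((1 + |((a - ⌊z⌋ : ℤ) : ℝ)|) / 2) ^ 2)⁻¹ by field_simp; norm_num]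
    gcongr
    linarith
  refine (Finset.sum_le_sum h1).trans ?_
  have h4 := Summable.sum_le_tsum (t.map (Equiv.subRight ⌊z⌋).toEmbedding)
    (fun _ _ => by positivity) hs
  rw [Finset.sum_map] at h4
  exact h4

lemma exists_sum_lattice_le (d : ℕ) : ∃ C : ℝ, 0 ≤ C ∧ ∀ (s : Finset (Fin d → ℤ)) (z : Fin d → ℝ),
    ∑ m ∈ s, ((1 + ‖z - rl m‖) ^ (2 * d))⁻¹ ≤ C := by
  classical
  obtain ⟨C, hC0, hC⟩ := exists_sum_int_le
  refine ⟨C ^ d, by positivity, fun s z => ?_⟩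
  have hsub : s ⊆ Fintype.piFinset fun i => s.image fun m => m i := by
    intro m hm
    rw [Fintype.mem_piFinset]
    exact fun i => Finset.mem_image_of_mem (fun m : Fin d → ℤ => m i) hm
  calc _ ≤ ∑ m ∈ s, ∏ i, ((1 + |z i - m i|) ^ 2)⁻¹ := by
        refine Finset.sum_le_sum fun m _ => ?_
        rw [Finset.prod_inv_distrib, pow_mul]
        have : ∏ i, (1 + |z i - m i|) ^ 2 ≤ ((1 + ‖z - rl m‖) ^ 2) ^ d := by
          calc _ ≤ ∏ _i : Fin d, (1 + ‖z - rl m‖) ^ 2 := by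
                refine Finset.prod_le_prod (fun _ _ => by positivity) fun i _ => ?_
                gcongr
                exact norm_le_pi_norm (z - rl m) i
            _ = _ := by simp
        have h0 : 0 < ∏ i, (1 + |z i - m i|) ^ 2 :=
          Finset.prod_pos fun i _ => by positivity
        gcongr
    _ ≤ ∑ m ∈ Fintype.piFinset fun i => s.image fun m => m i, ∏ i, ((1 + |z i - m i|) ^ 2)⁻¹ :=
        Finset.sum_le_sum_of_subset_of_nonneg hsub
          fun _ _ _ => Finset.prod_nonneg fun _ _ => by positivity
    _ = ∏ i, ∑ a ∈ s.image fun m => m i, ((1 + |z i - a|) ^ 2)⁻¹ :=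
        (Finset.prod_univ_sum (fun i => s.image fun m => m i)
          (fun i (a : ℤ) => ((1 + |z i - a|) ^ 2)⁻¹)).symm
    _ ≤ ∏ _i : Fin d, C := Finset.prod_le_prod
        (fun _ _ => Finset.sum_nonneg fun _ _ => by positivity) fun i _ => hC _ _
    _ = _ := by simp

/-- Square sum of wave packets at a point far away from all the tubes. -/
lemma exists_sum_extn_pk_le {Φ : (Fin d → ℝ) → Fin k → ℝ} (hΦ : ContDiff ℝ (⊤ : ℕ∞) Φ) (B : ℝ)
    (N : ℕ) :
    ∃ C : ℝ, 0 ≤ C ∧ ∀ r : ℝ, 1 ≤ r → ∀ 𝒯 : Finset ((Fin d → ℤ) × (Fin d → ℤ)),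
      (∀ T ∈ 𝒯, ‖frq r T.1‖ ≤ B) → ∀ w : (Fin d → ℝ) × (Fin k → ℝ), ‖w.2‖ ≤ r ^ 2 →
      ∀ L : ℝ, 1 ≤ L → (∀ T ∈ 𝒯, L ≤ 1 + ‖r⁻¹ • (w.1 + tg Φ w.2 (frq r T.1)) - rl T.2‖) →
        ∑ T ∈ 𝒯, ‖extn Φ (pk r T) w‖ ^ 2 ≤ C * (L ^ N)⁻¹ := by
  classical
  obtain ⟨C1, hC1, hK⟩ := norm_extn_pk_le hΦ B (N + d)
  obtain ⟨C2, hC2, hsum⟩ := exists_sum_lattice_le d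
  refine ⟨C1 ^ 2 * (4 * |B| + 1) ^ d * C2, by positivity, ?_⟩
  intro r hr 𝒯 h𝒯 w hw L hL hfar
  have hr0 : 0 < r := by linarith
  set z : (Fin d → ℤ) → (Fin d → ℝ) := fun n => r⁻¹ • (w.1 + tg Φ w.2 (frq r n)) with hz
  have h1 : ∀ T ∈ 𝒯, ‖extn Φ (pk r T) w‖ ^ 2 ≤
      C1 ^ 2 * (r ^ d)⁻¹ * (L ^ N)⁻¹ * ((1 + ‖z T.1 - rl T.2‖) ^ (2 * d))⁻¹ := by
    intro T hT
    have h2 := hK r hr T (h𝒯 T hT) w hw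
    have hL' : L ≤ 1 + ‖z T.1 - rl T.2‖ := hfar T hT
    have h1z : 1 ≤ 1 + ‖z T.1 - rl T.2‖ := by linarith [norm_nonneg (z T.1 - rl T.2)]
    calc _ ≤ (C1 * (√(r ^ d))⁻¹ * ((1 + ‖z T.1 - rl T.2‖) ^ (N + d))⁻¹) ^ 2 := by
          gcongr
      _ = C1 ^ 2 * (r ^ d)⁻¹ * ((1 + ‖z T.1 - rl T.2‖) ^ (2 * N))⁻¹ *
          ((1 + ‖z T.1 - rl T.2‖) ^ (2 * d))⁻¹ := by
        rw [mul_pow, mul_pow, inv_pow, Real.sq_sqrt (by positivity)]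
        rw [mul_assoc (C1 ^ 2 * (r ^ d)⁻¹), ← mul_inv, ← pow_add, inv_pow, ← pow_mul]
        congr 3
        ring
      _ ≤ _ := by
        have h3 : L ^ N ≤ (1 + ‖z T.1 - rl T.2‖) ^ (2 * N) :=
          (pow_le_pow_left₀ (by linarith) hL' N).trans (pow_le_pow_right₀ h1z (by omega))
        have : 0 < L ^ N := by positivity
        gcongr
  refine (Finset.sum_le_sum h1).trans ?_
  rw [← Finset.mul_sum]
  have hcard : ((𝒯.image Prod.fst).card : ℝ) ≤ (4 * |B| + 1) ^ d * r ^ d := by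
    have h3 : ∀ n ∈ 𝒯.image Prod.fst, ‖rl n - 0‖ ≤ 2 * r * |B| := by
      intro n hn
      obtain ⟨T, hT, rfl⟩ := Finset.mem_image.1 hn
      have h4 := h𝒯 T hT
      unfold frq at h4
      rw [norm_smul, Real.norm_of_nonneg (by positivity)] at h4
      rw [sub_zero]
      have h5 : (2 * r)⁻¹ * ‖rl T.1‖ ≤ |B| := h4.trans (le_abs_self _)
      calc ‖rl T.1‖ = 2 * r * ((2 * r)⁻¹ * ‖rl T.1‖) := by field_simp
        _ ≤ _ := by gcongr
    refine (card_lattice_le _ 0 (by positivity) h3).trans ?_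
    rw [← mul_pow, Fintype.card_fin]
    gcongr
    nlinarith [abs_nonneg B]
  have hdouble : ∑ T ∈ 𝒯, ((1 + ‖z T.1 - rl T.2‖) ^ (2 * d))⁻¹ ≤
      ((𝒯.image Prod.fst).card : ℝ) * C2 := by
    calc _ ≤ ∑ T ∈ 𝒯.image Prod.fst ×ˢ 𝒯.image Prod.snd,
          ((1 + ‖z T.1 - rl T.2‖) ^ (2 * d))⁻¹ :=
          Finset.sum_le_sum_of_subset_of_nonneg Finset.subset_product fun _ _ _ => by positivity
      _ = ∑ n ∈ 𝒯.image Prod.fst, ∑ m ∈ 𝒯.image Prod.snd,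
          ((1 + ‖z n - rl m‖) ^ (2 * d))⁻¹ := Finset.sum_product _ _ _
      _ ≤ ∑ n ∈ 𝒯.image Prod.fst, C2 := Finset.sum_le_sum fun n _ => hsum _ _
      _ = _ := by simp
  calc _ ≤ C1 ^ 2 * (r ^ d)⁻¹ * (L ^ N)⁻¹ * (((4 * |B| + 1) ^ d * r ^ d) * C2) := by
        gcongr
        exact hdouble.trans (by gcongr)
    _ = _ := by
      field_simp

open FourierTransform in
lemma exists_band_limited : ∃ g : ℝ → ℂ, Continuous g ∧ Integrable (fun s => ‖g s‖ ^ 2) ∧ g 0 ≠ 0 ∧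
    ∀ z : ℝ, 4 ≤ |z| → ∫ s, ((‖g s‖ ^ 2 : ℝ) : ℂ) * ex (s * z) = 0 := by
  set b : ContDiffBump (0 : ℝ) := ⟨1, 2, by norm_num, by norm_num⟩
  set η : ℝ → ℂ := fun v => (b v : ℂ)
  have hη : ContDiff ℝ (⊤ : ℕ∞) η := Complex.ofRealCLM.contDiff.comp b.contDiff
  have hηz : ∀ v, 2 ≤ |v| → η v = 0 := fun v hv => by
    have : b v = 0 := b.zero_of_le_dist (by simpa [b] using hv)
    simp [η, this]
  have hsupp : ∀ z, HasCompactSupport fun v => η (v + z) := fun z =>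
    HasCompactSupport.intro (isCompact_closedBall (-z) 2) fun v hv => hηz _ (by
      rw [Metric.mem_closedBall, Real.dist_eq, sub_neg_eq_add] at hv
      exact (not_le.1 hv).le)
  have hsm : ∀ z, ContDiff ℝ (⊤ : ℕ∞) fun v => η (v + z) := fun z => by fun_prop
  set f := fun z => (hsupp z).toSchwartzMap (hsm z)
  have hf : ∀ z v, f z v = η (v + z) := fun z v => rfl
  have hF : ∀ z ξ, 𝓕 (f z) ξ = ex (ξ * z) * 𝓕 (f 0) ξ := by
    intro z ξ
    rw [SchwartzMap.fourier_coe, SchwartzMap.fourier_coe, Real.fourier_real_eq,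
      Real.fourier_real_eq, ← integral_const_mul,
      ← integral_add_right_eq_self (fun v => ex (ξ * z) * (Real.fourierChar (-(v * ξ)) • f 0 v)) z]
    congr 1
    funext v
    rw [hf, hf, Circle.smul_def, Circle.smul_def, ← ex_eq_fourierChar, ← ex_eq_fourierChar,
      smul_eq_mul, smul_eq_mul, ← mul_assoc, ← ex_add]
    congr 2
    · ring
    · ring
  refine ⟨fun s => 𝓕 (f 0) s, (𝓕 (f 0)).continuous, ?_, ?_, ?_⟩
  · have := (SchwartzMap.memLp (𝓕 (f 0)) 2 (volume : Measure ℝ)).integrable_norm_pow (by norm_num)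
    simpa using this
  · dsimp only
    rw [SchwartzMap.fourier_coe, Real.fourier_real_eq]
    simp only [mul_zero, neg_zero, AddChar.map_zero_eq_one, one_smul]
    have h1 : ∫ v, f 0 v = ((∫ v, b v : ℝ) : ℂ) := by
      rw [← integral_complex_ofReal]
      congr 1
      funext v
      simp [hf, η]
    rw [h1]
    exact_mod_cast b.integral_pos.ne'
  · intro z hz
    have h1 := SchwartzMap.integral_inner_fourier_fourier (f 0) (f z)
    have h2 : ∫ x, inner ℂ (f 0 x) (f z x) = 0 := by
      rw [← integral_zero ℝ ℂ]
      congr 1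
      funext x
      rw [hf, hf, add_zero]
      rcases le_total 2 |x| with h | h
      · simp [hηz x h]
      · rw [hηz (x + z) (by
          have := abs_sub_abs_le_abs_sub z (-x)
          rw [abs_neg, sub_neg_eq_add, add_comm] at this
          linarith)]
        simp
    rw [h2] at h1
    rw [← h1]
    congr 1
    funext s
    rw [hF z s, RCLike.inner_apply, mul_assoc, Complex.mul_conj']
    push_cast
    ring

/-- A nonnegative band-limited function dominating the indicator of an interval. -/
lemma exists_cutoff : ∃ (ψ : ℝ → ℝ) (Λ : ℝ), 0 < Λ ∧ Continuous ψ ∧ (∀ s, 0 ≤ ψ s) ∧ Integrable ψ ∧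
    (∀ s, |s| ≤ 1 / 2 → 1 ≤ ψ s) ∧ ∀ z : ℝ, Λ ≤ |z| → ∫ s, (ψ s : ℂ) * ex (s * z) = 0 := by
  obtain ⟨g, hgc, hgi, hg0, hgz⟩ := exists_band_limited
  set c := ‖g 0‖ ^ 2 / 2 with hc
  have hc0 : 0 < c := by positivity
  have hev : ∀ᶠ s in nhds (0 : ℝ), c < ‖g s‖ ^ 2 := by
    have h1 : Filter.Tendsto (fun s => ‖g s‖ ^ 2) (nhds 0) (nhds (‖g 0‖ ^ 2)) :=
      (hgc.norm.pow 2).continuousAt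
    exact h1.eventually (lt_mem_nhds (by
      have : 0 < ‖g 0‖ ^ 2 := by positivity
      rw [hc]; linarith))
  obtain ⟨θ, hθ, hθb⟩ := Metric.eventually_nhds_iff.1 hev
  refine ⟨fun s => c⁻¹ * ‖g (θ * s)‖ ^ 2, 4 * θ, by positivity, by fun_prop,
    fun s => by positivity, ?_, ?_, ?_⟩
  · exact (hgi.comp_mul_left' hθ.ne').const_mul _
  · intro s hs
    have h1 := hθb (y := θ * s) (by
      rw [Real.dist_eq, sub_zero, abs_mul, abs_of_pos hθ]
      nlinarith)
    change 1 ≤ c⁻¹ * _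
    rw [inv_mul_eq_div, le_div_iff₀ hc0]
    linarith
  · intro z hz
    have h1 := hgz (z / θ) (by
      rw [abs_div, abs_of_pos hθ, le_div_iff₀ hθ]; exact hz)
    have h2 := Measure.integral_comp_mul_left
      (fun s => ((‖g s‖ ^ 2 : ℝ) : ℂ) * ex (s * (z / θ))) θ
    rw [h1, smul_zero] at h2
    calc _ = ∫ s, (c⁻¹ : ℂ) * (((‖g (θ * s)‖ ^ 2 : ℝ) : ℂ) * ex (θ * s * (z / θ))) := by
          congr 1
          funext s
          rw [show θ * s * (z / θ) = s * z by field_simp]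
          push_cast
          ring
      _ = 0 := by rw [integral_const_mul, h2, mul_zero]

/-- The tensor product of rescaled cutoffs, adapted to a cube of sidelength `r` centred at `c`. -/
def cut (ψ : ℝ → ℝ) (r : ℝ) (c w : (Fin d → ℝ) × (Fin k → ℝ)) : ℝ :=
  (∏ i, ψ (r⁻¹ * (w.1 i - c.1 i))) * ∏ j, ψ (r⁻¹ * (w.2 j - c.2 j))

lemma cut_nonneg {ψ : ℝ → ℝ} (h : ∀ s, 0 ≤ ψ s) (r : ℝ) (c w : (Fin d → ℝ) × (Fin k → ℝ)) :
    0 ≤ cut ψ r c w :=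
  mul_nonneg (Finset.prod_nonneg fun _ _ => h _) (Finset.prod_nonneg fun _ _ => h _)

lemma one_le_cut {ψ : ℝ → ℝ} (h : ∀ s, |s| ≤ 1 / 2 → 1 ≤ ψ s) {r : ℝ} (hr : 0 < r)
    {c w : (Fin d → ℝ) × (Fin k → ℝ)} (hw : w ∈ cubeQ d k r c) : 1 ≤ cut ψ r c w := by
  have hs : ∀ a : ℝ, |a| ≤ r / 2 → 1 ≤ ψ (r⁻¹ * a) := fun a ha => h _ (by
    rw [abs_mul, abs_of_pos (by positivity), inv_mul_le_iff₀ hr]; linarith)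
  have h1 : 1 ≤ ∏ i, ψ (r⁻¹ * (w.1 i - c.1 i)) := Finset.one_le_prod fun i _ => hs _ (hw.1 i)
  have h2 : 1 ≤ ∏ j, ψ (r⁻¹ * (w.2 j - c.2 j)) := Finset.one_le_prod fun i _ => hs _ (hw.2 i)
  exact one_le_mul_of_one_le_of_one_le h1 h2

lemma integrable_rescale {ψ : ℝ → ℝ} (h : Integrable ψ) {r : ℝ} (hr : 0 < r) (c : ℝ) :
    Integrable fun s => ψ (r⁻¹ * (s - c)) :=
  (h.comp_mul_left' (inv_ne_zero hr.ne')).comp_sub_right c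

lemma integrable_cut {ψ : ℝ → ℝ} (h : Integrable ψ) {r : ℝ} (hr : 0 < r)
    (c : (Fin d → ℝ) × (Fin k → ℝ)) : Integrable (cut ψ r c) := by
  unfold cut
  exact Integrable.mul_prod
    (f := fun x : Fin d → ℝ => ∏ i, ψ (r⁻¹ * (x i - c.1 i)))
    (g := fun x : Fin k → ℝ => ∏ i, ψ (r⁻¹ * (x i - c.2 i)))
    (Integrable.fintype_prod_dep (f := fun i s => ψ (r⁻¹ * (s - c.1 i)))
      fun i => integrable_rescale h hr _)
    (Integrable.fintype_prod_dep (f := fun i s => ψ (r⁻¹ * (s - c.2 i)))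
      fun i => integrable_rescale h hr _)

lemma integral_cut {ψ : ℝ → ℝ} {r : ℝ} (hr : 0 < r)
    (c : (Fin d → ℝ) × (Fin k → ℝ)) :
    ∫ w, cut ψ r c w = (r * ∫ s, ψ s) ^ (d + k) := by
  have h1 : ∀ c, ∫ s, ψ (r⁻¹ * (s - c)) = r * ∫ s, ψ s := fun c => by
    rw [integral_sub_right_eq_self (fun s => ψ (r⁻¹ * s)), Measure.integral_comp_mul_left]
    simp [abs_of_pos hr]
  unfold cut
  rw [Measure.volume_eq_prod, integral_prod_mul
    (f := fun x : Fin d → ℝ => ∏ i, ψ (r⁻¹ * (x i - c.1 i)))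
    (g := fun x : Fin k → ℝ => ∏ i, ψ (r⁻¹ * (x i - c.2 i))),
    integral_fintype_prod_volume_eq_prod (fun i s => ψ (r⁻¹ * (s - c.1 i))),
    integral_fintype_prod_volume_eq_prod (fun i s => ψ (r⁻¹ * (s - c.2 i)))]
  simp [h1, pow_add]

lemma ex_sum {ι : Type*} (s : Finset ι) (f : ι → ℝ) : ex (∑ i ∈ s, f i) = ∏ i ∈ s, ex (f i) := by
  classical
  induction s using Finset.induction_on with
  | empty => simp [ex_zero]
  | insert a s ha ih => rw [Finset.sum_insert ha, Finset.prod_insert ha, ex_add, ih]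

/-- The cutoff has no high frequencies. -/
lemma integral_cut_mul_ex {ψ : ℝ → ℝ} {Λ : ℝ}
    (hψ : ∀ z : ℝ, Λ ≤ |z| → ∫ s, (ψ s : ℂ) * ex (s * z) = 0) {r : ℝ} (hr : 0 < r)
    (c u : (Fin d → ℝ) × (Fin k → ℝ)) (hu : (∃ i, Λ ≤ r * |u.1 i|) ∨ ∃ j, Λ ≤ r * |u.2 j|) :
    ∫ w : (Fin d → ℝ) × (Fin k → ℝ), (cut ψ r c w : ℂ) * ex (w.1 ⬝ᵥ u.1 + w.2 ⬝ᵥ u.2) = 0 := by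
  have h1 : ∀ c z : ℝ, Λ ≤ r * |z| → ∫ s, (ψ (r⁻¹ * (s - c)) : ℂ) * ex (s * z) = 0 := by
    intro c z hz
    have h2 := integral_sub_right_eq_self
      (fun s => (ψ (r⁻¹ * s) : ℂ) * (ex (r⁻¹ * s * (r * z)) * ex (c * z))) (μ := volume) c
    have h3 := Measure.integral_comp_mul_left
      (fun s => (ψ s : ℂ) * (ex (s * (r * z)) * ex (c * z))) r⁻¹
    have h4 : ∫ s, (ψ s : ℂ) * (ex (s * (r * z)) * ex (c * z)) = 0 := by
      simp_rw [← mul_assoc (Complex.ofReal _)]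
      rw [integral_mul_const, hψ (r * z) (by rwa [abs_mul, abs_of_pos hr]), zero_mul]
    rw [h3, h4, smul_zero] at h2
    rw [← h2]
    congr 1
    funext s
    rw [← ex_add]
    congr 2
    field_simp
    ring
  have h5 : ∀ w : (Fin d → ℝ) × (Fin k → ℝ),
      (cut ψ r c w : ℂ) * ex (w.1 ⬝ᵥ u.1 + w.2 ⬝ᵥ u.2) =
      (∏ i, (ψ (r⁻¹ * (w.1 i - c.1 i)) : ℂ) * ex (w.1 i * u.1 i)) *
        ∏ j, (ψ (r⁻¹ * (w.2 j - c.2 j)) : ℂ) * ex (w.2 j * u.2 j) := by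
    intro w
    unfold cut
    rw [ex_add, dotProduct, dotProduct, ex_sum, ex_sum, Finset.prod_mul_distrib,
      Finset.prod_mul_distrib]
    push_cast
    ring
  simp_rw [h5]
  rw [Measure.volume_eq_prod, integral_prod_mul
    (f := fun x : Fin d → ℝ => ∏ i, (ψ (r⁻¹ * (x i - c.1 i)) : ℂ) * ex (x i * u.1 i))
    (g := fun x : Fin k → ℝ => ∏ i, (ψ (r⁻¹ * (x i - c.2 i)) : ℂ) * ex (x i * u.2 i)),
    integral_fintype_prod_volume_eq_prod
      (fun i s => (ψ (r⁻¹ * (s - c.1 i)) : ℂ) * ex (s * u.1 i)),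
    integral_fintype_prod_volume_eq_prod
      (fun i s => (ψ (r⁻¹ * (s - c.2 i)) : ℂ) * ex (s * u.2 i))]
  rcases hu with ⟨i, hi⟩ | ⟨j, hj⟩
  · rw [Finset.prod_eq_zero (Finset.mem_univ i) (h1 _ _ hi), zero_mul]
  · rw [Finset.prod_eq_zero (Finset.mem_univ j) (h1 _ _ hj), mul_zero]

section Frequencies

variable {Ω Ω₂ : Type*} [MeasureSpace Ω] [MeasureSpace Ω₂] [SFinite (volume : Measure Ω)]
  [SFinite (volume : Measure Ω₂)]

/-- The Fourier transform of a density `f` pushed forward along a frequency map `p`. -/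
def pext (p : Ω → (Fin d → ℝ) × (Fin k → ℝ)) (f : Ω → ℂ) (w : (Fin d → ℝ) × (Fin k → ℝ)) : ℂ :=
  ∫ ω, ex (w.1 ⬝ᵥ (p ω).1 + w.2 ⬝ᵥ (p ω).2) * f ω

omit [SFinite (volume : Measure Ω)] in
lemma conj_pext (p : Ω → (Fin d → ℝ) × (Fin k → ℝ)) (f : Ω → ℂ) (w : (Fin d → ℝ) × (Fin k → ℝ)) :
    (starRingEnd ℂ) (pext p f w) = pext (fun ω => -p ω) (fun ω => (starRingEnd ℂ) (f ω)) w := by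
  unfold pext
  rw [← integral_conj]
  congr 1
  funext ω
  rw [map_mul, conj_ex]
  congr 2
  simp only [Prod.fst_neg, Prod.snd_neg, dotProduct_neg]
  ring

lemma pext_mul_pext (p : Ω → (Fin d → ℝ) × (Fin k → ℝ)) (f : Ω → ℂ)
    (p' : Ω₂ → (Fin d → ℝ) × (Fin k → ℝ)) (f' : Ω₂ → ℂ) (w : (Fin d → ℝ) × (Fin k → ℝ)) :
    pext p f w * pext p' f' w =
      pext (fun z : Ω × Ω₂ => p z.1 + p' z.2) (fun z => f z.1 * f' z.2) w := by
  unfold pext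
  rw [← integral_prod_mul, ← Measure.volume_eq_prod]
  congr 1
  funext z
  simp only [Prod.fst_add, Prod.snd_add, dotProduct_add]
  have h : ex (w.1 ⬝ᵥ (p z.1).1 + w.1 ⬝ᵥ (p' z.2).1 + (w.2 ⬝ᵥ (p z.1).2 + w.2 ⬝ᵥ (p' z.2).2)) =
      ex (w.1 ⬝ᵥ (p z.1).1 + w.2 ⬝ᵥ (p z.1).2) * ex (w.1 ⬝ᵥ (p' z.2).1 + w.2 ⬝ᵥ (p' z.2).2) := by
    rw [← ex_add]
    congr 1
    ring
  rw [h]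
  ring

omit [SFinite (volume : Measure Ω)] in
lemma measurable_ex_dot {p : Ω → (Fin d → ℝ) × (Fin k → ℝ)} (hp : Measurable p) :
    Measurable fun z : ((Fin d → ℝ) × (Fin k → ℝ)) × Ω =>
      ex (z.1.1 ⬝ᵥ (p z.2).1 + z.1.2 ⬝ᵥ (p z.2).2) := by
  refine continuous_ex.measurable.comp ?_
  have h1 : Measurable fun z : ((Fin d → ℝ) × (Fin k → ℝ)) × Ω => (z.1, p z.2) :=
    measurable_fst.prodMk (hp.comp measurable_snd)
  have h2 : Continuous fun z : ((Fin d → ℝ) × (Fin k → ℝ)) × ((Fin d → ℝ) × (Fin k → ℝ)) =>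
      z.1.1 ⬝ᵥ z.2.1 + z.1.2 ⬝ᵥ z.2.2 :=
    ((continuous_fst.comp continuous_fst).dotProduct (continuous_fst.comp continuous_snd)).add
      ((continuous_snd.comp continuous_fst).dotProduct (continuous_snd.comp continuous_snd))
  exact h2.measurable.comp h1

omit [SFinite (volume : Measure Ω)] in
lemma continuous_pext {p : Ω → (Fin d → ℝ) × (Fin k → ℝ)} (hp : Measurable p) {f : Ω → ℂ}
    (hf : Integrable f) : Continuous (pext p f) := by
  refine continuous_of_dominated (bound := fun ω => ‖f ω‖) (fun w => ?_) (fun w => ?_) hf.norm ?_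
  · exact ((measurable_ex_dot hp).comp
      (measurable_const.prodMk measurable_id)).aestronglyMeasurable.mul hf.1
  · exact Filter.Eventually.of_forall fun ω => by rw [norm_mul, norm_ex, one_mul]
  · refine Filter.Eventually.of_forall fun ω => ?_
    have h2 : Continuous fun z : (Fin d → ℝ) × (Fin k → ℝ) =>
        z.1 ⬝ᵥ (p ω).1 + z.2 ⬝ᵥ (p ω).2 :=
      (continuous_fst.dotProduct continuous_const).add (continuous_snd.dotProduct continuous_const)
    exact (continuous_ex.comp h2).mul continuous_const

omit [SFinite (volume : Measure Ω)] in
lemma norm_pext_le (p : Ω → (Fin d → ℝ) × (Fin k → ℝ)) (f : Ω → ℂ)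
    (w : (Fin d → ℝ) × (Fin k → ℝ)) : ‖pext p f w‖ ≤ ∫ ω, ‖f ω‖ := by
  refine (norm_integral_le_integral_norm _).trans (le_of_eq ?_)
  congr 1
  funext ω
  rw [norm_mul, norm_ex, one_mul]

lemma integral_cut_mul_pext {ψ : ℝ → ℝ} {Λ : ℝ} (hψi : Integrable ψ)
    (hψ : ∀ z : ℝ, Λ ≤ |z| → ∫ s, (ψ s : ℂ) * ex (s * z) = 0) {r : ℝ} (hr : 0 < r)
    (c : (Fin d → ℝ) × (Fin k → ℝ)) {p : Ω → (Fin d → ℝ) × (Fin k → ℝ)} (hp : Measurable p)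
    {f : Ω → ℂ} (hf : Integrable f)
    (h : ∀ ω, f ω = 0 ∨ (∃ i, Λ ≤ r * |(p ω).1 i|) ∨ ∃ j, Λ ≤ r * |(p ω).2 j|) :
    ∫ w, (cut ψ r c w : ℂ) * pext p f w = 0 := by
  have h1 : ∀ w, (cut ψ r c w : ℂ) * pext p f w =
      ∫ ω, ex (w.1 ⬝ᵥ (p ω).1 + w.2 ⬝ᵥ (p ω).2) * ((cut ψ r c w : ℂ) * f ω) := by
    intro w
    unfold pext
    rw [← integral_const_mul]
    congr 1
    funext ω
    ring
  simp_rw [h1]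
  rw [integral_integral_swap]
  · rw [← integral_zero Ω ℂ]
    congr 1
    funext ω
    rcases h ω with h0 | h0
    · simp [h0]
    · have h2 := integral_cut_mul_ex hψ hr c (p ω) h0
      calc _ = ∫ w : (Fin d → ℝ) × (Fin k → ℝ), (cut ψ r c w : ℂ) *
            ex (w.1 ⬝ᵥ (p ω).1 + w.2 ⬝ᵥ (p ω).2) * f ω := by
              congr 1
              funext w
              ring
        _ = 0 := by rw [integral_mul_const, h2, zero_mul]
  · refine Integrable.bdd_mul (c := 1) ((integrable_cut hψi hr c).ofReal.mul_prod hf)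
      (measurable_ex_dot hp).aestronglyMeasurable
      (Filter.Eventually.of_forall fun z => (norm_ex _).le)

end Frequencies

lemma extn_eq_pext (Φ : (Fin d → ℝ) → Fin k → ℝ) (f : (Fin d → ℝ) → ℂ) :
    extn Φ f = pext (fun ξ => (ξ, Φ ξ)) f := rfl

lemma measurable_graph {Φ : (Fin d → ℝ) → Fin k → ℝ} (hΦ : Continuous Φ) :
    Measurable fun ξ : Fin d → ℝ => (ξ, Φ ξ) := measurable_id.prodMk hΦ.measurable

lemma continuous_extn {Φ : (Fin d → ℝ) → Fin k → ℝ} (hΦ : Continuous Φ) {f : (Fin d → ℝ) → ℂ}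
    (hf : Integrable f) : Continuous (extn Φ f) := continuous_pext (measurable_graph hΦ) hf

lemma norm_extn_le (Φ : (Fin d → ℝ) → Fin k → ℝ) (f : (Fin d → ℝ) → ℂ)
    (w : (Fin d → ℝ) × (Fin k → ℝ)) : ‖extn Φ f w‖ ≤ ∫ ξ, ‖f ξ‖ :=
  norm_pext_le (fun ξ => (ξ, Φ ξ)) f w

lemma contDiff_pk (r : ℝ) (T : (Fin d → ℤ) × (Fin d → ℤ)) : ContDiff ℝ (⊤ : ℕ∞) (pk r T) := by
  unfold pk
  have h1 : ContDiff ℝ (⊤ : ℕ∞) (scl r T.1) := by unfold scl; fun_prop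
  have h2 : ContDiff ℝ (⊤ : ℕ∞) fun ξ => -(rl T.2 ⬝ᵥ scl r T.1 ξ) := by
    have : ContDiff ℝ (⊤ : ℕ∞) fun ξ => dotL (rl T.2) (scl r T.1 ξ) :=
      (dotL (rl T.2)).contDiff.comp h1
    exact this.neg
  exact (Complex.ofRealCLM.contDiff.comp
    (contDiff_const.mul (contDiff_bump.comp h1))).mul (contDiff_ex.comp h2)

lemma norm_scl {r : ℝ} (hr : 0 < r) (n : Fin d → ℤ) (ξ : Fin d → ℝ) :
    ‖scl r n ξ‖ = r * ‖ξ - frq r n‖ := by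
  have : scl r n ξ = r • (ξ - frq r n) := by
    unfold scl frq
    ext i
    simp
    field_simp
  rw [this, norm_smul, Real.norm_of_nonneg hr.le]

lemma pk_eq_zero {r : ℝ} (hr : 0 < r) {T : (Fin d → ℤ) × (Fin d → ℤ)} {ξ : Fin d → ℝ}
    (h : 1 / 2 ≤ r * ‖ξ - frq r T.1‖) : pk r T ξ = 0 := by
  unfold pk
  rw [bump_eq_zero (by rwa [norm_scl hr])]
  simp

lemma hasCompactSupport_pk {r : ℝ} (hr : 0 < r) (T : (Fin d → ℤ) × (Fin d → ℤ)) :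
    HasCompactSupport (pk r T) :=
  HasCompactSupport.intro (isCompact_closedBall (frq r T.1) (1 / 2 * r⁻¹)) fun ξ hξ =>
    pk_eq_zero hr (by
      rw [Metric.mem_closedBall, dist_eq_norm, not_le] at hξ
      rw [← div_eq_mul_inv, div_lt_iff₀ hr] at hξ
      linarith)

lemma integrable_pk {r : ℝ} (hr : 0 < r) (T : (Fin d → ℤ) × (Fin d → ℤ)) :
    Integrable (pk r T) :=
  (contDiff_pk r T).continuous.integrable_of_hasCompactSupport (hasCompactSupport_pk hr T)

/-- The uniform bound for wave packets. -/
lemma norm_extn_pk_le_const (Φ : (Fin d → ℝ) → Fin k → ℝ) {r : ℝ} (hr : 0 < r)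
    (T : (Fin d → ℤ) × (Fin d → ℤ)) (w : (Fin d → ℝ) × (Fin k → ℝ)) :
    ‖extn Φ (pk r T) w‖ ≤ (√(r ^ d))⁻¹ * ∫ v, bump d v := by
  rw [extn_pk Φ hr, norm_mul, norm_mul, norm_ex, mul_one, Complex.norm_real,
    Real.norm_of_nonneg (by positivity)]
  gcongr
  refine (norm_integral_le_integral_norm _).trans (le_of_eq ?_)
  congr 1
  funext v
  rw [norm_mul, norm_mul, norm_ex, norm_ex, one_mul, mul_one, Complex.norm_real,
    Real.norm_of_nonneg (bump d).nonneg]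

/-- The resonance relation between four frequency labels. -/
def Res (Φ : (Fin d → ℝ) → Fin k → ℝ) (r Λ : ℝ) (n₁ n₁' n₂ n₂' : Fin d → ℤ) : Prop :=
  ‖frq r n₁ - frq r n₁' + (frq r n₂ - frq r n₂')‖ ≤ Λ * r⁻¹ ∧
    ‖Φ (frq r n₁) - Φ (frq r n₁') + (Φ (frq r n₂) - Φ (frq r n₂'))‖ ≤ Λ * r⁻¹

lemma exists_lipschitz_ball {E : Type*} [NormedAddCommGroup E] [NormedSpace ℝ E]
    {Φ : (Fin d → ℝ) → E} (hΦ : ContDiff ℝ (⊤ : ℕ∞) Φ) (B : ℝ) :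
    ∃ L : ℝ, 0 ≤ L ∧ ∀ x y : Fin d → ℝ, ‖x‖ ≤ B → ‖y‖ ≤ B → ‖Φ x - Φ y‖ ≤ L * ‖x - y‖ := by
  have hc : Continuous (fderiv ℝ Φ) := hΦ.continuous_fderiv (by simp)
  obtain ⟨C, hC⟩ := (isCompact_closedBall (0 : Fin d → ℝ) B).exists_bound_of_continuousOn
      hc.continuousOn
  refine ⟨max C 0, le_max_right _ _, fun x y hx hy => ?_⟩
  exact (convex_closedBall (0 : Fin d → ℝ) B).norm_image_sub_le_of_norm_fderiv_le
    (𝕜 := ℝ) (fun z _ => hΦ.differentiable (by simp) z)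
    (fun z hz => (hC z hz).trans (le_max_left _ _)) (by simpa using hy) (by simpa using hx)

lemma norm_four_le {E : Type*} [NormedAddCommGroup E] (a b c e a' b' c' e' : E) :
    ‖a - b + (c - e)‖ ≤ ‖a' - b' + (c' - e')‖ + (‖a' - a‖ + ‖b' - b‖ + ‖c' - c‖ + ‖e' - e‖) := by
  have h : a - b + (c - e) = (a' - b' + (c' - e')) +
      (-(a' - a) + (b' - b) + (-(c' - c)) + (e' - e)) := by abel
  rw [h]
  refine (norm_add_le _ _).trans ?_
  gcongr
  refine (norm_add₄_le).trans ?_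
  rw [norm_neg, norm_neg]

/-- Orthogonality and size of quadrilinear integrals of wave packets. -/
lemma exists_integral_quad {Φ : (Fin d → ℝ) → Fin k → ℝ} (hΦ : ContDiff ℝ (⊤ : ℕ∞) Φ) (B : ℝ)
    {ψ : ℝ → ℝ} {Λ₀ : ℝ} (hΛ₀ : 0 < Λ₀) (hψ0 : ∀ s, 0 ≤ ψ s) (hψi : Integrable ψ)
    (hψ : ∀ z : ℝ, Λ₀ ≤ |z| → ∫ s, (ψ s : ℂ) * ex (s * z) = 0) :
    ∃ Λ : ℝ, 0 < Λ ∧ ∃ C : ℝ, 0 ≤ C ∧ ∀ r : ℝ, 1 ≤ r → ∀ T₁ T₁' T₂ T₂' : (Fin d → ℤ) × (Fin d → ℤ),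
      ‖frq r T₁.1‖ ≤ B → ‖frq r T₁'.1‖ ≤ B → ‖frq r T₂.1‖ ≤ B → ‖frq r T₂'.1‖ ≤ B →
      ∀ c : (Fin d → ℝ) × (Fin k → ℝ),
      Integrable (fun w => (cut ψ r c w : ℂ) *
          ((extn Φ (pk r T₁) w * (starRingEnd ℂ) (extn Φ (pk r T₁') w)) *
          (extn Φ (pk r T₂) w * (starRingEnd ℂ) (extn Φ (pk r T₂') w)))) ∧
      (¬ Res Φ r Λ T₁.1 T₁'.1 T₂.1 T₂'.1 → ∫ w, (cut ψ r c w : ℂ) *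
          ((extn Φ (pk r T₁) w * (starRingEnd ℂ) (extn Φ (pk r T₁') w)) *
          (extn Φ (pk r T₂) w * (starRingEnd ℂ) (extn Φ (pk r T₂') w))) = 0) ∧
      ‖∫ w, (cut ψ r c w : ℂ) *
          ((extn Φ (pk r T₁) w * (starRingEnd ℂ) (extn Φ (pk r T₁') w)) *
          (extn Φ (pk r T₂) w * (starRingEnd ℂ) (extn Φ (pk r T₂') w)))‖ ≤ C * (r ^ k * (r ^ d)⁻¹) := by
  obtain ⟨L, hL0, hL⟩ := exists_lipschitz_ball hΦ (B + 1)
  have hΦc : Continuous Φ := hΦ.continuous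
  refine ⟨Λ₀ + 2 * (1 + L), by positivity, (∫ v, bump d v) ^ 4 * (∫ s, ψ s) ^ (d + k), ?_, ?_⟩
  · have h1 : 0 ≤ ∫ s, ψ s := integral_nonneg hψ0
    positivity
  intro r hr T₁ T₁' T₂ T₂' h₁ h₁' h₂ h₂' c
  have hr0 : 0 < r := by linarith
  have hbd : ∀ w, ‖(extn Φ (pk r T₁) w * (starRingEnd ℂ) (extn Φ (pk r T₁') w)) *
          (extn Φ (pk r T₂) w * (starRingEnd ℂ) (extn Φ (pk r T₂') w))‖ ≤
          (∫ v, bump d v) ^ 4 * ((r ^ d)⁻¹) ^ 2 := by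
    intro w
    have hI : 0 ≤ ∫ v, bump d v := integral_nonneg fun v => (bump d).nonneg
    have h := fun T => norm_extn_pk_le_const Φ hr0 T w
    rw [norm_mul, norm_mul, norm_mul, RCLike.norm_conj, RCLike.norm_conj]
    calc _ ≤ ((√(r ^ d))⁻¹ * ∫ v, bump d v) * ((√(r ^ d))⁻¹ * ∫ v, bump d v) *
          (((√(r ^ d))⁻¹ * ∫ v, bump d v) * ((√(r ^ d))⁻¹ * ∫ v, bump d v)) := by
          gcongr <;> exact h _
      _ = (∫ v, bump d v) ^ 4 * (((√(r ^ d))⁻¹) ^ 2) ^ 2 := by ring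
      _ = _ := by rw [inv_pow, Real.sq_sqrt (by positivity)]
  have hinteg : Integrable (fun w => (cut ψ r c w : ℂ) *
          ((extn Φ (pk r T₁) w * (starRingEnd ℂ) (extn Φ (pk r T₁') w)) *
          (extn Φ (pk r T₂) w * (starRingEnd ℂ) (extn Φ (pk r T₂') w)))) := by
    refine Integrable.mul_bdd (integrable_cut hψi hr0 c).ofReal ?_
      (Filter.Eventually.of_forall hbd)
    have hce := fun T => continuous_extn hΦc (integrable_pk hr0 T)
    refine Continuous.aestronglyMeasurable ?_
    exact ((hce _).mul (Complex.continuous_conj.comp (hce _))).mul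
      ((hce _).mul (Complex.continuous_conj.comp (hce _)))
  refine ⟨hinteg, ?_, ?_⟩
  · intro hres
    simp_rw [extn_eq_pext, conj_pext, pext_mul_pext]
    have hm := measurable_graph hΦc
    have hic : ∀ T, Integrable fun ξ : Fin d → ℝ => (starRingEnd ℂ) (pk r T ξ) := fun T =>
      Complex.conjCLE.toContinuousLinearMap.integrable_comp
        (μ := (volume : Measure (Fin d → ℝ))) (φ := pk r T) (integrable_pk hr0 T)
    refine integral_cut_mul_pext hψi hψ hr0 c ?_
      (((integrable_pk hr0 T₁).mul_prod (hic T₁')).mul_prod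
        ((integrable_pk hr0 T₂).mul_prod (hic T₂'))) ?_
    · exact ((hm.comp (measurable_fst.comp measurable_fst)).add
        (hm.comp (measurable_snd.comp measurable_fst)).neg).add
        ((hm.comp (measurable_fst.comp measurable_snd)).add
        (hm.comp (measurable_snd.comp measurable_snd)).neg)
    · rintro ⟨⟨ξ₁, ξ₁'⟩, ⟨ξ₂, ξ₂'⟩⟩
      by_contra! hcon
      obtain ⟨hne, hlow1, hlow2⟩ := hcon
      simp only [ne_eq, mul_eq_zero, map_eq_zero, not_or] at hne
      have hsup : ∀ T : (Fin d → ℤ) × (Fin d → ℤ), ∀ ξ, ¬ pk r T ξ = 0 →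
          ‖ξ - frq r T.1‖ ≤ 1 / 2 * r⁻¹ := by
        intro T ξ h
        by_contra hh
        refine h (pk_eq_zero hr0 ?_)
        rw [not_le, ← div_eq_mul_inv, div_lt_iff₀ hr0] at hh
        linarith
      have hd1 := hsup _ _ hne.1.1
      have hd1' := hsup _ _ hne.1.2
      have hd2 := hsup _ _ hne.2.1
      have hd2' := hsup _ _ hne.2.2
      have hri : r⁻¹ ≤ 1 := inv_le_one_of_one_le₀ hr
      have hlip : ∀ (n : Fin d → ℤ) (ξ : Fin d → ℝ), ‖frq r n‖ ≤ B → ‖ξ - frq r n‖ ≤ 1 / 2 * r⁻¹ →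
          ‖Φ ξ - Φ (frq r n)‖ ≤ L * (1 / 2 * r⁻¹) := by
        intro n ξ hn hξ
        refine (hL ξ (frq r n) ?_ (by linarith)).trans (by gcongr)
        have := norm_add_le (ξ - frq r n) (frq r n)
        rw [sub_add_cancel] at this
        linarith
      apply hres
      constructor
      · refine (norm_four_le _ _ _ _ ξ₁ ξ₁' ξ₂ ξ₂').trans ?_
        have hlow : ‖ξ₁ - ξ₁' + (ξ₂ - ξ₂')‖ ≤ Λ₀ * r⁻¹ := by
          rw [pi_norm_le_iff_of_nonneg (by positivity)]
          intro i
          have := hlow1 i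
          simp only [Prod.fst_add, Prod.fst_neg, Pi.add_apply, Pi.neg_apply] at this
          rw [Real.norm_eq_abs, ← div_eq_mul_inv, le_div_iff₀ hr0, mul_comm]
          simpa [sub_eq_add_neg] using this.le
        have : 0 ≤ L * r⁻¹ := by positivity
        linarith
      · refine (norm_four_le _ _ _ _ (Φ ξ₁) (Φ ξ₁') (Φ ξ₂) (Φ ξ₂')).trans ?_
        have hlow : ‖Φ ξ₁ - Φ ξ₁' + (Φ ξ₂ - Φ ξ₂')‖ ≤ Λ₀ * r⁻¹ := by
          rw [pi_norm_le_iff_of_nonneg (by positivity)]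
          intro i
          have := hlow2 i
          simp only [Prod.snd_add, Prod.snd_neg, Pi.add_apply, Pi.neg_apply] at this
          rw [Real.norm_eq_abs, ← div_eq_mul_inv, le_div_iff₀ hr0, mul_comm]
          simpa [sub_eq_add_neg] using this.le
        have := hlip _ _ h₁ hd1
        have := hlip _ _ h₁' hd1'
        have := hlip _ _ h₂ hd2
        have := hlip _ _ h₂' hd2'
        have : 0 ≤ r⁻¹ := by positivity
        linarith
  · refine (norm_integral_le_integral_norm _).trans ?_
    calc _ ≤ ∫ w, cut ψ r c w * ((∫ v, bump d v) ^ 4 * ((r ^ d)⁻¹) ^ 2) := by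
          refine integral_mono hinteg.norm ((integrable_cut hψi hr0 c).mul_const _) fun w => ?_
          dsimp only
          rw [norm_mul, Complex.norm_real, Real.norm_of_nonneg (cut_nonneg hψ0 _ _ _)]
          exact mul_le_mul_of_nonneg_left (hbd w) (cut_nonneg hψ0 _ _ _)
      _ = _ := by
        rw [integral_mul_const, integral_cut hr0, mul_pow, pow_add]
        field_simp

/-- A superposition of wave packets. -/
def syn (Φ : (Fin d → ℝ) → Fin k → ℝ) (r : ℝ) (𝒯 : Finset ((Fin d → ℤ) × (Fin d → ℤ)))
    (c : (Fin d → ℤ) × (Fin d → ℤ) → ℂ) (w : (Fin d → ℝ) × (Fin k → ℝ)) : ℂ :=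
  ∑ T ∈ 𝒯, c T * extn Φ (pk r T) w

lemma continuous_syn {Φ : (Fin d → ℝ) → Fin k → ℝ} (hΦ : Continuous Φ) {r : ℝ} (hr : 0 < r)
    (𝒯 : Finset ((Fin d → ℤ) × (Fin d → ℤ))) (c : (Fin d → ℤ) × (Fin d → ℤ) → ℂ) :
    Continuous (syn Φ r 𝒯 c) :=
  continuous_finsetSum _ fun T _ => continuous_const.mul (continuous_extn hΦ (integrable_pk hr T))

lemma measurableSet_cubeQ (R : ℝ) (c : (Fin d → ℝ) × (Fin k → ℝ)) :
    MeasurableSet (cubeQ d k R c) := by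
  have : IsClosed (cubeQ d k R c) := by
    have h : cubeQ d k R c = (⋂ i, {w | |w.1 i - c.1 i| ≤ R / 2}) ∩
        ⋂ j, {w | |w.2 j - c.2 j| ≤ R / 2} := by
      ext w
      simp [cubeQ]
    rw [h]
    refine (isClosed_iInter fun i => isClosed_le ?_ continuous_const).inter
      (isClosed_iInter fun j => isClosed_le ?_ continuous_const)
    · exact (((continuous_apply i).comp continuous_fst).sub continuous_const).abs
    · exact (((continuous_apply j).comp continuous_snd).sub continuous_const).abs
  exact this.measurableSet

open scoped Classical in
/-- The local `L²` estimate for products, reduced to resonant quadruples. -/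
lemma exists_setIntegral_le {Φ : (Fin d → ℝ) → Fin k → ℝ} (hΦ : ContDiff ℝ (⊤ : ℕ∞) Φ) (B : ℝ) :
    ∃ Λ : ℝ, 0 < Λ ∧ ∃ C : ℝ, 0 ≤ C ∧ ∀ r : ℝ, 1 ≤ r →
      ∀ (𝒜 ℬ : Finset ((Fin d → ℤ) × (Fin d → ℤ))) (a b : (Fin d → ℤ) × (Fin d → ℤ) → ℂ),
      (∀ T ∈ 𝒜, ‖frq r T.1‖ ≤ B) → (∀ T ∈ ℬ, ‖frq r T.1‖ ≤ B) →
      ∀ w₀ : (Fin d → ℝ) × (Fin k → ℝ),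
      ∫ w in cubeQ d k r w₀, ‖syn Φ r 𝒜 a w * syn Φ r ℬ b w‖ ^ 2 ≤
        C * (r ^ k * (r ^ d)⁻¹) * ∑ p ∈ 𝒜 ×ˢ 𝒜, ∑ q ∈ ℬ ×ˢ ℬ,
          if Res Φ r Λ p.1.1 p.2.1 q.1.1 q.2.1 then ‖a p.1‖ * ‖a p.2‖ * (‖b q.1‖ * ‖b q.2‖)
          else 0 := by
  obtain ⟨ψ, Λ₀, hΛ₀, hψc, hψ0, hψi, hψ1, hψ⟩ := exists_cutoff
  obtain ⟨Λ, hΛ, C, hC, h⟩ := exists_integral_quad hΦ B hΛ₀ hψ0 hψi hψ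
  refine ⟨Λ, hΛ, C, hC, fun r hr 𝒜 ℬ a b h𝒜 hℬ w₀ => ?_⟩
  have hr0 : 0 < r := by linarith
  set e : (Fin d → ℤ) × (Fin d → ℤ) → (Fin d → ℝ) × (Fin k → ℝ) → ℂ := fun T w =>
    extn Φ (pk r T) w with he
  set J := fun (p q : ((Fin d → ℤ) × (Fin d → ℤ)) × ((Fin d → ℤ) × (Fin d → ℤ)))
    (w : (Fin d → ℝ) × (Fin k → ℝ)) => (cut ψ r w₀ w : ℂ) *
      ((e p.1 w * (starRingEnd ℂ) (e p.2 w)) * (e q.1 w * (starRingEnd ℂ) (e q.2 w))) with hJ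
  set co := fun (p q : ((Fin d → ℤ) × (Fin d → ℤ)) × ((Fin d → ℤ) × (Fin d → ℤ))) =>
    (a p.1 * (starRingEnd ℂ) (a p.2)) * (b q.1 * (starRingEnd ℂ) (b q.2)) with hco
  have hexp : ∀ w, ((cut ψ r w₀ w * ‖syn Φ r 𝒜 a w * syn Φ r ℬ b w‖ ^ 2 : ℝ) : ℂ) =
      ∑ p ∈ 𝒜 ×ˢ 𝒜, ∑ q ∈ ℬ ×ˢ ℬ, co p q * J p q w := by
    intro w
    have h1 : ∀ (𝒯 : Finset ((Fin d → ℤ) × (Fin d → ℤ))) (c : (Fin d → ℤ) × (Fin d → ℤ) → ℂ),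
        ((‖syn Φ r 𝒯 c w‖ ^ 2 : ℝ) : ℂ) = ∑ p ∈ 𝒯 ×ˢ 𝒯, c p.1 * e p.1 w *
          (starRingEnd ℂ) (c p.2 * e p.2 w) := by
      intro 𝒯 c
      rw [Complex.ofReal_pow, ← Complex.mul_conj', syn, map_sum, Finset.sum_mul_sum,
        Finset.sum_product]
    rw [norm_mul, mul_pow, Complex.ofReal_mul, Complex.ofReal_mul, h1, h1, Finset.sum_mul_sum,
      Finset.mul_sum]
    refine Finset.sum_congr rfl fun p _ => ?_
    rw [Finset.mul_sum]
    refine Finset.sum_congr rfl fun q _ => ?_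
    simp only [hJ, hco, map_mul]
    ring
  have hmem : ∀ p ∈ 𝒜 ×ˢ 𝒜, ∀ q ∈ ℬ ×ˢ ℬ, Integrable (J p q) ∧
      (¬ Res Φ r Λ p.1.1 p.2.1 q.1.1 q.2.1 → ∫ w, J p q w = 0) ∧
      ‖∫ w, J p q w‖ ≤ C * (r ^ k * (r ^ d)⁻¹) := by
    intro p hp q hq
    rw [Finset.mem_product] at hp hq
    exact h r hr p.1 p.2 q.1 q.2 (h𝒜 _ hp.1) (h𝒜 _ hp.2) (hℬ _ hq.1) (hℬ _ hq.2) w₀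
  have hintegC : Integrable fun w => ((cut ψ r w₀ w * ‖syn Φ r 𝒜 a w * syn Φ r ℬ b w‖ ^ 2 : ℝ) : ℂ) := by
    simp_rw [hexp]
    exact integrable_finsetSum _ fun p hp => integrable_finsetSum _ fun q hq =>
      (hmem p hp q hq).1.const_mul _
  have hinteg : Integrable fun w => cut ψ r w₀ w * ‖syn Φ r 𝒜 a w * syn Φ r ℬ b w‖ ^ 2 := by
    simpa only [RCLike.re_to_complex, Complex.ofReal_re] using hintegC.re
  have hnn : ∀ w, 0 ≤ cut ψ r w₀ w * ‖syn Φ r 𝒜 a w * syn Φ r ℬ b w‖ ^ 2 := fun w =>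
    mul_nonneg (cut_nonneg hψ0 _ _ _) (sq_nonneg _)
  calc _ ≤ ∫ w in cubeQ d k r w₀, cut ψ r w₀ w * ‖syn Φ r 𝒜 a w * syn Φ r ℬ b w‖ ^ 2 := by
        refine integral_mono_of_nonneg (Filter.Eventually.of_forall fun w => sq_nonneg _)
          hinteg.integrableOn ?_
        rw [Filter.EventuallyLE, ae_restrict_iff' (measurableSet_cubeQ r w₀)]
        refine Filter.Eventually.of_forall fun w hw => ?_
        exact le_mul_of_one_le_left (sq_nonneg _) (one_le_cut hψ1 hr0 hw)
    _ ≤ ∫ w, cut ψ r w₀ w * ‖syn Φ r 𝒜 a w * syn Φ r ℬ b w‖ ^ 2 :=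
        setIntegral_le_integral hinteg (Filter.Eventually.of_forall hnn)
    _ ≤ ‖∫ w, ((cut ψ r w₀ w * ‖syn Φ r 𝒜 a w * syn Φ r ℬ b w‖ ^ 2 : ℝ) : ℂ)‖ := by
        rw [integral_complex_ofReal, Complex.norm_real]
        exact Real.le_norm_self _
    _ = ‖∑ p ∈ 𝒜 ×ˢ 𝒜, ∑ q ∈ ℬ ×ˢ ℬ, co p q * ∫ w, J p q w‖ := by
        simp_rw [hexp]
        rw [integral_finsetSum _ fun p hp => integrable_finsetSum _ fun q hq =>
          (hmem p hp q hq).1.const_mul _]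
        congr 1
        refine Finset.sum_congr rfl fun p hp => ?_
        rw [integral_finsetSum _ fun q hq => (hmem p hp q hq).1.const_mul _]
        exact Finset.sum_congr rfl fun q hq => integral_const_mul _ _
    _ ≤ _ := by
        refine (norm_sum_le _ _).trans ?_
        rw [Finset.mul_sum]
        refine Finset.sum_le_sum fun p hp => (norm_sum_le _ _).trans ?_
        rw [Finset.mul_sum]
        refine Finset.sum_le_sum fun q hq => ?_
        obtain ⟨-, h0, hle⟩ := hmem p hp q hq
        split_ifs with hres
        · rw [norm_mul, mul_comm]
          refine mul_le_mul hle ?_ (norm_nonneg _) (by positivity)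
          simp only [hco, norm_mul, RCLike.norm_conj]
          exact le_rfl
        · rw [h0 hres]
          simp

section Combinatorics

variable {ι₁ ι₂ 𝔮 β : Type*}

lemma sum_product_swap {ι : Type*} (X : Finset ι) (g : ι × ι → ℝ) :
    ∑ q ∈ X ×ˢ X, g q.swap = ∑ q ∈ X ×ˢ X, g q := by
  rw [Finset.sum_product, Finset.sum_product_right]
  rfl

open scoped Classical in
/-- Summation over resonant quadruples, with a multiplicative weight `ρ`. -/
lemma sum_quad_le (A : Finset ι₁) (B : Finset ι₂) {res : ι₁ → ι₁ → ι₂ → ι₂ → Prop}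
    (hsymm : ∀ T₁ T₁' T₂ T₂', res T₁ T₁' T₂ T₂' → res T₁' T₁ T₂' T₂)
    {C₁ E : ℝ} (hC₁ : 0 ≤ C₁) {ρ c : ι₁ → ℝ} {b : ι₂ → ℝ} (hρ : ∀ T ∈ A, 0 < ρ T)
    (H1 : ∀ T₁ ∈ A, ∀ T₁' ∈ A, ∀ T₂' ∈ B, ((B.filter fun T₂ => res T₁ T₁' T₂ T₂').card : ℝ) ≤ C₁)
    (H2 : ∀ T₁ ∈ A, ∀ T₂' ∈ B, ∑ T₁' ∈ A with ∃ T₂ ∈ B, res T₁ T₁' T₂ T₂', ρ T₁' ≤ E) :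
    ∑ p ∈ A ×ˢ A, ∑ q ∈ B ×ˢ B, (if res p.1 p.2 q.1 q.2 then c p.1 * c p.2 * (b q.1 * b q.2) else 0)
      ≤ C₁ * E * ∑ T₁ ∈ A, c T₁ ^ 2 / ρ T₁ * ∑ T₂ ∈ B, b T₂ ^ 2 := by
  set f : ι₁ × ι₁ → ι₂ × ι₂ → ℝ := fun p q =>
    if res p.1 p.2 q.1 q.2 then c p.1 ^ 2 / ρ p.1 * b q.2 ^ 2 * ρ p.2 else 0 with hf
  have hswap : ∑ p ∈ A ×ˢ A, ∑ q ∈ B ×ˢ B, f p.swap q.swap = ∑ p ∈ A ×ˢ A, ∑ q ∈ B ×ˢ B, f p q := by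
    simp_rw [fun p => sum_product_swap B (f p)]
    exact sum_product_swap A (fun p => ∑ q ∈ B ×ˢ B, f p q)
  have hterm : ∀ p ∈ A ×ˢ A, ∀ q ∈ B ×ˢ B,
      (if res p.1 p.2 q.1 q.2 then c p.1 * c p.2 * (b q.1 * b q.2) else 0) ≤
        1 / 2 * f p q + 1 / 2 * f p.swap q.swap := by
    intro p hp q _
    rw [Finset.mem_product] at hp
    have h1 := hρ _ hp.1
    have h2 := hρ _ hp.2
    by_cases hr : res p.1 p.2 q.1 q.2
    · have hr' := hsymm _ _ _ _ hr
      simp only [hf, Prod.fst_swap, Prod.snd_swap, if_pos hr, if_pos hr']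
      rw [← sub_nonneg]
      have : 1 / 2 * (c p.1 ^ 2 / ρ p.1 * b q.2 ^ 2 * ρ p.2) +
          1 / 2 * (c p.2 ^ 2 / ρ p.2 * b q.1 ^ 2 * ρ p.1) - c p.1 * c p.2 * (b q.1 * b q.2) =
          1 / 2 * (c p.1 * b q.2 * ρ p.2 - c p.2 * b q.1 * ρ p.1) ^ 2 / (ρ p.1 * ρ p.2) := by
        field_simp
        ring
      rw [this]
      positivity
    · have hr' : ¬ res p.2 p.1 q.2 q.1 := fun h => hr (hsymm _ _ _ _ h)
      simp [hf, hr, hr']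
  have h1 : ∑ p ∈ A ×ˢ A, ∑ q ∈ B ×ˢ B,
      (if res p.1 p.2 q.1 q.2 then c p.1 * c p.2 * (b q.1 * b q.2) else 0) ≤
        ∑ p ∈ A ×ˢ A, ∑ q ∈ B ×ˢ B, f p q := by
    refine (Finset.sum_le_sum fun p hp => Finset.sum_le_sum fun q hq => hterm p hp q hq).trans ?_
    simp only [Finset.sum_add_distrib, ← Finset.mul_sum]
    rw [hswap]
    linarith
  refine h1.trans ?_
  have h2 : ∑ p ∈ A ×ˢ A, ∑ q ∈ B ×ˢ B, f p q =
      ∑ T₁ ∈ A, ∑ T₂' ∈ B, c T₁ ^ 2 / ρ T₁ * b T₂' ^ 2 *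
        ∑ T₁' ∈ A, ρ T₁' * ((B.filter fun T₂ => res T₁ T₁' T₂ T₂').card : ℝ) := by
    rw [Finset.sum_product]
    refine Finset.sum_congr rfl fun T₁ _ => ?_
    simp_rw [Finset.sum_product_right, Finset.mul_sum]
    rw [Finset.sum_comm]
    refine Finset.sum_congr rfl fun T₂' _ => Finset.sum_congr rfl fun T₁' _ => ?_
    simp only [hf]
    rw [← Finset.sum_filter, Finset.sum_const, nsmul_eq_mul]
    ring
  rw [h2, Finset.mul_sum]
  refine Finset.sum_le_sum fun T₁ hT₁ => ?_
  rw [Finset.mul_sum, Finset.mul_sum]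
  refine Finset.sum_le_sum fun T₂' hT₂' => ?_
  have hρ1 := hρ _ hT₁
  rw [mul_comm (C₁ * E)]
  refine mul_le_mul_of_nonneg_left ?_ (by positivity)
  calc _ ≤ ∑ T₁' ∈ A, (if ∃ T₂ ∈ B, res T₁ T₁' T₂ T₂' then C₁ * ρ T₁' else 0) := by
        refine Finset.sum_le_sum fun T₁' hT₁' => ?_
        split_ifs with h
        · rw [mul_comm]
          exact mul_le_mul_of_nonneg_right (H1 _ hT₁ _ hT₁' _ hT₂') (hρ _ hT₁').le
        · rw [Finset.filter_false_of_mem]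
          · simp
          · exact fun T₂ hT₂ hh => h ⟨T₂, hT₂, hh⟩
    _ = C₁ * ∑ T₁' ∈ A with ∃ T₂ ∈ B, res T₁ T₁' T₂ T₂', ρ T₁' := by
        rw [← Finset.sum_filter, Finset.mul_sum]
    _ ≤ C₁ * E := mul_le_mul_of_nonneg_left (H2 _ hT₁ _ hT₂') hC₁

open scoped Classical in
/-- Each element of `𝒯₁` is assigned to a block in such a way that the resonant sum over
elements assigned far away is controlled. -/
lemma exists_assignment [Nonempty β] (𝒯₁ : Finset ι₁) (𝒯₂ : Finset ι₂) (Q : Finset 𝔮)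
    (inc₁ : ι₁ → 𝔮 → Prop) (inc₂ : ι₂ → 𝔮 → Prop) (blk : 𝔮 → β) (far : β → β → Prop)
    {res : ι₁ → ι₁ → ι₂ → ι₂ → Prop}
    (hsymm : ∀ T₁ T₁' T₂ T₂', res T₁ T₁' T₂ T₂' → res T₁' T₁ T₂' T₂)
    {C₁ C₂ : ℝ} (hC₁ : 0 ≤ C₁) (hC₂ : 0 ≤ C₂)
    (H1 : ∀ q ∈ Q, ∀ T₁ ∈ 𝒯₁, ∀ T₁' ∈ 𝒯₁, ∀ T₂' ∈ 𝒯₂, inc₁ T₁ q → inc₁ T₁' q → inc₂ T₂' q →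
      ((𝒯₂.filter fun T₂ => inc₂ T₂ q ∧ res T₁ T₁' T₂ T₂').card : ℝ) ≤ C₁)
    (H2 : ∀ q ∈ Q, ∀ T₁ ∈ 𝒯₁, ∀ T₂' ∈ 𝒯₂, ∀ S ∈ 𝒯₂, inc₁ T₁ q → inc₂ T₂' q →
      (((𝒯₁ ×ˢ Q).filter fun x => inc₁ x.1 q ∧ (∃ T₂ ∈ 𝒯₂, inc₂ T₂ q ∧ res T₁ x.1 T₂ T₂') ∧
        far (blk q) (blk x.2) ∧ inc₁ x.1 x.2 ∧ inc₂ S x.2).card : ℝ) ≤ C₂) (b : ι₂ → ℝ) :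
    ∃ bs : ι₁ → β, ∀ (B : β) (c : ι₁ → ℝ) (b' : ι₂ → ℝ), (∀ T, |b' T| ≤ |b T|) →
      ∑ q ∈ Q with blk q = B,
        ∑ p ∈ (𝒯₁.filter fun T => inc₁ T q ∧ far B (bs T)) ×ˢ (𝒯₁.filter fun T => inc₁ T q ∧ far B (bs T)),
          ∑ p' ∈ (𝒯₂.filter fun T => inc₂ T q) ×ˢ (𝒯₂.filter fun T => inc₂ T q),
          (if res p.1 p.2 p'.1 p'.2 then c p.1 * c p.2 * (b' p'.1 * b' p'.2) else 0) ≤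
        C₁ * (C₂ + 1) * (∑ T ∈ 𝒯₁, c T ^ 2) * ∑ T ∈ 𝒯₂, b T ^ 2 := by
  set N : 𝔮 → ℝ := fun q => ∑ T ∈ 𝒯₂ with inc₂ T q, b T ^ 2 with hN
  have hN0 : ∀ q, 0 ≤ N q := fun q => Finset.sum_nonneg fun _ _ => sq_nonneg _
  set M : ι₁ → β → ℝ := fun T B => ∑ q ∈ Q with blk q = B ∧ inc₁ T q, N q with hM
  have hbs : ∀ T, ∃ B, ∀ B', M T B' ≤ M T B := by
    intro T
    by_cases hQ : Q.Nonempty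
    · obtain ⟨B, -, hmax⟩ := Finset.exists_max_image (Q.image blk) (M T) (hQ.image blk)
      refine ⟨B, fun B' => ?_⟩
      by_cases hB' : B' ∈ Q.image blk
      · exact hmax _ hB'
      · have : M T B' = 0 := by
          simp only [hM]
          rw [Finset.filter_false_of_mem, Finset.sum_empty]
          rintro q hq ⟨h, -⟩
          exact hB' (Finset.mem_image.2 ⟨q, hq, h⟩)
        rw [this]
        exact Finset.sum_nonneg fun q _ => hN0 q
    · rw [Finset.not_nonempty_iff_eq_empty] at hQ
      subst hQ
      exact ⟨Classical.arbitrary β, fun B' => by simp [hM]⟩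
  choose bs hbs using hbs
  refine ⟨bs, fun B c b' hb' => ?_⟩
  set W : ℝ := ∑ T ∈ 𝒯₂, b T ^ 2 with hW
  have hW0 : 0 ≤ W := Finset.sum_nonneg fun _ _ => sq_nonneg _
  rcases hW0.eq_or_lt with hWz | hWpos
  · have hb0 : ∀ T ∈ 𝒯₂, b' T = 0 := by
      intro T hT
      have := (Finset.sum_eq_zero_iff_of_nonneg (fun T _ => sq_nonneg (b T))).1 hWz.symm T hT
      have h2 : b T = 0 := by simpa using this
      simpa [h2] using hb' T
    rw [← hWz, mul_zero]
    refine le_of_eq (Finset.sum_eq_zero fun q _ => Finset.sum_eq_zero fun p _ =>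
      Finset.sum_eq_zero fun p' hp' => ?_)
    rw [Finset.mem_product, Finset.mem_filter] at hp'
    rw [hb0 _ hp'.1.1]
    simp
  set η : ℝ := W / (𝒯₁.card + 1) with hη
  have hηpos : 0 < η := by positivity
  set ρ : ι₁ → ℝ := fun T => (∑ q ∈ Q with far B (blk q) ∧ inc₁ T q, N q) + η with hρ
  have hρpos : ∀ T, 0 < ρ T := fun T =>
    add_pos_of_nonneg_of_pos (Finset.sum_nonneg fun q _ => hN0 q) hηpos
  have hMρ : ∀ T, far B (bs T) → M T B ≤ ρ T := by
    intro T hT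
    refine (hbs T B).trans ((Finset.sum_le_sum_of_subset_of_nonneg ?_ fun q _ _ => hN0 q).trans
      (le_add_of_nonneg_right hηpos.le))
    intro q hq
    rw [Finset.mem_filter] at hq ⊢
    exact ⟨hq.1, hq.2.1 ▸ hT, hq.2.2⟩
  have hkey : ∀ q ∈ Q.filter fun q => blk q = B, ∀ T₁ ∈ 𝒯₁, inc₁ T₁ q → ∀ T₂' ∈ 𝒯₂, inc₂ T₂' q →
      ∑ T₁' ∈ 𝒯₁ with inc₁ T₁' q ∧ (∃ T₂ ∈ 𝒯₂, inc₂ T₂ q ∧ res T₁ T₁' T₂ T₂'), ρ T₁' ≤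
        (C₂ + 1) * W := by
    intro q hq T₁ hT₁ h₁ T₂' hT₂' h₂
    rw [Finset.mem_filter] at hq
    set X := 𝒯₁.filter fun T₁' => inc₁ T₁' q ∧ (∃ T₂ ∈ 𝒯₂, inc₂ T₂ q ∧ res T₁ T₁' T₂ T₂') with hX
    have hsum : ∑ T₁' ∈ X, ∑ q' ∈ Q with far B (blk q') ∧ inc₁ T₁' q', N q' ≤ C₂ * W := by
      calc _ = ∑ T₁' ∈ X, ∑ q' ∈ Q, ∑ S ∈ 𝒯₂,
            (if far B (blk q') ∧ inc₁ T₁' q' ∧ inc₂ S q' then b S ^ 2 else 0) := by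
            refine Finset.sum_congr rfl fun T₁' _ => ?_
            rw [Finset.sum_filter]
            refine Finset.sum_congr rfl fun q' _ => ?_
            split_ifs with hc
            · simp only [hN, hc, true_and]
              rw [Finset.sum_filter]
            · rw [Finset.sum_eq_zero]
              intro S _
              rw [if_neg]
              tauto
        _ = ∑ x ∈ X ×ˢ Q, ∑ S ∈ 𝒯₂,
            (if far B (blk x.2) ∧ inc₁ x.1 x.2 ∧ inc₂ S x.2 then b S ^ 2 else 0) := by
            rw [Finset.sum_product]
        _ = ∑ S ∈ 𝒯₂, ∑ x ∈ X ×ˢ Q,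
            (if far B (blk x.2) ∧ inc₁ x.1 x.2 ∧ inc₂ S x.2 then b S ^ 2 else 0) := by
            rw [Finset.sum_comm]
        _ ≤ ∑ S ∈ 𝒯₂, C₂ * b S ^ 2 := by
            refine Finset.sum_le_sum fun S hS => ?_
            rw [← Finset.sum_filter, Finset.sum_const, nsmul_eq_mul]
            refine mul_le_mul_of_nonneg_right ?_ (sq_nonneg _)
            refine le_trans ?_ (H2 q hq.1 T₁ hT₁ T₂' hT₂' S hS h₁ h₂)
            rw [Nat.cast_le]
            refine Finset.card_le_card fun x hx => ?_
            rw [Finset.mem_filter, Finset.mem_product] at hx ⊢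
            have hx1 := (Finset.mem_filter.1 hx.1.1)
            exact ⟨⟨hx1.1, hx.1.2⟩, hx1.2.1, hx1.2.2, hq.2 ▸ hx.2.1, hx.2.2⟩
        _ = C₂ * W := by rw [Finset.mul_sum]
    have hcard : (X.card : ℝ) * η ≤ W := by
      have h3 : (X.card : ℝ) ≤ 𝒯₁.card + 1 := by
        have : (X.card : ℝ) ≤ 𝒯₁.card := Nat.cast_le.2 (Finset.card_filter_le _ _)
        linarith
      calc (X.card : ℝ) * η ≤ (𝒯₁.card + 1) * η := by gcongr
        _ = W := by rw [hη]; field_simp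
    simp only [hρ]
    rw [Finset.sum_add_distrib, Finset.sum_const, nsmul_eq_mul]
    linarith
  calc _ ≤ ∑ q ∈ Q with blk q = B, C₁ * ((C₂ + 1) * W) *
          ∑ T ∈ 𝒯₁ with inc₁ T q ∧ far B (bs T), c T ^ 2 / ρ T * ∑ S ∈ 𝒯₂ with inc₂ S q, b' S ^ 2 := by
        refine Finset.sum_le_sum fun q hq => ?_
        have hqm := Finset.mem_filter.1 hq
        refine sum_quad_le _ _ hsymm hC₁ (fun T _ => hρpos T) ?_ ?_
        · intro T₁ h₁ T₁' h₁' T₂' h₂'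
          rw [Finset.mem_filter] at h₁ h₁' h₂'
          rw [Finset.filter_filter]
          exact H1 q hqm.1 _ h₁.1 _ h₁'.1 _ h₂'.1 h₁.2.1 h₁'.2.1 h₂'.2
        · intro T₁ h₁ T₂' h₂'
          rw [Finset.mem_filter] at h₁ h₂'
          refine le_trans (Finset.sum_le_sum_of_subset_of_nonneg ?_ fun T _ _ => (hρpos T).le)
            (hkey q hq T₁ h₁.1 h₁.2.1 T₂' h₂'.1 h₂'.2)
          intro T hT
          simp only [Finset.mem_filter] at hT ⊢
          obtain ⟨⟨hT1, hT2, -⟩, T₂, ⟨hT3, hT4⟩, hT5⟩ := hT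
          exact ⟨hT1, hT2, T₂, hT3, hT4, hT5⟩
    _ ≤ ∑ q ∈ Q with blk q = B, C₁ * ((C₂ + 1) * W) *
          ∑ T ∈ 𝒯₁ with inc₁ T q ∧ far B (bs T), c T ^ 2 / ρ T * N q := by
        refine Finset.sum_le_sum fun q _ => mul_le_mul_of_nonneg_left
          (Finset.sum_le_sum fun T _ => mul_le_mul_of_nonneg_left ?_ ?_) (by positivity)
        · exact Finset.sum_le_sum fun S _ => sq_le_sq.2 (hb' S)
        · have := hρpos T
          positivity
    _ = C₁ * ((C₂ + 1) * W) * ∑ T ∈ 𝒯₁ with far B (bs T), c T ^ 2 / ρ T * M T B := by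
        rw [← Finset.mul_sum]
        congr 1
        simp only [hM, Finset.mul_sum]
        refine Finset.sum_comm' fun q T => ?_
        simp only [Finset.mem_filter]
        tauto
    _ ≤ C₁ * ((C₂ + 1) * W) * ∑ T ∈ 𝒯₁, c T ^ 2 := by
        refine mul_le_mul_of_nonneg_left ?_ (by positivity)
        refine le_trans (Finset.sum_le_sum fun T hT => ?_)
          (Finset.sum_le_sum_of_subset_of_nonneg (Finset.filter_subset _ _) fun T _ _ => sq_nonneg (c T))
        rw [Finset.mem_filter] at hT
        have := hρpos T
        calc c T ^ 2 / ρ T * M T B ≤ c T ^ 2 / ρ T * ρ T := by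
              gcongr
              exact hMρ T hT.2
          _ = c T ^ 2 := by field_simp
    _ = _ := by ring

end Combinatorics

section Nondegeneracy

/-- The vector `L^t s` for a linear map `L : ℝ^d → ℝ^k`. -/
def tgL (s : Fin k → ℝ) (L : (Fin d → ℝ) →L[ℝ] (Fin k → ℝ)) : Fin d → ℝ :=
  fun i => s ⬝ᵥ L (Pi.single i 1)

lemma tg_eq (Φ : (Fin d → ℝ) → Fin k → ℝ) (s : Fin k → ℝ) (ν : Fin d → ℝ) :
    tg Φ s ν = tgL s (fderiv ℝ Φ ν) := rfl

lemma tgL_sub (s : Fin k → ℝ) (L M : (Fin d → ℝ) →L[ℝ] (Fin k → ℝ)) :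
    tgL s (L - M) = tgL s L - tgL s M := by
  ext i
  simp [tgL, dotProduct_sub]

lemma tgL_sub_left (s t : Fin k → ℝ) (L : (Fin d → ℝ) →L[ℝ] (Fin k → ℝ)) :
    tgL (s - t) L = tgL s L - tgL t L := by
  ext i
  simp [tgL, sub_dotProduct]

lemma tgL_smul (c : ℝ) (s : Fin k → ℝ) (L : (Fin d → ℝ) →L[ℝ] (Fin k → ℝ)) :
    tgL s (c • L) = c • tgL s L := by
  ext i
  simp [tgL]

lemma tgL_smul_left (c : ℝ) (s : Fin k → ℝ) (L : (Fin d → ℝ) →L[ℝ] (Fin k → ℝ)) :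
    tgL (c • s) L = c • tgL s L := by
  ext i
  simp [tgL]

lemma norm_tgL_le (s : Fin k → ℝ) (L : (Fin d → ℝ) →L[ℝ] (Fin k → ℝ)) :
    ‖tgL s L‖ ≤ k * ‖s‖ * ‖L‖ := by
  rw [pi_norm_le_iff_of_nonneg (by positivity)]
  intro i
  rw [Real.norm_eq_abs]
  refine (abs_dotProduct_le _ _).trans ?_
  gcongr
  refine (L.le_opNorm _).trans ?_
  have : ‖(Pi.single i 1 : Fin d → ℝ)‖ ≤ 1 := by
    rw [Pi.norm_single]
    simp
  nlinarith [norm_nonneg L]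

lemma continuous_tgL : Continuous fun z : (Fin k → ℝ) × ((Fin d → ℝ) →L[ℝ] (Fin k → ℝ)) =>
    tgL z.1 z.2 :=
  continuous_pi fun _ => continuous_fst.dotProduct (continuous_snd.clm_apply continuous_const)

lemma norm_tg_le (Φ : (Fin d → ℝ) → Fin k → ℝ) (s : Fin k → ℝ) (ν : Fin d → ℝ) :
    ‖tg Φ s ν‖ ≤ k * ‖s‖ * ‖fderiv ℝ Φ ν‖ := norm_tgL_le _ _

variable {Φ : (Fin d → ℝ) → Fin k → ℝ} (hΦ : ContDiff ℝ (⊤ : ℕ∞) Φ)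

include hΦ

lemma fderiv_comp_apply (x v : Fin d → ℝ) (l : Fin k) :
    fderiv ℝ (fun y => Φ y l) x v = fderiv ℝ Φ x v l := by
  have h := (hΦ.differentiable (by simp) x).hasFDerivAt
  rw [(hasFDerivAt_pi'.1 h l).fderiv]
  rfl

lemma Dmat_mulVec (a b u : Fin d → ℝ) :
    Dmat d k Φ a b *ᵥ u = fderiv ℝ Φ b u - fderiv ℝ Φ a u := by
  ext l
  have h : ∀ x, fderiv ℝ Φ x u l = ∑ i, u i * fderiv ℝ Φ x (Pi.single i 1) l := by
    intro x
    conv_lhs => rw [pi_eq_sum_univ' u]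
    simp [map_sum, Finset.sum_apply]
  simp only [mulVec, dotProduct, Dmat, gradPhi, of_apply, fderiv_comp_apply hΦ, Pi.sub_apply, h,
    ← Finset.sum_sub_distrib]
  exact Finset.sum_congr rfl fun i _ => by ring

lemma vecMul_Dmat (a b : Fin d → ℝ) (s : Fin k → ℝ) :
    s ᵥ* Dmat d k Φ a b = tg Φ s b - tg Φ s a := by
  ext i
  simp only [vecMul, dotProduct, Dmat, gradPhi, of_apply, fderiv_comp_apply hΦ, Pi.sub_apply, tg,
    ← Finset.sum_sub_distrib]
  exact Finset.sum_congr rfl fun i _ => by ring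

lemma vecMul_tHess (a u : Fin d → ℝ) (s : Fin k → ℝ) :
    u ᵥ* tHess d k Φ s a = tgL s (fderiv ℝ (fderiv ℝ Φ) a u) := by
  ext i
  have hG : ∀ x, HasFDerivAt (fderiv ℝ Φ) (fderiv ℝ (fderiv ℝ Φ) x) x := fun x =>
    ((hΦ.fderiv_right (m := (⊤ : ℕ∞)) (by simp)).differentiable (by simp) x).hasFDerivAt
  have h1 : ∀ l v, fderiv ℝ (fun x => fderiv ℝ (fun y => Φ y l) x (Pi.single i 1)) a v =
      fderiv ℝ (fderiv ℝ Φ) a v (Pi.single i 1) l := by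
    intro l v
    have : (fun x => fderiv ℝ (fun y => Φ y l) x (Pi.single i 1)) =
        fun x => fderiv ℝ Φ x (Pi.single i 1) l := by
      funext x
      rw [fderiv_comp_apply hΦ]
    rw [this]
    have h2 : HasFDerivAt (fun x => fderiv ℝ Φ x (Pi.single i 1))
        ((fderiv ℝ (fderiv ℝ Φ) a).flip (Pi.single i 1)) a := by
      simpa using (hG a).clm_apply (hasFDerivAt_const (Pi.single i (1 : ℝ)) a)
    rw [(hasFDerivAt_pi'.1 h2 l).fderiv]
    rfl
  have h3 : ∀ l, fderiv ℝ (fderiv ℝ Φ) a u (Pi.single i 1) l =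
      ∑ j, u j * fderiv ℝ (fderiv ℝ Φ) a (Pi.single j 1) (Pi.single i 1) l := by
    intro l
    conv_lhs => rw [pi_eq_sum_univ' u]
    simp [map_sum, Finset.sum_apply]
  simp only [vecMul, dotProduct, tHess, hessPhi, tgL, Matrix.sum_apply, Matrix.smul_apply, of_apply,
    h1, h3, smul_eq_mul, Finset.mul_sum]
  rw [Finset.sum_comm]
  exact Finset.sum_congr rfl fun l _ => Finset.sum_congr rfl fun j _ => by ring

lemma eq_zero_of_linearized {a b : Fin d → ℝ}
    (h1 : ∀ t : Fin k → ℝ, (∑ i, t i ^ 2) = 1 → (tHess d k Φ t a).det ≠ 0)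
    (h2 : ∀ t : Fin k → ℝ, (∑ i, t i ^ 2) = 1 →
      (Dmat d k Φ a b * (tHess d k Φ t a)⁻¹ * (Dmat d k Φ a b)ᵀ).det ≠ 0)
    {s τ : Fin k → ℝ} {u : Fin d → ℝ} (hs : s ≠ 0)
    (e1 : tgL s (fderiv ℝ (fderiv ℝ Φ) a u) + (tg Φ τ a - tg Φ τ b) = 0)
    (e2 : fderiv ℝ Φ b u - fderiv ℝ Φ a u = 0) : u = 0 ∧ τ = 0 := by
  set σ : ℝ := √(∑ i, s i ^ 2) with hσ
  have hpos : 0 < ∑ i, s i ^ 2 := by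
    obtain ⟨i, hi⟩ := Function.ne_iff.1 hs
    refine Finset.sum_pos' (fun i _ => sq_nonneg _) ⟨i, Finset.mem_univ _, ?_⟩
    exact sq_pos_of_ne_zero hi
  have hσ0 : 0 < σ := Real.sqrt_pos.2 hpos
  have hunit : ∑ i, ((σ⁻¹ • s) i) ^ 2 = 1 := by
    simp only [Pi.smul_apply, smul_eq_mul, mul_pow, ← Finset.mul_sum]
    rw [inv_pow, hσ, Real.sq_sqrt hpos.le, inv_mul_cancel₀ hpos.ne']
  set D := Dmat d k Φ a b
  set H := tHess d k Φ (σ⁻¹ • s) a with hH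
  have hdet := h1 _ hunit
  have hdet2 := h2 _ hunit
  rw [← hH] at hdet hdet2
  have e1' : u ᵥ* H = (σ⁻¹ • τ) ᵥ* D := by
    rw [hH, vecMul_tHess hΦ, tgL_smul_left, smul_vecMul, vecMul_Dmat hΦ,
      eq_neg_of_add_eq_zero_left e1]
    simp
  have e2' : u ᵥ* Dᵀ = 0 := by
    rw [vecMul_transpose, Dmat_mulVec hΦ, e2]
  have hu : u = (σ⁻¹ • τ) ᵥ* (D * H⁻¹) := by
    rw [← vecMul_vecMul, ← e1', vecMul_vecMul, mul_nonsing_inv _ (isUnit_iff_ne_zero.2 hdet),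
      vecMul_one]
  have hτ : σ⁻¹ • τ = 0 := by
    refine eq_zero_of_vecMul_eq_zero hdet2 ?_
    rw [← vecMul_vecMul, ← hu, e2']
  refine ⟨by rw [hu, hτ, zero_vecMul], ?_⟩
  exact (smul_eq_zero.1 hτ).resolve_left (inv_ne_zero hσ0.ne')

lemma exists_linearized_lower_bound {a b : Fin d → ℝ} (hk : 1 ≤ k)
    (h1 : ∀ t : Fin k → ℝ, (∑ i, t i ^ 2) = 1 → (tHess d k Φ t a).det ≠ 0)
    (h2 : ∀ t : Fin k → ℝ, (∑ i, t i ^ 2) = 1 →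
      (Dmat d k Φ a b * (tHess d k Φ t a)⁻¹ * (Dmat d k Φ a b)ᵀ).det ≠ 0) :
    ∃ κ : ℝ, 0 < κ ∧ ∀ (s τ : Fin k → ℝ) (u : Fin d → ℝ),
      κ * (‖s‖ * ‖u‖ + ‖τ‖) ≤
        ‖tgL s (fderiv ℝ (fderiv ℝ Φ) a u) + tgL τ (fderiv ℝ Φ a - fderiv ℝ Φ b)‖ +
        ‖s‖ * ‖(fderiv ℝ Φ b - fderiv ℝ Φ a) u‖ := by
  set F : (Fin k → ℝ) × ((Fin k → ℝ) × (Fin d → ℝ)) → ℝ := fun z =>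
    ‖tgL z.1 (fderiv ℝ (fderiv ℝ Φ) a z.2.2) + tgL z.2.1 (fderiv ℝ Φ a - fderiv ℝ Φ b)‖ +
      ‖(fderiv ℝ Φ b - fderiv ℝ Φ a) z.2.2‖ with hF
  have hFc : Continuous F := by
    refine ((Continuous.add ?_ ?_).norm).add ?_
    · exact continuous_tgL.comp (continuous_fst.prodMk
        ((ContinuousLinearMap.continuous _).comp (continuous_snd.comp continuous_snd)))
    · exact continuous_tgL.comp ((continuous_fst.comp continuous_snd).prodMk continuous_const)
    · exact ((ContinuousLinearMap.continuous _).comp (continuous_snd.comp continuous_snd)).norm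
  have hK : IsCompact (Metric.sphere (0 : Fin k → ℝ) 1 ×ˢ
      Metric.sphere (0 : (Fin k → ℝ) × (Fin d → ℝ)) 1) :=
    (isCompact_sphere _ _).prod (isCompact_sphere _ _)
  obtain ⟨κ, hκ, hmin⟩ := hK.exists_forall_le' hFc.continuousOn (a := 0) (by
    rintro ⟨s, τ, u⟩ ⟨hs, hz⟩
    simp only [mem_sphere_iff_norm, sub_zero] at hs hz
    have hs0 : s ≠ 0 := by
      rintro rfl
      simp at hs
    have h0 : 0 ≤ F (s, τ, u) := by positivity
    rcases h0.eq_or_lt with h | h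
    · exfalso
      have h3 := (add_eq_zero_iff_of_nonneg (norm_nonneg _) (norm_nonneg _)).1 h.symm
      obtain ⟨hu, hτ⟩ := eq_zero_of_linearized hΦ h1 h2 (s := s) (τ := τ) (u := u) hs0
        (by simpa [tgL_sub, tg_eq] using norm_eq_zero.1 h3.1) (by simpa using norm_eq_zero.1 h3.2)
      subst hu hτ
      simp at hz
    · exact h)
  refine ⟨κ / 2, by positivity, ?_⟩
  have hunit : ∀ (s τ : Fin k → ℝ) (u : Fin d → ℝ), ‖s‖ = 1 → κ / 2 * (‖u‖ + ‖τ‖) ≤ F (s, τ, u) := by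
    intro s τ u hs
    by_cases hz : ((τ, u) : (Fin k → ℝ) × (Fin d → ℝ)) = 0
    · have h3 : τ = 0 ∧ u = 0 := by simpa using hz
      rw [h3.1, h3.2]
      simp only [norm_zero, add_zero, mul_zero]
      positivity
    · set m := ‖((τ, u) : (Fin k → ℝ) × (Fin d → ℝ))‖ with hm
      have hm0 : 0 < m := norm_pos_iff.2 hz
      have h3 := hmin (s, m⁻¹ • τ, m⁻¹ • u) ⟨by simpa using hs, by
        simp only [mem_sphere_iff_norm, sub_zero]
        have : ((m⁻¹ • τ, m⁻¹ • u) : (Fin k → ℝ) × (Fin d → ℝ)) = m⁻¹ • (τ, u) := rfl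
        rw [this, norm_smul, norm_inv, norm_norm, ← hm, inv_mul_cancel₀ hm0.ne']⟩
      have h4 : F (s, m⁻¹ • τ, m⁻¹ • u) = m⁻¹ * F (s, τ, u) := by
        simp only [hF, map_smul, tgL_smul, tgL_smul_left, ← smul_add, norm_smul, norm_inv,
          Real.norm_of_nonneg hm0.le]
        ring
      rw [h4, inv_mul_eq_div, le_div_iff₀ hm0] at h3
      have h5 : ‖τ‖ ≤ m := norm_fst_le (τ, u)
      have h6 : ‖u‖ ≤ m := norm_snd_le (τ, u)
      nlinarith
  intro s τ u
  by_cases hs : s = 0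
  · subst hs
    have h3 := hunit (fun _ => 1) τ 0 (by
      have : Nonempty (Fin k) := ⟨⟨0, hk⟩⟩
      rw [pi_norm_const]
      simp)
    have h0 : ∀ L : (Fin d → ℝ) →L[ℝ] (Fin k → ℝ), tgL 0 L = 0 := fun L => by
      ext i
      simp [tgL]
    have h0' : ∀ t : Fin k → ℝ, tgL t (0 : (Fin d → ℝ) →L[ℝ] (Fin k → ℝ)) = 0 := fun L => by
      ext i
      simp [tgL]
    simpa [hF, h0, h0'] using h3
  · have hs0 : 0 < ‖s‖ := norm_pos_iff.2 hs
    have h3 := hunit (‖s‖⁻¹ • s) (‖s‖⁻¹ • τ) u (by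
      rw [norm_smul, norm_inv, norm_norm, inv_mul_cancel₀ hs0.ne'])
    have h4 : ‖s‖ * F (‖s‖⁻¹ • s, ‖s‖⁻¹ • τ, u) =
        ‖tgL s (fderiv ℝ (fderiv ℝ Φ) a u) + tgL τ (fderiv ℝ Φ a - fderiv ℝ Φ b)‖ +
        ‖s‖ * ‖(fderiv ℝ Φ b - fderiv ℝ Φ a) u‖ := by
      simp only [hF, tgL_smul_left, ← smul_add, norm_smul, norm_inv, norm_norm]
      field_simp
    rw [← h4]
    calc _ = ‖s‖ * (κ / 2 * (‖u‖ + ‖‖s‖⁻¹ • τ‖)) := by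
          rw [norm_smul, norm_inv, norm_norm]
          field_simp
      _ ≤ _ := mul_le_mul_of_nonneg_left h3 hs0.le

/-- The quantitative transversality of the two pieces of the surface. -/
lemma exists_transversality {a₀ b₀ : Fin d → ℝ} (hk : 1 ≤ k)
    (h1 : ∀ t : Fin k → ℝ, (∑ i, t i ^ 2) = 1 → (tHess d k Φ t a₀).det ≠ 0)
    (h2 : ∀ t : Fin k → ℝ, (∑ i, t i ^ 2) = 1 →
      (Dmat d k Φ a₀ b₀ * (tHess d k Φ t a₀)⁻¹ * (Dmat d k Φ a₀ b₀)ᵀ).det ≠ 0) :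
    ∃ κ : ℝ, 0 < κ ∧ ∃ ρ : ℝ, 0 < ρ ∧ ∀ ν ν' a η b : Fin d → ℝ,
      ‖ν - a₀‖ ≤ ρ → ‖ν' - a₀‖ ≤ ρ → ‖a - a₀‖ ≤ ρ → ‖η - b₀‖ ≤ ρ → ‖b - b₀‖ ≤ ρ →
      ∀ s s' : Fin k → ℝ, κ * (‖s‖ * ‖ν - ν'‖ + ‖s - s'‖) ≤
        ‖(tg Φ s ν - tg Φ s η) - (tg Φ s' ν' - tg Φ s' η)‖ +
        ‖s‖ * ‖(Φ (ν + (b - a)) - Φ ν) - (Φ (ν' + (b - a)) - Φ ν')‖ := by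
  obtain ⟨κ, hκ, hlin⟩ := exists_linearized_lower_bound hΦ hk h1 h2
  set ε : ℝ := κ / (2 * (2 * k + 2)) with hε
  have hε0 : 0 < ε := by positivity
  have hG : ContDiff ℝ (⊤ : ℕ∞) (fderiv ℝ Φ) := hΦ.fderiv_right (by simp)
  have hstrict : ∀ {E : Type} [NormedAddCommGroup E] [NormedSpace ℝ E] (f : (Fin d → ℝ) → E),
      ContDiff ℝ (⊤ : ℕ∞) f → ∀ x₀, ∃ δ > 0, ∀ x y, ‖x - x₀‖ ≤ δ → ‖y - x₀‖ ≤ δ →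
        ‖f x - f y - fderiv ℝ f x₀ (x - y)‖ ≤ ε * ‖x - y‖ := by
    intro E _ _ f hf x₀
    have h := (hf.contDiffAt (x := x₀)).hasStrictFDerivAt (by simp)
    have h3 := h.isLittleO.def hε0
    rw [Metric.eventually_nhds_iff] at h3
    obtain ⟨δ, hδ, h4⟩ := h3
    refine ⟨δ / 2, by positivity, fun x y hx hy => h4 (y := (x, y)) ?_⟩
    rw [Prod.dist_eq, max_lt_iff, dist_eq_norm, dist_eq_norm]
    constructor <;> dsimp only <;> linarith
  obtain ⟨δ₁, hδ₁, hs1⟩ := hstrict Φ hΦ a₀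
  obtain ⟨δ₂, hδ₂, hs2⟩ := hstrict Φ hΦ b₀
  obtain ⟨δ₃, hδ₃, hs3⟩ := hstrict (fderiv ℝ Φ) hG a₀
  obtain ⟨δ₄, hδ₄, hs4⟩ := Metric.continuous_iff.1 hG.continuous a₀ ε hε0
  obtain ⟨δ₅, hδ₅, hs5⟩ := Metric.continuous_iff.1 hG.continuous b₀ ε hε0
  set ρ := min (min δ₁ (δ₂ / 3)) (min δ₃ (min (δ₄ / 2) (δ₅ / 2))) with hρ
  have hρ1 : ρ ≤ δ₁ := (min_le_left _ _).trans (min_le_left _ _)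
  have hρ2 : ρ ≤ δ₂ / 3 := (min_le_left _ _).trans (min_le_right _ _)
  have hρ3 : ρ ≤ δ₃ := (min_le_right _ _).trans (min_le_left _ _)
  have hρ4 : ρ ≤ δ₄ / 2 := (min_le_right _ _).trans ((min_le_right _ _).trans (min_le_left _ _))
  have hρ5 : ρ ≤ δ₅ / 2 := (min_le_right _ _).trans ((min_le_right _ _).trans (min_le_right _ _))
  refine ⟨κ / 2, by positivity, ρ, by positivity, ?_⟩
  intro ν ν' a η b hν hν' ha hη hb s s'
  set u := ν - ν' with hu
  set τ := s - s' with hτ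
  have h3 := hlin s τ u
  have hE1 : ‖tgL s (fderiv ℝ (fderiv ℝ Φ) a₀ u) + tgL τ (fderiv ℝ Φ a₀ - fderiv ℝ Φ b₀)‖ ≤
      ‖(tg Φ s ν - tg Φ s η) - (tg Φ s' ν' - tg Φ s' η)‖ +
        (k * ‖s‖ * (ε * ‖u‖) + k * ‖τ‖ * (2 * ε)) := by
    have hid : tgL s (fderiv ℝ (fderiv ℝ Φ) a₀ u) + tgL τ (fderiv ℝ Φ a₀ - fderiv ℝ Φ b₀) =
        ((tg Φ s ν - tg Φ s η) - (tg Φ s' ν' - tg Φ s' η)) -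
        (tgL s (fderiv ℝ Φ ν - fderiv ℝ Φ ν' - fderiv ℝ (fderiv ℝ Φ) a₀ u) +
          tgL τ ((fderiv ℝ Φ ν' - fderiv ℝ Φ a₀) - (fderiv ℝ Φ η - fderiv ℝ Φ b₀))) := by
      simp only [tg_eq, tgL_sub, hτ, tgL_sub_left]
      abel
    rw [hid]
    refine (norm_sub_le _ _).trans ?_
    gcongr
    refine (norm_add_le _ _).trans ?_
    gcongr
    · refine (norm_tgL_le _ _).trans ?_
      gcongr
      exact hs3 ν ν' (by linarith) (by linarith)
    · refine (norm_tgL_le _ _).trans ?_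
      gcongr
      refine (norm_sub_le _ _).trans ?_
      have h4 := hs4 ν' (by rw [dist_eq_norm]; linarith)
      have h5 := hs5 η (by rw [dist_eq_norm]; linarith)
      rw [dist_eq_norm] at h4 h5
      linarith
  have hE2 : ‖(fderiv ℝ Φ b₀ - fderiv ℝ Φ a₀) u‖ ≤
      ‖(Φ (ν + (b - a)) - Φ ν) - (Φ (ν' + (b - a)) - Φ ν')‖ + 2 * ε * ‖u‖ := by
    have hsh : ∀ x, ‖x - a₀‖ ≤ ρ → ‖x + (b - a) - b₀‖ ≤ δ₂ := by
      intro x hx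
      have : x + (b - a) - b₀ = (x - a₀) + (b - b₀) - (a - a₀) := by abel
      rw [this]
      refine (norm_sub_le _ _).trans ?_
      have := norm_add_le (x - a₀) (b - b₀)
      linarith
    have h4 := hs2 (ν + (b - a)) (ν' + (b - a)) (hsh _ hν) (hsh _ hν')
    have h5 := hs1 ν ν' (by linarith) (by linarith)
    rw [show ν + (b - a) - (ν' + (b - a)) = u by rw [hu]; abel] at h4
    rw [← hu] at h5
    have hid : (fderiv ℝ Φ b₀ - fderiv ℝ Φ a₀) u =
        ((Φ (ν + (b - a)) - Φ ν) - (Φ (ν' + (b - a)) - Φ ν')) -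
        ((Φ (ν + (b - a)) - Φ (ν' + (b - a)) - fderiv ℝ Φ b₀ u) -
          (Φ ν - Φ ν' - fderiv ℝ Φ a₀ u)) := by
      rw [_root_.sub_apply]
      abel
    rw [hid]
    refine (norm_sub_le _ _).trans ?_
    gcongr
    refine (norm_sub_le _ _).trans ?_
    linarith
  have h6 : ‖s‖ * ‖(fderiv ℝ Φ b₀ - fderiv ℝ Φ a₀) u‖ ≤
      ‖s‖ * ‖(Φ (ν + (b - a)) - Φ ν) - (Φ (ν' + (b - a)) - Φ ν')‖ + 2 * ε * (‖s‖ * ‖u‖) := by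
    calc _ ≤ ‖s‖ * (‖(Φ (ν + (b - a)) - Φ ν) - (Φ (ν' + (b - a)) - Φ ν')‖ + 2 * ε * ‖u‖) := by
          gcongr
      _ = _ := by ring
  have h7 : (2 * k + 2) * ε = κ / 2 := by
    rw [hε]
    field_simp
  have h8 : 0 ≤ ‖s‖ * ‖u‖ := by positivity
  have h9 := norm_nonneg τ
  have hk0 : (0 : ℝ) ≤ k := by positivity
  have h10 : κ / 2 * (‖s‖ * ‖u‖ + ‖τ‖) = (2 * k + 2) * ε * (‖s‖ * ‖u‖) + (2 * k + 2) * ε * ‖τ‖ := by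
    rw [h7]; ring
  have h11 : 0 ≤ k * ε * (‖s‖ * ‖u‖) := by positivity
  have h12 : 0 ≤ ε * ‖τ‖ := by positivity
  nlinarith

end Nondegeneracy

/-- The centre of a lattice cell of side `r`. -/
def ctr (r : ℝ) (q : (Fin d → ℤ) × (Fin k → ℤ)) : (Fin d → ℝ) × (Fin k → ℝ) :=
  (r • (rl q.1 + fun _ => 1 / 2), r • (rl q.2 + fun _ => 1 / 2))

/-- The wave packet `T` passes near the cell `q`. -/
def Inc (Φ : (Fin d → ℝ) → Fin k → ℝ) (r D : ℝ) (T : (Fin d → ℤ) × (Fin d → ℤ))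
    (q : (Fin d → ℤ) × (Fin k → ℤ)) : Prop :=
  ‖(ctr r q).1 + tg Φ (ctr r q).2 (frq r T.1) - r • rl T.2‖ ≤ r * D

/-- The block of cells containing `q`. -/
def blk (K : ℕ) (q : (Fin d → ℤ) × (Fin k → ℤ)) : (Fin d → ℤ) × (Fin k → ℤ) :=
  (fun i => q.1 i / (K : ℤ), fun j => q.2 j / (K : ℤ))

/-- Two blocks coincide or are adjacent. -/
def Near (b b' : (Fin d → ℤ) × (Fin k → ℤ)) : Prop :=
  (∀ i, |b.1 i - b'.1 i| ≤ 1) ∧ ∀ j, |b.2 j - b'.2 j| ≤ 1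

lemma le_abs_sub_of_two_le {K : ℕ} (hK : 0 < K) {x y : ℤ} (h : ¬ |x / (K : ℤ) - y / (K : ℤ)| ≤ 1) :
    (K : ℤ) ≤ |x - y| := by
  have hK' : (0 : ℤ) < K := by exact_mod_cast hK
  have h1 := Int.mul_ediv_add_emod x K
  have h2 := Int.mul_ediv_add_emod y K
  have h3 := Int.emod_nonneg x hK'.ne'
  have h4 := Int.emod_nonneg y hK'.ne'
  have h5 := Int.emod_lt_of_pos x hK'
  have h6 := Int.emod_lt_of_pos y hK'
  set a := x / (K : ℤ)
  set b := y / (K : ℤ)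
  rw [not_le, lt_abs] at h
  rw [le_abs]
  rcases h with h | h
  · left
    nlinarith
  · right
    nlinarith

lemma rl_sub_apply {ι : Type*} (m n : ι → ℤ) (i : ι) : (rl m - rl n) i = ((m i - n i : ℤ) : ℝ) := by
  simp [rl]

lemma le_norm_of_not_near {r : ℝ} (hr : 0 < r) {K : ℕ} (hK : 0 < K)
    {q q' : (Fin d → ℤ) × (Fin k → ℤ)} (h : ¬ Near (blk K q) (blk K q')) :
    r * K ≤ ‖(ctr r q).1 - (ctr r q').1‖ ∨ r * K ≤ ‖(ctr r q).2 - (ctr r q').2‖ := by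
  have key : ∀ {ι : Type} [Fintype ι] (m n : ι → ℤ), (∃ i, ¬ |m i / (K : ℤ) - n i / (K : ℤ)| ≤ 1) →
      r * K ≤ ‖r • (rl m + fun _ => (1 / 2 : ℝ)) - r • (rl n + fun _ => (1 / 2 : ℝ))‖ := by
    rintro ι _ m n ⟨i, hi⟩
    rw [← smul_sub, add_sub_add_right_eq_sub, norm_smul, Real.norm_of_nonneg hr.le]
    gcongr
    refine le_trans ?_ (norm_le_pi_norm _ i)
    rw [rl_sub_apply, Real.norm_eq_abs, ← Int.cast_abs]
    exact_mod_cast le_abs_sub_of_two_le hK hi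
  unfold Near at h
  rw [not_and_or, not_forall, not_forall] at h
  rcases h with h | h
  · exact Or.inl (key _ _ h)
  · exact Or.inr (key _ _ h)

lemma tg_sub_left (Φ : (Fin d → ℝ) → Fin k → ℝ) (s t : Fin k → ℝ) (ν : Fin d → ℝ) :
    tg Φ (s - t) ν = tg Φ s ν - tg Φ t ν := tgL_sub_left _ _ _

lemma norm_rl_sub_le {r : ℝ} (hr : 0 < r) {n n' : Fin d → ℤ} {C : ℝ}
    (h : ‖frq r n - frq r n'‖ ≤ C * r⁻¹) : ‖rl n - rl n'‖ ≤ 2 * C := by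
  unfold frq at h
  rw [← smul_sub, norm_smul, Real.norm_of_nonneg (by positivity)] at h
  rw [mul_inv] at h
  have : r * (2⁻¹ * r⁻¹ * ‖rl n - rl n'‖) ≤ r * (C * r⁻¹) := by gcongr
  field_simp at this
  linarith

set_option maxHeartbeats 2000000 in
/-- Two solutions of the incidence and resonance relations are close to each other. -/
lemma exists_separation {Φ : (Fin d → ℝ) → Fin k → ℝ} (hΦ : ContDiff ℝ (⊤ : ℕ∞) Φ) (B Λ κ : ℝ)
    (hB : 0 ≤ B) (hΛ : 0 < Λ) (hκ : 0 < κ) :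
    ∃ C : ℝ, 1 ≤ C ∧ ∀ (r D : ℝ) (K : ℕ), 1 ≤ D → C * D ^ 2 ≤ r → r ≤ K * D →
      ∀ T₁ T₂ S T T' : (Fin d → ℤ) × (Fin d → ℤ), ∀ n₂ n₂' : Fin d → ℤ,
      ∀ q x x' : (Fin d → ℤ) × (Fin k → ℤ),
      ‖frq r T₁.1‖ ≤ B → ‖frq r T₂.1‖ ≤ B → ‖frq r S.1‖ ≤ B → ‖frq r T.1‖ ≤ B → ‖frq r T'.1‖ ≤ B →
      ‖frq r n₂‖ ≤ B → ‖frq r n₂'‖ ≤ B →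
      ‖(ctr r q).2‖ ≤ r ^ 2 → ‖(ctr r x).2‖ ≤ r ^ 2 →
      (∀ s s' : Fin k → ℝ, κ * (‖s‖ * ‖frq r T.1 - frq r T'.1‖ + ‖s - s'‖) ≤
        ‖(tg Φ s (frq r T.1) - tg Φ s (frq r S.1)) - (tg Φ s' (frq r T'.1) - tg Φ s' (frq r S.1))‖ +
        ‖s‖ * ‖(Φ (frq r T.1 + (frq r T₂.1 - frq r T₁.1)) - Φ (frq r T.1)) -
          (Φ (frq r T'.1 + (frq r T₂.1 - frq r T₁.1)) - Φ (frq r T'.1))‖) →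
      Inc Φ r D T q → Inc Φ r D T' q → Inc Φ r D T x → Inc Φ r D T' x' →
      Inc Φ r D S x → Inc Φ r D S x' → ¬ Near (blk K q) (blk K x) →
      Res Φ r Λ T₁.1 T.1 n₂ T₂.1 → Res Φ r Λ T₁.1 T'.1 n₂' T₂.1 →
      ‖rl T.1 - rl T'.1‖ ≤ C * D ^ 2 ∧ ‖rl T.2 - rl T'.2‖ ≤ C * D ^ 2 ∧
        ‖rl x.1 - rl x'.1‖ ≤ C * D ^ 2 ∧ ‖rl x.2 - rl x'.2‖ ≤ C * D ^ 2 := by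
  obtain ⟨L, hL0, hL⟩ := exists_lipschitz_ball hΦ (3 * B)
  obtain ⟨L₂, hL₂0, hL₂⟩ := exists_lipschitz_ball (hΦ.fderiv_right (m := (⊤ : ℕ∞)) (by simp)) B
  obtain ⟨M₀, hM₀⟩ := (isCompact_closedBall (0 : Fin d → ℝ) B).exists_bound_of_continuousOn
      (hΦ.continuous_fderiv (by simp)).continuousOn
  set M := max M₀ 0 with hMdef
  have hM0 : 0 ≤ M := le_max_right _ _
  have hM : ∀ ν : Fin d → ℝ, ‖ν‖ ≤ B → ∀ s : Fin k → ℝ, ‖tg Φ s ν‖ ≤ k * M * ‖s‖ := by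
    intro ν hν s
    refine (norm_tg_le Φ s ν).trans ?_
    calc _ ≤ k * ‖s‖ * M := by
          gcongr
          exact (hM₀ ν (by simpa using hν)).trans (le_max_left _ _)
      _ = _ := by ring
  set C₁ := (6 + 4 * (1 + L) * Λ) / κ with hC₁
  set C₂ := 2 * C₁ * (k * M + 1) with hC₂
  have hC₁0 : 0 ≤ C₁ := by positivity
  have hC₂0 : 0 ≤ C₂ := by positivity
  refine ⟨4 + 2 * C₂ + (k * L₂ * C₂ + 2) + (k * M * C₁ + 2) + C₁, ?_, ?_⟩
  · have : 0 ≤ k * L₂ * C₂ := by positivity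
    have : 0 ≤ k * M * C₁ := by positivity
    linarith
  intro r D K hD hr hK T₁ T₂ S T T' n₂ n₂' q x x' b₁ b₂ bS bT bT' bn bn' tq tx hND
    iT iT' iTx iTx' iS iS' hnear hres hres'
  have p1 : 0 ≤ k * L₂ * C₂ := by positivity
  have p2 : 0 ≤ k * M * C₁ := by positivity
  have hD0 : 0 < D := by linarith
  have hDD : D ≤ D ^ 2 := by nlinarith
  have hr4 : 4 * D ^ 2 ≤ r := le_trans (by
    gcongr
    linarith) hr
  have hr0 : 0 < r := lt_of_lt_of_le (by positivity) hr4
  have hKp : 0 < K := by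
    by_contra h
    have : K = 0 := by omega
    subst this
    simp at hK
    linarith
  unfold Inc at iT iT' iTx iTx' iS iS'
  set ν := frq r T.1
  set ν' := frq r T'.1
  set η := frq r S.1
  set a := frq r T₁.1
  set b := frq r T₂.1
  set s := (ctr r q).2 - (ctr r x).2 with hs
  set s' := (ctr r q).2 - (ctr r x').2 with hs'
  have hs2 : ‖s‖ ≤ 2 * r ^ 2 := (norm_sub_le _ _).trans (by linarith)
  have geo : ∀ (U : (Fin d → ℤ) × (Fin d → ℤ)) (y : (Fin d → ℤ) × (Fin k → ℤ)),
      ‖(ctr r q).1 + tg Φ (ctr r q).2 (frq r U.1) - r • rl U.2‖ ≤ r * D →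
      ‖(ctr r y).1 + tg Φ (ctr r y).2 (frq r U.1) - r • rl U.2‖ ≤ r * D →
      ‖(ctr r q).1 - (ctr r y).1 + tg Φ ((ctr r q).2 - (ctr r y).2) (frq r U.1)‖ ≤ 2 * (r * D) := by
    intro U y h1 h2
    have : (ctr r q).1 - (ctr r y).1 + tg Φ ((ctr r q).2 - (ctr r y).2) (frq r U.1) =
        ((ctr r q).1 + tg Φ (ctr r q).2 (frq r U.1) - r • rl U.2) -
        ((ctr r y).1 + tg Φ (ctr r y).2 (frq r U.1) - r • rl U.2) := by
      rw [tg_sub_left]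
      abel
    rw [this]
    exact (norm_sub_le _ _).trans (by linarith)
  have g1 := geo T x iT iTx
  have g2 := geo T' x' iT' iTx'
  have hE1 : ‖(tg Φ s ν - tg Φ s η) - (tg Φ s' ν' - tg Φ s' η)‖ ≤ 6 * (r * D) := by
    have : (tg Φ s ν - tg Φ s η) - (tg Φ s' ν' - tg Φ s' η) =
        (((ctr r q).1 - (ctr r x).1 + tg Φ s ν) - ((ctr r q).1 - (ctr r x').1 + tg Φ s' ν')) +
        (((ctr r x).1 + tg Φ (ctr r x).2 η - r • rl S.2) -
          ((ctr r x').1 + tg Φ (ctr r x').2 η - r • rl S.2)) := by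
      simp only [hs, hs', tg_sub_left]
      abel
    rw [this]
    refine (norm_add_le _ _).trans ?_
    have e1 := norm_sub_le ((ctr r q).1 - (ctr r x).1 + tg Φ s ν)
      ((ctr r q).1 - (ctr r x').1 + tg Φ s' ν')
    have e2 := norm_sub_le ((ctr r x).1 + tg Φ (ctr r x).2 η - r • rl S.2)
          ((ctr r x').1 + tg Φ (ctr r x').2 η - r • rl S.2)
    linarith
  have hri : 0 < r⁻¹ := inv_pos.2 hr0
  have hreso : ∀ (m : Fin d → ℤ) (μ : Fin d → ℝ), ‖frq r m‖ ≤ B → ‖μ‖ ≤ B →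
      ‖a - μ + (frq r m - b)‖ ≤ Λ * r⁻¹ → ‖Φ a - Φ μ + (Φ (frq r m) - Φ b)‖ ≤ Λ * r⁻¹ →
      ‖Φ (μ + (b - a)) - Φ μ + (Φ a - Φ b)‖ ≤ (1 + L) * Λ * r⁻¹ := by
    intro m μ hm hμ h1 h2
    have h3 : ‖Φ (frq r m) - Φ (μ + (b - a))‖ ≤ L * (Λ * r⁻¹) := by
      refine (hL _ _ (by linarith) ?_).trans ?_
      · have e1 := norm_add_le μ (b - a)
        have e2 := norm_sub_le b a
        linarith
      · gcongr
        rwa [show frq r m - (μ + (b - a)) = a - μ + (frq r m - b) by abel]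
    have : Φ (μ + (b - a)) - Φ μ + (Φ a - Φ b) =
        (Φ a - Φ μ + (Φ (frq r m) - Φ b)) - (Φ (frq r m) - Φ (μ + (b - a))) := by abel
    rw [this]
    refine (norm_sub_le _ _).trans ?_
    linarith
  have hE2 : ‖(Φ (ν + (b - a)) - Φ ν) - (Φ (ν' + (b - a)) - Φ ν')‖ ≤ 2 * ((1 + L) * Λ * r⁻¹) := by
    have h1 := hreso n₂ ν bn bT hres.1 hres.2
    have h2 := hreso n₂' ν' bn' bT' hres'.1 hres'.2
    have : (Φ (ν + (b - a)) - Φ ν) - (Φ (ν' + (b - a)) - Φ ν') =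
      (Φ (ν + (b - a)) - Φ ν + (Φ a - Φ b)) - (Φ (ν' + (b - a)) - Φ ν' + (Φ a - Φ b)) := by abel
    rw [this]
    exact (norm_sub_le _ _).trans (by linarith)
  have hmain : ‖s‖ * ‖ν - ν'‖ + ‖s - s'‖ ≤ C₁ * (r * D) := by
    have h1 := hND s s'
    have h2 : ‖s‖ * ‖(Φ (ν + (b - a)) - Φ ν) - (Φ (ν' + (b - a)) - Φ ν')‖ ≤
        4 * (1 + L) * Λ * (r * D) := by
      calc _ ≤ (2 * r ^ 2) * (2 * ((1 + L) * Λ * r⁻¹)) := by gcongr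
        _ = 4 * (1 + L) * Λ * (r * 1) := by
          field_simp
          ring
        _ ≤ _ := by gcongr
    rw [hC₁, div_mul_eq_mul_div, le_div_iff₀ hκ]
    linarith
  have hp1 : 0 ≤ ‖s‖ * ‖ν - ν'‖ := by positivity
  have hss : ‖s - s'‖ ≤ C₁ * (r * D) := by linarith
  have hlow : r ^ 2 ≤ 2 * D * ((k * M + 1) * ‖s‖) := by
    have hrK : r ^ 2 ≤ D * (r * K) := by
      calc r ^ 2 = r * r := sq r
        _ ≤ r * (K * D) := by gcongr
        _ = _ := by ring
    rcases le_norm_of_not_near hr0 hKp hnear with h | h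
    · have h1 := hM ν bT s
      have h2 : ‖(ctr r q).1 - (ctr r x).1‖ ≤ 2 * (r * D) + k * M * ‖s‖ := by
        have e := norm_sub_le ((ctr r q).1 - (ctr r x).1 + tg Φ s ν) (tg Φ s ν)
        rw [add_sub_cancel_right] at e
        linarith
      have h3 : D * (r * K) ≤ D * (2 * (r * D) + k * M * ‖s‖) := by gcongr; exact h.trans h2
      have h4 : 0 ≤ D * ‖s‖ := by positivity
      have h5 : 4 * D ^ 2 * r ≤ r * r := by gcongr
      linarith
    · change r * K ≤ ‖s‖ at h
      have h3 : D * (r * K) ≤ D * ‖s‖ := by gcongr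
      have h4 : 0 ≤ D * ‖s‖ := by positivity
      have h5 : 0 ≤ k * M * (D * ‖s‖) := by positivity
      linarith
  have hν : ‖ν - ν'‖ ≤ C₂ * D ^ 2 * r⁻¹ := by
    have h1 : ‖s‖ * ‖ν - ν'‖ ≤ C₁ * (r * D) := by linarith [norm_nonneg (s - s')]
    have h2 : r ^ 2 * ‖ν - ν'‖ ≤ 2 * D * (k * M + 1) * (C₁ * (r * D)) := by
      calc _ ≤ 2 * D * ((k * M + 1) * ‖s‖) * ‖ν - ν'‖ := by gcongr
        _ = 2 * D * (k * M + 1) * (‖s‖ * ‖ν - ν'‖) := by ring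
        _ ≤ _ := by gcongr
    rw [← div_eq_mul_inv, le_div_iff₀ hr0]
    have h3 : r * (‖ν - ν'‖ * r) ≤ r * (C₂ * D ^ 2) := by
      rw [hC₂]
      linarith
    exact le_of_mul_le_mul_left h3 hr0
  have hctr : ∀ {ι : Type} [Fintype ι] (m n : ι → ℤ) (c : ℝ),
      ‖r • (rl m + fun _ => (1 / 2 : ℝ)) - r • (rl n + fun _ => (1 / 2 : ℝ))‖ ≤ c * (r * D) →
      ‖rl m - rl n‖ ≤ c * D := by
    intro ι _ m n c h
    rw [← smul_sub, add_sub_add_right_eq_sub, norm_smul, Real.norm_of_nonneg hr0.le] at h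
    exact le_of_mul_le_mul_left (by linarith) hr0
  have hx1 : ‖(ctr r x).1 - (ctr r x').1‖ ≤ (k * M * C₁ + 2) * (r * D) := by
    have : (ctr r x).1 - (ctr r x').1 =
        (((ctr r x).1 + tg Φ (ctr r x).2 η - r • rl S.2) -
          ((ctr r x').1 + tg Φ (ctr r x').2 η - r • rl S.2)) + tg Φ (s - s') η := by
      simp only [hs, hs', tg_sub_left]
      abel
    rw [this]
    refine (norm_add_le _ _).trans ?_
    have e1 := norm_sub_le ((ctr r x).1 + tg Φ (ctr r x).2 η - r • rl S.2)
          ((ctr r x').1 + tg Φ (ctr r x').2 η - r • rl S.2)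
    have e2 := hM η bS (s - s')
    have e3 : k * M * ‖s - s'‖ ≤ k * M * (C₁ * (r * D)) := by gcongr
    linarith
  have hx2 : ‖(ctr r x).2 - (ctr r x').2‖ ≤ C₁ * (r * D) := by
    have : (ctr r x).2 - (ctr r x').2 = -(s - s') := by
      rw [hs, hs']
      abel
    rwa [this, norm_neg]
  have hm : ‖rl T.2 - rl T'.2‖ ≤ (k * L₂ * C₂ + 2) * D ^ 2 := by
    have h1 : r • rl T.2 - r • rl T'.2 =
        (((ctr r q).1 + tg Φ (ctr r q).2 ν' - r • rl T'.2) -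
          ((ctr r q).1 + tg Φ (ctr r q).2 ν - r • rl T.2)) +
          tgL (ctr r q).2 (fderiv ℝ Φ ν - fderiv ℝ Φ ν') := by
      rw [tgL_sub, ← tg_eq, ← tg_eq]
      abel
    have h2 : ‖tgL (ctr r q).2 (fderiv ℝ Φ ν - fderiv ℝ Φ ν')‖ ≤ k * L₂ * C₂ * D ^ 2 * r := by
      refine (norm_tgL_le _ _).trans ?_
      calc _ ≤ k * r ^ 2 * (L₂ * (C₂ * D ^ 2 * r⁻¹)) := by
            gcongr
            exact (hL₂ _ _ bT bT').trans (by gcongr)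
        _ = _ := by
            field_simp
    have h3 : r * ‖rl T.2 - rl T'.2‖ ≤ 2 * (r * D) + k * L₂ * C₂ * D ^ 2 * r := by
      calc _ = ‖r • rl T.2 - r • rl T'.2‖ := by
            rw [← smul_sub, norm_smul, Real.norm_of_nonneg hr0.le]
        _ ≤ _ := by
            rw [h1]
            refine (norm_add_le _ _).trans ?_
            have e1 := norm_sub_le ((ctr r q).1 + tg Φ (ctr r q).2 ν' - r • rl T'.2)
              ((ctr r q).1 + tg Φ (ctr r q).2 ν - r • rl T.2)
            linarith
    have h4 : r * ‖rl T.2 - rl T'.2‖ ≤ r * ((k * L₂ * C₂ + 2) * D ^ 2) := by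
      have h5 : r * D ≤ r * D ^ 2 := mul_le_mul_of_nonneg_left hDD hr0.le
      linarith
    exact le_of_mul_le_mul_left h4 hr0
  have hD2 : 0 ≤ D ^ 2 := by positivity
  have mono : ∀ {u c X : ℝ}, u ≤ c * D ^ 2 → c ≤ X → u ≤ X * D ^ 2 := fun h h' =>
    h.trans (mul_le_mul_of_nonneg_right h' hD2)
  have hDD' : ∀ {c : ℝ}, 0 ≤ c → c * D ≤ c * D ^ 2 := fun h => mul_le_mul_of_nonneg_left hDD h
  refine ⟨mono ((norm_rl_sub_le hr0 hν).trans (mul_assoc _ _ _).symm.le) ?_, mono hm ?_,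
    mono ((hctr _ _ _ hx1).trans (hDD' ?_)) ?_, mono ((hctr _ _ _ hx2).trans (hDD' hC₁0)) ?_⟩
  all_goals linarith

lemma card_le_of_pairwise {α ι : Type*} [Fintype ι] (s : Finset α) {e : α → ι → ℤ}
    (he : Function.Injective e) {M : ℝ} (hM : 0 ≤ M)
    (h : ∀ x ∈ s, ∀ y ∈ s, ‖rl (e x) - rl (e y)‖ ≤ M) :
    (s.card : ℝ) ≤ (2 * M + 1) ^ Fintype.card ι := by
  classical
  rcases s.eq_empty_or_nonempty with rfl | ⟨y, hy⟩
  · simp only [Finset.card_empty, Nat.cast_zero]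
    positivity
  · rw [← Finset.card_image_of_injective s he]
    refine card_lattice_le _ (rl (e y)) hM fun n hn => ?_
    obtain ⟨x, hx, rfl⟩ := Finset.mem_image.1 hn
    exact h x hx y hy

lemma norm_rl_elim_sub_le {ι ι' : Type*} [Fintype ι] [Fintype ι'] {m n : ι → ℤ} {m' n' : ι' → ℤ}
    {M : ℝ} (hM : 0 ≤ M) (h : ‖rl m - rl n‖ ≤ M) (h' : ‖rl m' - rl n'‖ ≤ M) :
    ‖rl (Sum.elim m m') - rl (Sum.elim n n')‖ ≤ M := by
  rw [pi_norm_le_iff_of_nonneg hM] at *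
  rintro (i | i)
  · exact h i
  · exact h' i

lemma sumElim_injective {ι ι' : Type*} :
    Function.Injective fun T : (ι → ℤ) × (ι' → ℤ) => Sum.elim T.1 T.2 := by
  rintro ⟨a, b⟩ ⟨a', b'⟩ h
  have h1 := fun i => congrFun h (Sum.inl i)
  have h2 := fun i => congrFun h (Sum.inr i)
  simp only [Sum.elim_inl, Sum.elim_inr] at h1 h2
  rw [Prod.mk.injEq]
  exact ⟨funext h1, funext h2⟩

lemma tg_sub_eq (Φ : (Fin d → ℝ) → Fin k → ℝ) (s : Fin k → ℝ) (ν ν' : Fin d → ℝ) :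
    tg Φ s ν - tg Φ s ν' = tgL s (fderiv ℝ Φ ν - fderiv ℝ Φ ν') := by
  rw [tgL_sub, ← tg_eq, ← tg_eq]

lemma norm_rl_sub_le_of_inc {Φ : (Fin d → ℝ) → Fin k → ℝ} {B L₂ : ℝ} (hL₂0 : 0 ≤ L₂)
    (hL₂ : ∀ x y : Fin d → ℝ, ‖x‖ ≤ B → ‖y‖ ≤ B → ‖fderiv ℝ Φ x - fderiv ℝ Φ y‖ ≤ L₂ * ‖x - y‖)
    {r D c : ℝ} (hr : 0 < r) {q : (Fin d → ℤ) × (Fin k → ℤ)}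
    (hq : ‖(ctr r q).2‖ ≤ r ^ 2) {T T' : (Fin d → ℤ) × (Fin d → ℤ)} (bT : ‖frq r T.1‖ ≤ B)
    (bT' : ‖frq r T'.1‖ ≤ B) (iT : Inc Φ r D T q) (iT' : Inc Φ r D T' q)
    (hν : ‖frq r T.1 - frq r T'.1‖ ≤ c * r⁻¹) :
    ‖rl T.2 - rl T'.2‖ ≤ 2 * D + k * L₂ * c := by
  unfold Inc at iT iT'
  have h1 : r • rl T.2 - r • rl T'.2 =
      (((ctr r q).1 + tg Φ (ctr r q).2 (frq r T'.1) - r • rl T'.2) -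
        ((ctr r q).1 + tg Φ (ctr r q).2 (frq r T.1) - r • rl T.2)) +
        tgL (ctr r q).2 (fderiv ℝ Φ (frq r T.1) - fderiv ℝ Φ (frq r T'.1)) := by
    rw [← tg_sub_eq]
    abel
  have h2 : ‖tgL (ctr r q).2 (fderiv ℝ Φ (frq r T.1) - fderiv ℝ Φ (frq r T'.1))‖ ≤
      k * L₂ * c * r := by
    refine (norm_tgL_le _ _).trans ?_
    calc _ ≤ k * r ^ 2 * (L₂ * (c * r⁻¹)) := by
          gcongr
          exact (hL₂ _ _ bT bT').trans (by gcongr)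
      _ = _ := by
          field_simp
  have h3 : r * ‖rl T.2 - rl T'.2‖ ≤ r * (2 * D + k * L₂ * c) := by
    calc _ = ‖r • rl T.2 - r • rl T'.2‖ := by
          rw [← smul_sub, norm_smul, Real.norm_of_nonneg hr.le]
      _ ≤ _ := by
          rw [h1]
          refine (norm_add_le _ _).trans ?_
          have e1 := norm_sub_le ((ctr r q).1 + tg Φ (ctr r q).2 (frq r T'.1) - r • rl T'.2)
            ((ctr r q).1 + tg Φ (ctr r q).2 (frq r T.1) - r • rl T.2)
          linarith
  exact le_of_mul_le_mul_left h3 hr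

open scoped Classical in
lemma exists_card_resonant_le {Φ : (Fin d → ℝ) → Fin k → ℝ} (hΦ : ContDiff ℝ (⊤ : ℕ∞) Φ)
    (B Λ : ℝ) (hΛ : 0 < Λ) :
    ∃ C : ℝ, 0 ≤ C ∧ ∀ r D : ℝ, 0 < r → 1 ≤ D → ∀ 𝒯 : Finset ((Fin d → ℤ) × (Fin d → ℤ)),
      (∀ T ∈ 𝒯, ‖frq r T.1‖ ≤ B) → ∀ q : (Fin d → ℤ) × (Fin k → ℤ), ‖(ctr r q).2‖ ≤ r ^ 2 →
      ∀ n₁ n₁' n₂' : Fin d → ℤ,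
      ((𝒯.filter fun T => Inc Φ r D T q ∧ Res Φ r Λ n₁ n₁' T.1 n₂').card : ℝ) ≤
        C * D ^ (2 * d) := by
  obtain ⟨L₂, hL₂0, hL₂⟩ := exists_lipschitz_ball (hΦ.fderiv_right (m := (⊤ : ℕ∞)) (by simp)) B
  set M := 4 * Λ + (2 + k * L₂ * (2 * Λ)) with hM
  have hM0 : 0 ≤ M := by positivity
  refine ⟨(2 * M + 1) ^ (2 * d), by positivity, fun r D hr hD 𝒯 h𝒯 q hq n₁ n₁' n₂' => ?_⟩
  have hcard : 2 * d = Fintype.card (Fin d ⊕ Fin d) := by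
    simp
    ring
  have hD1 : 2 * (M * D) + 1 ≤ (2 * M + 1) * D := by nlinarith
  refine (card_le_of_pairwise _ sumElim_injective (M := M * D) (by positivity) ?_).trans ?_
  · intro T hT T' hT'
    rw [Finset.mem_filter] at hT hT'
    have hν : ‖frq r T.1 - frq r T'.1‖ ≤ 2 * Λ * r⁻¹ := by
      have e := norm_sub_le (frq r n₁ - frq r n₁' + (frq r T.1 - frq r n₂'))
        (frq r n₁ - frq r n₁' + (frq r T'.1 - frq r n₂'))
      rw [add_sub_add_left_eq_sub, sub_sub_sub_cancel_right] at e
      linarith [hT.2.2.1, hT'.2.2.1]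
    have h1 := norm_rl_sub_le hr hν
    have h2 := norm_rl_sub_le_of_inc hL₂0 hL₂ hr hq (h𝒯 _ hT.1) (h𝒯 _ hT'.1) hT.2.1 hT'.2.1 hν
    have h3 : 0 ≤ k * L₂ * (2 * Λ) := by positivity
    apply norm_rl_elim_sub_le (by positivity)
    · refine h1.trans ?_
      nlinarith
    · refine h2.trans ?_
      nlinarith
  · rw [hcard, ← mul_pow]
    gcongr

/-- The transversality inequality with constant `κ` for frequencies near `a₀` and `b₀`. -/
def Transversal (Φ : (Fin d → ℝ) → Fin k → ℝ) (κ ρ : ℝ) (a₀ b₀ : Fin d → ℝ) : Prop :=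
  ∀ ν ν' a η b : Fin d → ℝ,
    ‖ν - a₀‖ ≤ ρ → ‖ν' - a₀‖ ≤ ρ → ‖a - a₀‖ ≤ ρ → ‖η - b₀‖ ≤ ρ → ‖b - b₀‖ ≤ ρ →
    ∀ s s' : Fin k → ℝ, κ * (‖s‖ * ‖ν - ν'‖ + ‖s - s'‖) ≤
      ‖(tg Φ s ν - tg Φ s η) - (tg Φ s' ν' - tg Φ s' η)‖ +
      ‖s‖ * ‖(Φ (ν + (b - a)) - Φ ν) - (Φ (ν' + (b - a)) - Φ ν')‖

open scoped Classical in
lemma exists_card_far_le {Φ : (Fin d → ℝ) → Fin k → ℝ} (hΦ : ContDiff ℝ (⊤ : ℕ∞) Φ)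
    (B Λ κ : ℝ) (hB : 0 ≤ B) (hΛ : 0 < Λ) (hκ : 0 < κ) :
    ∃ C : ℝ, 1 ≤ C ∧ ∀ a₀ b₀ : Fin d → ℝ, ∀ ρ : ℝ, Transversal Φ κ ρ a₀ b₀ →
      ‖a₀‖ + ρ ≤ B → ‖b₀‖ + ρ ≤ B → ∀ (r D : ℝ) (K : ℕ), 1 ≤ D → C * D ^ 2 ≤ r → r ≤ K * D →
      ∀ 𝒯₁ 𝒯₂ : Finset ((Fin d → ℤ) × (Fin d → ℤ)),
      (∀ T ∈ 𝒯₁, ‖frq r T.1 - a₀‖ ≤ ρ) → (∀ T ∈ 𝒯₂, ‖frq r T.1 - b₀‖ ≤ ρ) →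
      ∀ Q : Finset ((Fin d → ℤ) × (Fin k → ℤ)), (∀ q ∈ Q, ‖(ctr r q).2‖ ≤ r ^ 2) →
      ∀ q ∈ Q, ∀ T₁ ∈ 𝒯₁, ∀ T₂ ∈ 𝒯₂, ∀ S ∈ 𝒯₂,
      (((𝒯₁ ×ˢ Q).filter fun x => Inc Φ r D x.1 q ∧
        (∃ T' ∈ 𝒯₂, Inc Φ r D T' q ∧ Res Φ r Λ T₁.1 x.1.1 T'.1 T₂.1) ∧
        ¬ Near (blk K q) (blk K x.2) ∧ Inc Φ r D x.1 x.2 ∧ Inc Φ r D S x.2).card : ℝ) ≤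
        C * D ^ (2 * (3 * d + k)) := by
  obtain ⟨M, hM1, hM⟩ := exists_separation hΦ B Λ κ hB hΛ hκ
  refine ⟨(2 * M + 1) ^ (3 * d + k) + M, ?_, ?_⟩
  · have : 0 ≤ (2 * M + 1) ^ (3 * d + k) := by positivity
    linarith
  intro a₀ b₀ ρ htr ha hb r D K hD hr hK 𝒯₁ 𝒯₂ h𝒯₁ h𝒯₂ Q hQ q hq T₁ hT₁ T₂ hT₂ S hS
  have hM0 : 0 ≤ (2 * M + 1) ^ (3 * d + k) := by positivity
  have hr' : M * D ^ 2 ≤ r := by nlinarith [sq_nonneg D]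
  have hbd : ∀ {c v : Fin d → ℝ}, ‖c‖ + ρ ≤ B → ‖v - c‖ ≤ ρ → ‖v‖ ≤ B := by
    intro c v h1 h2
    have := norm_add_le (v - c) c
    rw [sub_add_cancel] at this
    linarith
  have hcard : 3 * d + k = Fintype.card ((Fin d ⊕ Fin d) ⊕ (Fin d ⊕ Fin k)) := by
    simp
    ring
  have hinj : Function.Injective fun x : ((Fin d → ℤ) × (Fin d → ℤ)) × ((Fin d → ℤ) × (Fin k → ℤ)) =>
      Sum.elim (Sum.elim x.1.1 x.1.2) (Sum.elim x.2.1 x.2.2) := by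
    rintro ⟨x, y⟩ ⟨x', y'⟩ h
    have h1 := sumElim_injective (a₁ := (Sum.elim x.1 x.2, Sum.elim y.1 y.2))
      (a₂ := (Sum.elim x'.1 x'.2, Sum.elim y'.1 y'.2)) h
    rw [Prod.mk.injEq] at h1 ⊢
    exact ⟨sumElim_injective h1.1, sumElim_injective h1.2⟩
  refine (card_le_of_pairwise _ hinj (M := M * D ^ 2) (by positivity) ?_).trans ?_
  · rintro ⟨T, x⟩ hx ⟨T', x'⟩ hx'
    rw [Finset.mem_filter, Finset.mem_product] at hx hx'
    obtain ⟨⟨hT, hxQ⟩, iT, ⟨U, hU, -, hres⟩, hnear, iTx, iS⟩ := hx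
    obtain ⟨⟨hT', hxQ'⟩, iT', ⟨U', hU', -, hres'⟩, -, iTx', iS'⟩ := hx'
    have h := hM r D K hD hr' hK T₁ T₂ S T T' U.1 U'.1 q x x' (hbd ha (h𝒯₁ _ hT₁))
      (hbd hb (h𝒯₂ _ hT₂)) (hbd hb (h𝒯₂ _ hS)) (hbd ha (h𝒯₁ _ hT)) (hbd ha (h𝒯₁ _ hT'))
      (hbd hb (h𝒯₂ _ hU)) (hbd hb (h𝒯₂ _ hU')) (hQ _ hq) (hQ _ hxQ)
      (htr _ _ _ _ _ (h𝒯₁ _ hT) (h𝒯₁ _ hT') (h𝒯₁ _ hT₁) (h𝒯₂ _ hS) (h𝒯₂ _ hT₂))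
      iT iT' iTx iTx' iS iS' hnear hres hres'
    have h0 : 0 ≤ M * D ^ 2 := by positivity
    exact norm_rl_elim_sub_le h0 (norm_rl_elim_sub_le h0 h.1 h.2.1)
      (norm_rl_elim_sub_le h0 h.2.2.1 h.2.2.2)
  · rw [← hcard, pow_mul]
    calc _ ≤ ((2 * M + 1) * D ^ 2) ^ (3 * d + k) := by
          gcongr
          nlinarith
      _ = (2 * M + 1) ^ (3 * d + k) * (D ^ 2) ^ (3 * d + k) := mul_pow _ _ _
      _ ≤ _ := by
          gcongr
          linarith

lemma Res.symm {Φ : (Fin d → ℝ) → Fin k → ℝ} {r Λ : ℝ} {n₁ n₁' n₂ n₂' : Fin d → ℤ}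
    (h : Res Φ r Λ n₁ n₁' n₂ n₂') : Res Φ r Λ n₁' n₁ n₂' n₂ := by
  have key : ∀ {E : Type} [NormedAddCommGroup E] (x x' y y' : E),
      ‖x' - x + (y' - y)‖ = ‖x - x' + (y - y')‖ := by
    intro E _ x x' y y'
    rw [← norm_neg]
    congr 1
    abel
  exact ⟨(key _ _ _ _).trans_le h.1, (key _ _ _ _).trans_le h.2⟩

open scoped Classical in
/-- The square function estimate for the nonlocal interaction. -/
lemma exists_far_sq_le {Φ : (Fin d → ℝ) → Fin k → ℝ} (hΦ : ContDiff ℝ (⊤ : ℕ∞) Φ)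
    (B κ : ℝ) (hB : 0 ≤ B) (hκ : 0 < κ) :
    ∃ C : ℝ, 1 ≤ C ∧ ∀ a₀ b₀ : Fin d → ℝ, ∀ ρ : ℝ, Transversal Φ κ ρ a₀ b₀ →
      ‖a₀‖ + ρ ≤ B → ‖b₀‖ + ρ ≤ B → ∀ (r D : ℝ) (K : ℕ), 1 ≤ D → C * D ^ 2 ≤ r → r ≤ K * D →
      ∀ 𝒯₁ 𝒯₂ : Finset ((Fin d → ℤ) × (Fin d → ℤ)),
      (∀ T ∈ 𝒯₁, ‖frq r T.1 - a₀‖ ≤ ρ) → (∀ T ∈ 𝒯₂, ‖frq r T.1 - b₀‖ ≤ ρ) →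
      ∀ Q : Finset ((Fin d → ℤ) × (Fin k → ℤ)), (∀ q ∈ Q, ‖(ctr r q).2‖ ≤ r ^ 2) →
      ∀ b : (Fin d → ℤ) × (Fin d → ℤ) → ℂ,
      ∃ bs : (Fin d → ℤ) × (Fin d → ℤ) → (Fin d → ℤ) × (Fin k → ℤ),
      ∀ (β : (Fin d → ℤ) × (Fin k → ℤ)) (c b' : (Fin d → ℤ) × (Fin d → ℤ) → ℂ),
      (∀ T, ‖b' T‖ ≤ ‖b T‖) →
      ∑ q ∈ Q with blk K q = β, ∫ w in cubeQ d k r (ctr r q),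
        ‖syn Φ r (𝒯₁.filter fun T => Inc Φ r D T q ∧ ¬ Near β (bs T)) c w *
          syn Φ r (𝒯₂.filter fun T => Inc Φ r D T q) b' w‖ ^ 2 ≤
        C * D ^ (2 * d + 2 * (3 * d + k)) * (r ^ k * (r ^ d)⁻¹) *
          (∑ T ∈ 𝒯₁, ‖c T‖ ^ 2) * ∑ T ∈ 𝒯₂, ‖b T‖ ^ 2 := by
  obtain ⟨Λ, hΛ, C₀, hC₀, hinteg⟩ := exists_setIntegral_le hΦ B
  obtain ⟨C₁, hC₁, hres⟩ := exists_card_resonant_le hΦ B Λ hΛ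
  obtain ⟨C₂, hC₂, hfar⟩ := exists_card_far_le hΦ B Λ κ hB hΛ hκ
  have hCC : 0 ≤ C₀ * (C₁ * (C₂ + 1)) := by positivity
  refine ⟨C₂ + C₀ * (C₁ * (C₂ + 1)), by linarith, ?_⟩
  intro a₀ b₀ ρ htr ha hb r D K hD hr hK 𝒯₁ 𝒯₂ h𝒯₁ h𝒯₂ Q hQ b
  have hbd : ∀ {c v : Fin d → ℝ}, ‖c‖ + ρ ≤ B → ‖v - c‖ ≤ ρ → ‖v‖ ≤ B := by
    intro c v h1 h2
    have := norm_add_le (v - c) c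
    rw [sub_add_cancel] at this
    linarith
  have hr' : C₂ * D ^ 2 ≤ r := le_trans (by gcongr; linarith) hr
  have hr1 : 1 ≤ r := by nlinarith
  have hr0 : 0 < r := by linarith
  have B₁ : ∀ T ∈ 𝒯₁, ‖frq r T.1‖ ≤ B := fun T hT => hbd ha (h𝒯₁ T hT)
  have B₂ : ∀ T ∈ 𝒯₂, ‖frq r T.1‖ ≤ B := fun T hT => hbd hb (h𝒯₂ T hT)
  obtain ⟨bs, hbs⟩ := exists_assignment (β := (Fin d → ℤ) × (Fin k → ℤ)) 𝒯₁ 𝒯₂ Q (Inc Φ r D) (Inc Φ r D) (blk K)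
    (fun β β' => ¬ Near β β') (res := fun T₁ T₁' T₂ T₂' => Res Φ r Λ T₁.1 T₁'.1 T₂.1 T₂'.1)
    (fun _ _ _ _ h => h.symm) (C₁ := C₁ * D ^ (2 * d)) (C₂ := C₂ * D ^ (2 * (3 * d + k)))
    (by positivity) (by positivity)
    (fun q hq T₁ hT₁ T₁' hT₁' T₂' hT₂' _ _ _ =>
      hres r D hr0 hD 𝒯₂ B₂ q (hQ q hq) T₁.1 T₁'.1 T₂'.1)
    (fun q hq T₁ hT₁ T₂' hT₂' S hS _ _ => by
      convert hfar a₀ b₀ ρ htr ha hb r D K hD hr' hK 𝒯₁ 𝒯₂ h𝒯₁ h𝒯₂ Q hQ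
        q hq T₁ hT₁ T₂' hT₂' S hS) (fun T => ‖b T‖)
  refine ⟨bs, fun β c b' hb' => ?_⟩
  have key := hbs β (fun T => ‖c T‖) (fun T => ‖b' T‖) (fun T => by simpa using hb' T)
  have hX : 0 ≤ (∑ T ∈ 𝒯₁, ‖c T‖ ^ 2) * ∑ T ∈ 𝒯₂, ‖b T‖ ^ 2 := by positivity
  have hpow : C₁ * D ^ (2 * d) * (C₂ * D ^ (2 * (3 * d + k)) + 1) ≤
      C₁ * (C₂ + 1) * D ^ (2 * d + 2 * (3 * d + k)) := by
    have : (1 : ℝ) ≤ D ^ (2 * (3 * d + k)) := one_le_pow₀ hD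
    calc _ ≤ C₁ * D ^ (2 * d) * (C₂ * D ^ (2 * (3 * d + k)) + D ^ (2 * (3 * d + k))) := by gcongr
      _ = _ := by
        ring
  calc _ ≤ ∑ q ∈ Q with blk K q = β, C₀ * (r ^ k * (r ^ d)⁻¹) * _ := by
        refine Finset.sum_le_sum fun q hq => ?_
        exact hinteg r hr1 _ _ _ _ (fun T hT => B₁ T (Finset.mem_filter.1 hT).1)
          (fun T hT => B₂ T (Finset.mem_filter.1 hT).1) _
    _ = C₀ * (r ^ k * (r ^ d)⁻¹) * ∑ q ∈ Q with blk K q = β, _ := by rw [Finset.mul_sum]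
    _ ≤ C₀ * (r ^ k * (r ^ d)⁻¹) * (C₁ * D ^ (2 * d) * (C₂ * D ^ (2 * (3 * d + k)) + 1) *
          (∑ T ∈ 𝒯₁, ‖c T‖ ^ 2) * ∑ T ∈ 𝒯₂, ‖b T‖ ^ 2) := by
        refine mul_le_mul_of_nonneg_left ?_ (by positivity)
        refine le_of_eq_of_le ?_ key
        congr!
    _ = C₀ * (r ^ k * (r ^ d)⁻¹) * ((∑ T ∈ 𝒯₁, ‖c T‖ ^ 2) * ∑ T ∈ 𝒯₂, ‖b T‖ ^ 2) *
        (C₁ * D ^ (2 * d) * (C₂ * D ^ (2 * (3 * d + k)) + 1)) := by ring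
    _ ≤ C₀ * (r ^ k * (r ^ d)⁻¹) * ((∑ T ∈ 𝒯₁, ‖c T‖ ^ 2) * ∑ T ∈ 𝒯₂, ‖b T‖ ^ 2) *
        (C₁ * (C₂ + 1) * D ^ (2 * d + 2 * (3 * d + k))) := by gcongr
    _ = C₀ * (C₁ * (C₂ + 1)) * D ^ (2 * d + 2 * (3 * d + k)) * (r ^ k * (r ^ d)⁻¹) *
        ((∑ T ∈ 𝒯₁, ‖c T‖ ^ 2) * ∑ T ∈ 𝒯₂, ‖b T‖ ^ 2) := by ring
    _ ≤ (C₂ + C₀ * (C₁ * (C₂ + 1))) * D ^ (2 * d + 2 * (3 * d + k)) * (r ^ k * (r ^ d)⁻¹) *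
        ((∑ T ∈ 𝒯₁, ‖c T‖ ^ 2) * ∑ T ∈ 𝒯₂, ‖b T‖ ^ 2) := by
        gcongr
        linarith
    _ = _ := by ring

/-- The half-open unit cube centred at the origin. -/
def unitBox (d : ℕ) : Set (Fin d → ℝ) := Set.univ.pi fun _ => Set.Ioc (-(1 / 2)) (1 / 2)

lemma integral_Ioc_ex (n : ℤ) :
    ∫ s in Set.Ioc (-(1 / 2) : ℝ) (1 / 2), ex (n * s) = if n = 0 then 1 else 0 := by
  rw [← intervalIntegral.integral_of_le (by norm_num)]
  split_ifs with h
  · simp only [h, Int.cast_zero, zero_mul, ex_zero, intervalIntegral.integral_const, sub_neg_eq_add]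
    norm_num
  · have hc : (2 * Real.pi * Complex.I * n : ℂ) ≠ 0 := by
      simp [Real.pi_ne_zero, Complex.I_ne_zero, h]
    have h1 : ∀ s : ℝ, ex (n * s) = Complex.exp (2 * Real.pi * Complex.I * n * s) := by
      intro s
      unfold ex
      congr 1
      push_cast
      ring
    simp only [h1]
    rw [integral_exp_mul_complex hc]
    have h2 : Complex.exp (2 * Real.pi * Complex.I * n * ((1 / 2 : ℝ) : ℂ)) =
        Complex.exp (2 * Real.pi * Complex.I * n * ((-(1 / 2) : ℝ) : ℂ)) := by
      rw [Complex.exp_eq_exp_iff_exists_int]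
      refine ⟨n, ?_⟩
      push_cast
      ring
    rw [h2, sub_self, zero_div]

lemma integral_unitBox_ex (n : Fin d → ℤ) :
    ∫ v in unitBox d, ex (rl n ⬝ᵥ v) = if n = 0 then 1 else 0 := by
  have h1 : ∀ v : Fin d → ℝ, ex (rl n ⬝ᵥ v) = ∏ i, ex (n i * v i) := fun v => ex_sum _ _
  simp only [h1]
  unfold unitBox
  rw [volume_pi, Measure.restrict_pi_pi, integral_fintype_prod_eq_prod (fun i s => ex (n i * s))]
  simp only [integral_Ioc_ex]
  rw [Finset.prod_ite_zero, Finset.prod_const_one]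
  congr 1
  simp [funext_iff]

lemma volume_unitBox : volume (unitBox d) = 1 := by
  unfold unitBox
  rw [Real.volume_pi_Ioc]
  norm_num

lemma integrableOn_unitBox {f : (Fin d → ℝ) → ℂ} (hf : Continuous f) :
    IntegrableOn f (unitBox d) := by
  refine (hf.continuousOn.integrableOn_compact (isCompact_Icc (a := fun _ => -(1 / 2))
    (b := fun _ => 1 / 2))).mono_set ?_
  intro v hv
  simp only [unitBox, Set.mem_univ_pi, Set.mem_Ioc] at hv
  exact ⟨fun i => (hv i).1.le, fun i => (hv i).2⟩

lemma continuous_ex_rl (n : Fin d → ℤ) : Continuous fun v : Fin d → ℝ => ex (rl n ⬝ᵥ v) :=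
  continuous_ex.comp (by unfold dotProduct; fun_prop)

lemma integrableOn_unitBox_ex (z : ℂ) (n : Fin d → ℤ) :
    IntegrableOn (fun v : Fin d → ℝ => z * ex (rl n ⬝ᵥ v)) (unitBox d) :=
  integrableOn_unitBox (continuous_const.mul (continuous_ex_rl n))

/-- Parseval's identity for trigonometric polynomials. -/
lemma integral_unitBox_norm_sq {α : Type*} (s : Finset α) {e : α → Fin d → ℤ}
    (he : Set.InjOn e s) (c : α → ℂ) :
    ∫ v in unitBox d, ‖∑ a ∈ s, c a * ex (rl (e a) ⬝ᵥ v)‖ ^ 2 = ∑ a ∈ s, ‖c a‖ ^ 2 := by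
  apply Complex.ofRealLI.injective
  rw [← LinearIsometry.integral_comp_comm]
  have h1 : ∀ v : Fin d → ℝ, Complex.ofRealLI (‖∑ a ∈ s, c a * ex (rl (e a) ⬝ᵥ v)‖ ^ 2) =
      ∑ a ∈ s, ∑ a' ∈ s, c a * (starRingEnd ℂ) (c a') * ex (rl (e a - e a') ⬝ᵥ v) := by
    intro v
    change ((‖∑ a ∈ s, c a * ex (rl (e a) ⬝ᵥ v)‖ ^ 2 : ℝ) : ℂ) = _
    rw [Complex.ofReal_pow, ← Complex.mul_conj', map_sum, Finset.sum_mul_sum]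
    refine Finset.sum_congr rfl fun a _ => Finset.sum_congr rfl fun a' _ => ?_
    have : rl (e a - e a') ⬝ᵥ v = rl (e a) ⬝ᵥ v - rl (e a') ⬝ᵥ v := by
      rw [← sub_dotProduct]
      congr 1
      ext i
      simp [rl]
    rw [this, ex_sub, map_mul]
    ring
  simp only [h1]
  rw [integral_finsetSum _ fun a _ => integrable_finsetSum _ fun a' _ =>
    integrableOn_unitBox_ex _ _]
  change _ = ((∑ a ∈ s, ‖c a‖ ^ 2 : ℝ) : ℂ)
  push_cast
  refine Finset.sum_congr rfl fun a ha => ?_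
  rw [integral_finsetSum _ fun a' _ =>
    integrableOn_unitBox_ex _ _, Finset.sum_eq_single a]
  · rw [integral_const_mul, integral_unitBox_ex, if_pos (sub_self _), mul_one, Complex.mul_conj']
  · intro a' ha' hne
    rw [integral_const_mul, integral_unitBox_ex, if_neg, mul_zero]
    intro h
    exact hne (he ha' ha (sub_eq_zero.1 h).symm)
  · exact fun h => absurd ha h

/-- A finite superposition of wave packets. -/
def synf (r : ℝ) (𝒯 : Finset ((Fin d → ℤ) × (Fin d → ℤ))) (c : (Fin d → ℤ) × (Fin d → ℤ) → ℂ)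
    (ξ : Fin d → ℝ) : ℂ := ∑ T ∈ 𝒯, c T * pk r T ξ

lemma integrable_synf {r : ℝ} (hr : 0 < r) (𝒯 : Finset ((Fin d → ℤ) × (Fin d → ℤ)))
    (c : (Fin d → ℤ) × (Fin d → ℤ) → ℂ) : Integrable (synf r 𝒯 c) :=
  integrable_finsetSum _ fun T _ => (integrable_pk hr T).const_mul _

lemma contDiff_synf (r : ℝ) (𝒯 : Finset ((Fin d → ℤ) × (Fin d → ℤ)))
    (c : (Fin d → ℤ) × (Fin d → ℤ) → ℂ) : ContDiff ℝ (⊤ : ℕ∞) (synf r 𝒯 c) :=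
  ContDiff.sum fun T _ => contDiff_const.mul (contDiff_pk r T)

lemma hasCompactSupport_synf {r : ℝ} (hr : 0 < r) (𝒯 : Finset ((Fin d → ℤ) × (Fin d → ℤ)))
    (c : (Fin d → ℤ) × (Fin d → ℤ) → ℂ) : HasCompactSupport (synf r 𝒯 c) := by
  classical
  unfold synf
  induction 𝒯 using Finset.induction_on with
  | empty =>
    simp only [Finset.sum_empty]
    exact HasCompactSupport.zero
  | insert T s hT ih =>
    simp only [Finset.sum_insert hT]
    exact ((hasCompactSupport_pk hr T).mul_left).add ih

lemma continuous_phase {Φ : (Fin d → ℝ) → Fin k → ℝ} (hΦ : Continuous Φ)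
    (w : (Fin d → ℝ) × (Fin k → ℝ)) : Continuous (phase Φ w) := by
  unfold phase dotProduct
  fun_prop

lemma integrable_ex_phase_mul {Φ : (Fin d → ℝ) → Fin k → ℝ} (hΦ : Continuous Φ)
    (w : (Fin d → ℝ) × (Fin k → ℝ)) {f : (Fin d → ℝ) → ℂ} (hf : Integrable f) :
    Integrable fun ξ => ex (phase Φ w ξ) * f ξ :=
  hf.bdd_mul (c := 1) (continuous_ex.comp (continuous_phase hΦ w)).aestronglyMeasurable
    (Filter.Eventually.of_forall fun _ => (norm_ex _).le)

lemma extn_synf {Φ : (Fin d → ℝ) → Fin k → ℝ} (hΦ : Continuous Φ) {r : ℝ} (hr : 0 < r)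
    (𝒯 : Finset ((Fin d → ℤ) × (Fin d → ℤ))) (c : (Fin d → ℤ) × (Fin d → ℤ) → ℂ)
    (w : (Fin d → ℝ) × (Fin k → ℝ)) : extn Φ (synf r 𝒯 c) w = syn Φ r 𝒯 c w := by
  unfold extn synf syn
  simp only [Finset.mul_sum]
  rw [integral_finsetSum _ fun T _ =>
    integrable_ex_phase_mul hΦ w ((integrable_pk hr T).const_mul _)]
  refine Finset.sum_congr rfl fun T _ => ?_
  rw [extn, ← integral_const_mul]
  congr 1
  funext ξ
  ring

lemma integrable_norm_sq_synf {r : ℝ} (hr : 0 < r) (𝒯 : Finset ((Fin d → ℤ) × (Fin d → ℤ)))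
    (c : (Fin d → ℤ) × (Fin d → ℤ) → ℂ) : Integrable fun ξ => ‖synf r 𝒯 c ξ‖ ^ 2 := by
  refine ((contDiff_synf r 𝒯 c).continuous.norm.pow 2).integrable_of_hasCompactSupport ?_
  refine (hasCompactSupport_synf hr 𝒯 c).mono fun ξ hξ => ?_
  rw [Function.mem_support] at hξ ⊢
  exact fun h => hξ (by simp [h])

/-- The synthesis operator of the wave packet system is bounded. -/
lemma integral_norm_sq_synf_le {r : ℝ} (hr : 0 < r) (𝒯 : Finset ((Fin d → ℤ) × (Fin d → ℤ)))
    (c : (Fin d → ℤ) × (Fin d → ℤ) → ℂ) :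
    ∫ ξ, ‖synf r 𝒯 c ξ‖ ^ 2 ≤ 3 ^ d * ∑ T ∈ 𝒯, ‖c T‖ ^ 2 := by
  classical
  set N := 𝒯.image Prod.fst with hN
  set g : (Fin d → ℤ) → (Fin d → ℝ) → ℂ := fun n => synf r (𝒯.filter fun T => T.1 = n) c with hg
  have hsum : ∀ ξ, synf r 𝒯 c ξ = ∑ n ∈ N, g n ξ := by
    intro ξ
    exact (Finset.sum_fiberwise_of_maps_to (fun T hT => Finset.mem_image_of_mem _ hT) _).symm
  have hpt : ∀ ξ, ‖synf r 𝒯 c ξ‖ ^ 2 ≤ 3 ^ d * ∑ n ∈ N, ‖g n ξ‖ ^ 2 := by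
    intro ξ
    set N' := N.filter fun n => r * ‖ξ - frq r n‖ < 1 / 2 with hN'
    have h1 : ∑ n ∈ N, g n ξ = ∑ n ∈ N', g n ξ := by
      rw [hN', Finset.sum_filter_of_ne]
      intro n _ hne
      by_contra h
      refine hne (Finset.sum_eq_zero fun T hT => ?_)
      rw [pk_eq_zero hr, mul_zero]
      rw [(Finset.mem_filter.1 hT).2]
      exact not_lt.1 h
    have hcard : (N'.card : ℝ) ≤ 3 ^ d := by
      refine (card_lattice_le N' ((2 * r) • ξ) (M := 1) (by norm_num) fun n hn => ?_).trans ?_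
      · have h2 := (Finset.mem_filter.1 hn).2
        have h3 : rl n - (2 * r) • ξ = -((2 * r) • (ξ - frq r n)) := by
          unfold frq
          rw [smul_sub, smul_smul, mul_inv_cancel₀ (by positivity), one_smul]
          abel
        rw [h3, norm_neg, norm_smul, Real.norm_of_nonneg (by positivity)]
        linarith
      · norm_num
    rw [hsum, h1]
    calc ‖∑ n ∈ N', g n ξ‖ ^ 2 ≤ (∑ n ∈ N', ‖g n ξ‖) ^ 2 := by
          gcongr
          exact norm_sum_le _ _
      _ ≤ N'.card * ∑ n ∈ N', ‖g n ξ‖ ^ 2 := sq_sum_le_card_mul_sum_sq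
      _ ≤ 3 ^ d * ∑ n ∈ N, ‖g n ξ‖ ^ 2 := by
          gcongr
          exact Finset.filter_subset _ _
  have hinteg : ∀ 𝒮 : Finset ((Fin d → ℤ) × (Fin d → ℤ)), Integrable fun ξ => ‖synf r 𝒮 c ξ‖ ^ 2 :=
    fun 𝒮 => integrable_norm_sq_synf hr 𝒮 c
  have hgn : ∀ n, ∫ ξ, ‖g n ξ‖ ^ 2 ≤ ∑ T ∈ 𝒯 with T.1 = n, ‖c T‖ ^ 2 := by
    intro n
    set 𝒮 := 𝒯.filter fun T => T.1 = n with h𝒮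
    have hinj : Set.InjOn (fun T : (Fin d → ℤ) × (Fin d → ℤ) => -T.2) 𝒮 := by
      intro T hT T' hT' h
      have h1 := (Finset.mem_filter.1 hT).2
      have h2 := (Finset.mem_filter.1 hT').2
      exact Prod.ext (h1.trans h2.symm) (neg_injective h)
    rw [← integral_unitBox_norm_sq 𝒮 hinj c]
    set P : (Fin d → ℝ) → ℂ := fun v => ∑ T ∈ 𝒮, c T * ex (rl (-T.2) ⬝ᵥ v) with hP
    have hPc : Continuous P := by
      simp only [hP]
      exact continuous_finsetSum _ fun T _ => continuous_const.mul (continuous_ex_rl _)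
    have hPi : IntegrableOn (fun v => ‖P v‖ ^ 2) (unitBox d) := by
      have := integrableOn_unitBox (Complex.continuous_ofReal.comp (hPc.norm.pow 2))
      exact this.norm.congr (Filter.Eventually.of_forall fun v => by simp)
    have hgv : ∀ v, ‖g n (frq r n + r⁻¹ • v)‖ ^ 2 = r ^ d * ((bump d v) ^ 2 * ‖P v‖ ^ 2) := by
      intro v
      have : g n (frq r n + r⁻¹ • v) = (√(r ^ d) * bump d v : ℝ) * P v := by
        simp only [hg, hP, synf, Finset.mul_sum]
        refine Finset.sum_congr rfl fun T hT => ?_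
        have h1 := (Finset.mem_filter.1 hT).2
        have h2 : rl (-T.2) ⬝ᵥ v = -(rl T.2 ⬝ᵥ v) := by
          rw [← neg_dotProduct]
          congr 1
          ext i
          simp [rl]
        rw [pk, h1, scl_frq_add hr.ne', h2]
        ring
      rw [this, norm_mul, Complex.norm_real, norm_mul, Real.norm_of_nonneg (Real.sqrt_nonneg _), mul_pow,
        mul_pow, Real.sq_sqrt (by positivity), Real.norm_eq_abs, sq_abs]
      ring
    have hresc : ∫ ξ, ‖g n ξ‖ ^ 2 = ∫ v, (bump d v) ^ 2 * ‖P v‖ ^ 2 := by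
      have h1 := integral_rescale hr (frq r n) fun ξ => ((‖g n ξ‖ ^ 2 : ℝ) : ℂ)
      simp only [hgv] at h1
      rw [integral_complex_ofReal, integral_complex_ofReal, integral_const_mul] at h1
      have h2 : (r ^ d)⁻¹ • ((r ^ d * ∫ v, (bump d v) ^ 2 * ‖P v‖ ^ 2 : ℝ) : ℂ) =
          ((∫ v, (bump d v) ^ 2 * ‖P v‖ ^ 2 : ℝ) : ℂ) := by
        rw [Complex.real_smul, ← Complex.ofReal_mul, inv_mul_cancel_left₀ (by positivity)]
      rw [h2] at h1
      exact_mod_cast h1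
    rw [hresc, ← integral_indicator (by
      unfold unitBox
      exact MeasurableSet.univ_pi fun _ => measurableSet_Ioc)]
    refine integral_mono_of_nonneg (Filter.Eventually.of_forall fun v => by positivity)
      ((integrable_indicator_iff (by
      unfold unitBox
      exact MeasurableSet.univ_pi fun _ => measurableSet_Ioc)).2 hPi)
      (Filter.Eventually.of_forall fun v => ?_)
    by_cases hv : ‖v‖ < 1 / 2
    · rw [Set.indicator_of_mem]
      · have h1 : (bump d v : ℝ) ≤ 1 := (bump d).le_one
        have h0 : (0 : ℝ) ≤ bump d v := (bump d).nonneg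
        have : (bump d v : ℝ) ^ 2 ≤ 1 := pow_le_one₀ h0 h1
        change (bump d v : ℝ) ^ 2 * ‖P v‖ ^ 2 ≤ ‖P v‖ ^ 2
        nlinarith [sq_nonneg ‖P v‖]
      · rw [pi_norm_lt_iff (by norm_num)] at hv
        intro i _
        have := abs_lt.1 (hv i)
        exact ⟨this.1, this.2.le⟩
    · simp only [bump_eq_zero (not_lt.1 hv), ne_eq, OfNat.ofNat_ne_zero, not_false_eq_true, zero_pow, zero_mul]
      exact Set.indicator_nonneg (fun _ _ => by positivity) _
  calc ∫ ξ, ‖synf r 𝒯 c ξ‖ ^ 2 ≤ ∫ ξ, 3 ^ d * ∑ n ∈ N, ‖g n ξ‖ ^ 2 :=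
        integral_mono (hinteg 𝒯) ((integrable_finsetSum _ fun n _ => hinteg _).const_mul _) hpt
    _ = 3 ^ d * ∑ n ∈ N, ∫ ξ, ‖g n ξ‖ ^ 2 := by
        rw [integral_const_mul, integral_finsetSum _ fun n _ => hinteg _]
    _ ≤ 3 ^ d * ∑ n ∈ N, ∑ T ∈ 𝒯 with T.1 = n, ‖c T‖ ^ 2 := by
        gcongr with n _
        exact hgn n
    _ = _ := by
        rw [Finset.sum_fiberwise_of_maps_to fun T hT => Finset.mem_image_of_mem _ hT]

open FourierTransform in
/-- Plancherel's theorem for smooth compactly supported functions. -/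
lemma plancherel {h : (Fin d → ℝ) → ℂ} (hs : HasCompactSupport h) (hc : ContDiff ℝ (⊤ : ℕ∞) h) :
    Integrable (fun x : Fin d → ℝ => ‖∫ ξ, ex (x ⬝ᵥ ξ) * h ξ‖ ^ 2) ∧
      ∫ x : Fin d → ℝ, ‖∫ ξ, ex (x ⬝ᵥ ξ) * h ξ‖ ^ 2 = ∫ ξ, ‖h ξ‖ ^ 2 := by
  set e := EuclideanSpace.equiv (Fin d) ℝ with he
  have hs' : HasCompactSupport (h ∘ e) := hs.comp_homeomorph e.toHomeomorph
  have hc' : ContDiff ℝ (⊤ : ℕ∞) (h ∘ e) := hc.comp e.contDiff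
  set H := hs'.toSchwartzMap hc' with hH
  have hmp := EuclideanSpace.volume_preserving_symm_measurableEquiv_toLp (Fin d)
  have hemb := (MeasurableEquiv.toLp 2 (Fin d → ℝ)).symm.measurableEmbedding
  have hF : ∀ y : EuclideanSpace ℝ (Fin d),
      ‖∫ ξ, ex (((MeasurableEquiv.toLp 2 (Fin d → ℝ)).symm y) ⬝ᵥ ξ) * h ξ‖ ^ 2 =
        ‖𝓕 H (-y)‖ ^ 2 := by
    intro y
    rw [← hmp.integral_comp hemb, SchwartzMap.fourier_coe, Real.fourier_eq]
    congr 2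
    refine integral_congr_ae (Filter.Eventually.of_forall fun v => ?_)
    simp only [inner_neg_right, neg_neg, Circle.smul_def, ← ex_eq_fourierChar, smul_eq_mul]
    rfl
  have hinteg : Integrable fun y : EuclideanSpace ℝ (Fin d) => ‖𝓕 H y‖ ^ 2 := by
    have := (SchwartzMap.memLp (𝓕 H) 2 volume).integrable_norm_pow (by norm_num)
    simpa using this
  constructor
  · rw [← hmp.integrable_comp_emb hemb]
    refine (Integrable.comp_neg hinteg).congr (Filter.Eventually.of_forall fun y => ?_)
    exact (hF y).symm
  · rw [← hmp.integral_comp hemb]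
    simp only [hF]
    rw [integral_neg_eq_self (fun y => ‖𝓕 H y‖ ^ 2), SchwartzMap.integral_norm_sq_fourier,
      ← hmp.integral_comp hemb]
    rfl

lemma extn_eq (Φ : (Fin d → ℝ) → Fin k → ℝ) (f : (Fin d → ℝ) → ℂ) (x : Fin d → ℝ) (t : Fin k → ℝ) :
    extn Φ f (x, t) = ∫ ξ, ex (x ⬝ᵥ ξ) * (ex (t ⬝ᵥ Φ ξ) * f ξ) := by
  unfold extn phase
  simp only [ex_add, mul_assoc]

/-- Conservation of mass. -/
lemma integral_norm_sq_extn {Φ : (Fin d → ℝ) → Fin k → ℝ} (hΦ : ContDiff ℝ (⊤ : ℕ∞) Φ)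
    {f : (Fin d → ℝ) → ℂ} (hs : HasCompactSupport f) (hc : ContDiff ℝ (⊤ : ℕ∞) f) (t : Fin k → ℝ) :
    Integrable (fun x => ‖extn Φ f (x, t)‖ ^ 2) ∧
      ∫ x, ‖extn Φ f (x, t)‖ ^ 2 = ∫ ξ, ‖f ξ‖ ^ 2 := by
  have h1 : ContDiff ℝ (⊤ : ℕ∞) fun ξ => t ⬝ᵥ Φ ξ := (dotL t).contDiff.comp hΦ
  have h := plancherel (h := fun ξ => ex (t ⬝ᵥ Φ ξ) * f ξ) hs.mul_left
    ((contDiff_ex.comp h1).mul hc)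
  simp only [extn_eq]
  refine ⟨h.1, h.2.trans ?_⟩
  simp only [norm_mul, norm_ex, one_mul]

lemma cubeQ_eq_prod (R : ℝ) (c : (Fin d → ℝ) × (Fin k → ℝ)) :
    cubeQ d k R c = {x | ∀ i, |x i - c.1 i| ≤ R / 2} ×ˢ {t | ∀ j, |t j - c.2 j| ≤ R / 2} := rfl

lemma box_eq_pi {ι : Type*} (R : ℝ) (z : ι → ℝ) : {x : ι → ℝ | ∀ i, |x i - z i| ≤ R / 2} =
    Set.univ.pi fun i => Set.Icc (z i - R / 2) (z i + R / 2) := by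
  ext x
  simp only [Set.mem_ofPred_eq, Set.mem_univ_pi, Set.mem_Icc, abs_le]
  refine forall_congr' fun i => ⟨fun h => ⟨by linarith [h.1], by linarith [h.2]⟩,
    fun h => ⟨by linarith [h.1], by linarith [h.2]⟩⟩

lemma isCompact_box {ι : Type*} [Finite ι] (R : ℝ) (z : ι → ℝ) :
    IsCompact {x : ι → ℝ | ∀ i, |x i - z i| ≤ R / 2} := by
  rw [box_eq_pi]
  exact isCompact_univ_pi fun _ => isCompact_Icc

lemma isCompact_cubeQ (R : ℝ) (c : (Fin d → ℝ) × (Fin k → ℝ)) : IsCompact (cubeQ d k R c) := by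
  rw [cubeQ_eq_prod]
  exact (isCompact_box _ _).prod (isCompact_box _ _)

lemma volume_box {ι : Type*} [Fintype ι] {R : ℝ} (hR : 0 ≤ R) (z : ι → ℝ) :
    volume {x : ι → ℝ | ∀ i, |x i - z i| ≤ R / 2} = ENNReal.ofReal (R ^ Fintype.card ι) := by
  rw [box_eq_pi, volume_pi_pi]
  simp [Real.volume_Icc, ENNReal.ofReal_pow hR]

lemma volume_cubeQ {R : ℝ} (hR : 0 ≤ R) (c : (Fin d → ℝ) × (Fin k → ℝ)) :
    volume (cubeQ d k R c) = ENNReal.ofReal (R ^ (d + k)) := by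
  rw [cubeQ_eq_prod, Measure.volume_eq_prod, Measure.prod_prod, volume_box hR, volume_box hR,
    ← ENNReal.ofReal_mul (by positivity), Fintype.card_fin, Fintype.card_fin, pow_add]

lemma setIntegral_norm_sq_extn_le {Φ : (Fin d → ℝ) → Fin k → ℝ} (hΦ : ContDiff ℝ (⊤ : ℕ∞) Φ)
    {f : (Fin d → ℝ) → ℂ} (hs : HasCompactSupport f) (hc : ContDiff ℝ (⊤ : ℕ∞) f) {R : ℝ} (hR : 0 ≤ R)
    (c : (Fin d → ℝ) × (Fin k → ℝ)) :
    ∫ w in cubeQ d k R c, ‖extn Φ f w‖ ^ 2 ≤ R ^ k * ∫ ξ, ‖f ξ‖ ^ 2 := by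
  have hcont : Continuous fun w => ‖extn Φ f w‖ ^ 2 :=
    (continuous_extn hΦ.continuous (hc.continuous.integrable_of_hasCompactSupport hs)).norm.pow 2
  have hi : IntegrableOn (fun w => ‖extn Φ f w‖ ^ 2) (cubeQ d k R c) :=
    hcont.continuousOn.integrableOn_compact (isCompact_cubeQ R c)
  set X := {x : Fin d → ℝ | ∀ i, |x i - c.1 i| ≤ R / 2} with hX
  set Y := {t : Fin k → ℝ | ∀ j, |t j - c.2 j| ≤ R / 2} with hY
  have hvol : volume Y = ENNReal.ofReal (R ^ k) := by
    rw [hY, volume_box hR, Fintype.card_fin]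
  unfold IntegrableOn at hi
  rw [cubeQ_eq_prod, ← hX, ← hY, Measure.volume_eq_prod, ← Measure.prod_restrict] at hi ⊢
  rw [integral_prod_symm _ hi]
  calc ∫ t in Y, ∫ x in X, ‖extn Φ f (x, t)‖ ^ 2 ≤ ∫ _ in Y, ∫ ξ, ‖f ξ‖ ^ 2 := by
        refine integral_mono hi.integral_prod_right ?_ fun t => ?_
        · exact integrableOn_const (by rw [hvol]; exact ENNReal.ofReal_ne_top)
        · dsimp only
          rw [← (integral_norm_sq_extn hΦ hs hc t).2]
          exact setIntegral_le_integral (integral_norm_sq_extn hΦ hs hc t).1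
            (Filter.Eventually.of_forall fun x => by positivity)
    _ = R ^ k * ∫ ξ, ‖f ξ‖ ^ 2 := by
        rw [setIntegral_const, Measure.real, hvol, ENNReal.toReal_ofReal (by positivity), smul_eq_mul]

lemma setIntegral_norm_sq_syn_le {Φ : (Fin d → ℝ) → Fin k → ℝ} (hΦ : ContDiff ℝ (⊤ : ℕ∞) Φ)
    {r : ℝ} (hr : 0 < r) (𝒯 : Finset ((Fin d → ℤ) × (Fin d → ℤ))) (b : (Fin d → ℤ) × (Fin d → ℤ) → ℂ)
    {R : ℝ} (hR : 0 ≤ R) (c : (Fin d → ℝ) × (Fin k → ℝ)) :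
    ∫ w in cubeQ d k R c, ‖syn Φ r 𝒯 b w‖ ^ 2 ≤ R ^ k * (3 ^ d * ∑ T ∈ 𝒯, ‖b T‖ ^ 2) := by
  simp only [← extn_synf hΦ.continuous hr]
  refine (setIntegral_norm_sq_extn_le hΦ (hasCompactSupport_synf hr 𝒯 b) (contDiff_synf r 𝒯 b)
    hR c).trans ?_
  gcongr
  exact integral_norm_sq_synf_le hr 𝒯 b

lemma exists_norm_syn_sq_le {Φ : (Fin d → ℝ) → Fin k → ℝ} (hΦ : ContDiff ℝ (⊤ : ℕ∞) Φ) (B : ℝ)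
    (N : ℕ) : ∃ C : ℝ, 0 ≤ C ∧ ∀ r : ℝ, 1 ≤ r → ∀ 𝒯 : Finset ((Fin d → ℤ) × (Fin d → ℤ)),
      (∀ T ∈ 𝒯, ‖frq r T.1‖ ≤ B) → ∀ w : (Fin d → ℝ) × (Fin k → ℝ), ‖w.2‖ ≤ r ^ 2 →
      ∀ L : ℝ, 1 ≤ L → (∀ T ∈ 𝒯, L ≤ 1 + ‖r⁻¹ • (w.1 + tg Φ w.2 (frq r T.1)) - rl T.2‖) →
      ∀ c : (Fin d → ℤ) × (Fin d → ℤ) → ℂ,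
        ‖syn Φ r 𝒯 c w‖ ^ 2 ≤ C * (L ^ N)⁻¹ * ∑ T ∈ 𝒯, ‖c T‖ ^ 2 := by
  obtain ⟨C, hC, h⟩ := exists_sum_extn_pk_le hΦ B N
  refine ⟨C, hC, fun r hr 𝒯 h𝒯 w hw L hL hfar c => ?_⟩
  calc ‖syn Φ r 𝒯 c w‖ ^ 2 ≤ (∑ T ∈ 𝒯, ‖c T‖ * ‖extn Φ (pk r T) w‖) ^ 2 := by
        gcongr
        refine (norm_sum_le _ _).trans (le_of_eq ?_)
        simp only [norm_mul]
    _ ≤ (∑ T ∈ 𝒯, ‖c T‖ ^ 2) * ∑ T ∈ 𝒯, ‖extn Φ (pk r T) w‖ ^ 2 :=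
        Finset.sum_mul_sq_le_sq_mul_sq _ _ _
    _ ≤ (∑ T ∈ 𝒯, ‖c T‖ ^ 2) * (C * (L ^ N)⁻¹) := by
        gcongr
        exact h r hr 𝒯 h𝒯 w hw L hL hfar
    _ = _ := mul_comm _ _

lemma norm_sub_ctr_le {r : ℝ} (hr : 0 ≤ r) {c w : (Fin d → ℝ) × (Fin k → ℝ)}
    (hw : w ∈ cubeQ d k r c) : ‖w.1 - c.1‖ ≤ r / 2 ∧ ‖w.2 - c.2‖ ≤ r / 2 :=
  ⟨(pi_norm_le_iff_of_nonneg (by positivity)).2 hw.1,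
    (pi_norm_le_iff_of_nonneg (by positivity)).2 hw.2⟩

lemma exists_le_of_not_inc {Φ : (Fin d → ℝ) → Fin k → ℝ} (hΦ : ContDiff ℝ (⊤ : ℕ∞) Φ) (B : ℝ) :
    ∃ E : ℝ, 0 ≤ E ∧ ∀ r D : ℝ, 1 ≤ r → ∀ T : (Fin d → ℤ) × (Fin d → ℤ), ‖frq r T.1‖ ≤ B →
      ∀ q : (Fin d → ℤ) × (Fin k → ℤ), ¬ Inc Φ r D T q → ∀ w ∈ cubeQ d k r (ctr r q),
      max 1 (D / (1 + E)) ≤ 1 + ‖r⁻¹ • (w.1 + tg Φ w.2 (frq r T.1)) - rl T.2‖ := by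
  have hc : Continuous (fderiv ℝ Φ) := hΦ.continuous_fderiv (by simp)
  obtain ⟨M, hM⟩ := (isCompact_closedBall (0 : Fin d → ℝ) B).exists_bound_of_continuousOn
      hc.continuousOn
  refine ⟨1 + k * max M 0, by positivity, fun r D hr T hT q hq w hw => max_le (by simp) ?_⟩
  have hr0 : 0 < r := by linarith
  set E : ℝ := 1 + k * max M 0 with hE
  have hE0 : 0 ≤ E := by positivity
  obtain ⟨h1, h2⟩ := norm_sub_ctr_le hr0.le hw
  unfold Inc at hq
  rw [not_le] at hq
  set z := w.1 + tg Φ w.2 (frq r T.1) - r • rl T.2 with hz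
  have h3 : r⁻¹ • (w.1 + tg Φ w.2 (frq r T.1)) - rl T.2 = r⁻¹ • z := by
    rw [hz, smul_sub, smul_smul, inv_mul_cancel₀ hr0.ne', one_smul]
  have h4 : ‖tg Φ (w.2 - (ctr r q).2) (frq r T.1)‖ ≤ k * (r / 2) * max M 0 := by
    refine (norm_tg_le _ _ _).trans ?_
    gcongr
    exact (hM _ (by simpa using hT)).trans (le_max_left _ _)
  have h5 : r * D < ‖z‖ + r * E := by
    have : (ctr r q).1 + tg Φ (ctr r q).2 (frq r T.1) - r • rl T.2 =
        z - (w.1 - (ctr r q).1) - tg Φ (w.2 - (ctr r q).2) (frq r T.1) := by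
      rw [hz, tg_sub_left]
      abel
    rw [this] at hq
    have h6 := norm_sub_le (z - (w.1 - (ctr r q).1)) (tg Φ (w.2 - (ctr r q).2) (frq r T.1))
    have h7 := norm_sub_le z (w.1 - (ctr r q).1)
    have h8 : (0 : ℝ) ≤ k * r * max M 0 := by positivity
    rw [hE]
    nlinarith
  rw [h3, norm_smul, Real.norm_of_nonneg (by positivity)]
  have h6 : D - E ≤ r⁻¹ * ‖z‖ := by
    rw [inv_mul_eq_div, le_div_iff₀ hr0]
    nlinarith
  have h7 : 0 ≤ r⁻¹ * ‖z‖ := by positivity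
  rw [div_le_iff₀ (by positivity)]
  nlinarith

/-- The cells used to cover a cube of side `r ^ 2`. -/
def cells (d k : ℕ) (r : ℝ) : Finset ((Fin d → ℤ) × (Fin k → ℤ)) :=
  (Fintype.piFinset fun _ => Finset.Icc (-(⌈r / 2⌉ + 1)) (⌈r / 2⌉ + 1)) ×ˢ
    Fintype.piFinset fun _ => Finset.Icc (-(⌈r / 2⌉ + 1)) (⌈r / 2⌉ + 1)

lemma abs_le_of_mem_cells {r : ℝ} {q : (Fin d → ℤ) × (Fin k → ℤ)} (hq : q ∈ cells d k r) :
    (∀ i, |(q.1 i : ℝ)| ≤ r / 2 + 2) ∧ ∀ j, |(q.2 j : ℝ)| ≤ r / 2 + 2 := by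
  unfold cells at hq
  simp only [Finset.mem_product, Fintype.mem_piFinset, Finset.mem_Icc] at hq
  have hc := (Int.ceil_lt_add_one (r / 2)).le
  constructor
  · intro i
    have h1 : (-(⌈r / 2⌉ + 1) : ℝ) ≤ q.1 i := by exact_mod_cast (hq.1 i).1
    have h2 : (q.1 i : ℝ) ≤ ⌈r / 2⌉ + 1 := by exact_mod_cast (hq.1 i).2
    exact abs_le.2 ⟨by linarith, by linarith⟩
  · intro i
    have h1 : (-(⌈r / 2⌉ + 1) : ℝ) ≤ q.2 i := by exact_mod_cast (hq.2 i).1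
    have h2 : (q.2 i : ℝ) ≤ ⌈r / 2⌉ + 1 := by exact_mod_cast (hq.2 i).2
    exact abs_le.2 ⟨by linarith, by linarith⟩

lemma card_cells_le {r : ℝ} (hr : 6 ≤ r) : ((cells d k r).card : ℝ) ≤ (2 * r) ^ (d + k) := by
  have h : ((Finset.Icc (-(⌈r / 2⌉ + 1)) (⌈r / 2⌉ + 1)).card : ℝ) ≤ 2 * r := by
    have h0 : (0 : ℤ) ≤ ⌈r / 2⌉ := Int.ceil_nonneg (by positivity)
    have hc := (Int.ceil_lt_add_one (r / 2)).le
    rw [Int.card_Icc]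
    have : (((⌈r / 2⌉ + 1 + 1 - -(⌈r / 2⌉ + 1)).toNat : ℤ) : ℝ) ≤ 2 * r := by
      rw [Int.toNat_of_nonneg (by linarith)]
      push_cast
      linarith
    exact_mod_cast this
  unfold cells
  rw [Finset.card_product, Fintype.card_piFinset_const, Fintype.card_piFinset_const, pow_add]
  push_cast
  gcongr

lemma norm_ctr_le {r : ℝ} (hr : 6 ≤ r) {q : (Fin d → ℤ) × (Fin k → ℤ)} (hq : q ∈ cells d k r) :
    ‖(ctr r q).1‖ ≤ r ^ 2 - r / 2 ∧ ‖(ctr r q).2‖ ≤ r ^ 2 - r / 2 := by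
  have h := abs_le_of_mem_cells hq
  have key : ∀ z : ℝ, |z| ≤ r / 2 + 2 → ‖r * (z + 1 / 2)‖ ≤ r ^ 2 - r / 2 := by
    intro z hz
    rw [norm_mul, Real.norm_of_nonneg (by linarith), Real.norm_eq_abs]
    have h1 : |z + 1 / 2| ≤ |z| + 1 / 2 := (abs_add_le _ _).trans (by norm_num [abs_of_pos])
    nlinarith
  have h0 : 0 ≤ r ^ 2 - r / 2 := by nlinarith
  exact ⟨(pi_norm_le_iff_of_nonneg h0).2 fun i => key _ (h.1 i),
    (pi_norm_le_iff_of_nonneg h0).2 fun j => key _ (h.2 j)⟩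

lemma norm_le_of_mem_cell {r : ℝ} (hr : 6 ≤ r) {q : (Fin d → ℤ) × (Fin k → ℤ)}
    (hq : q ∈ cells d k r) {w : (Fin d → ℝ) × (Fin k → ℝ)} (hw : w ∈ cubeQ d k r (ctr r q)) :
    ‖w.1‖ ≤ r ^ 2 ∧ ‖w.2‖ ≤ r ^ 2 := by
  obtain ⟨h1, h2⟩ := norm_sub_ctr_le (by linarith) hw
  obtain ⟨h3, h4⟩ := norm_ctr_le hr hq
  have h5 := norm_add_le (w.1 - (ctr r q).1) (ctr r q).1
  have h6 := norm_add_le (w.2 - (ctr r q).2) (ctr r q).2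
  rw [sub_add_cancel] at h5 h6
  constructor <;> linarith

lemma exists_cell {r : ℝ} (hr : 0 < r) {w : (Fin d → ℝ) × (Fin k → ℝ)}
    (hw : w ∈ cubeQ d k (r ^ 2) 0) : ∃ q ∈ cells d k r, w ∈ cubeQ d k r (ctr r q) := by
  have key1 : ∀ x : ℝ, |x - r * (⌊x / r⌋ + 1 / 2)| ≤ r / 2 := by
    intro x
    have h1 := Int.floor_le (x / r)
    have h2 := (Int.lt_floor_add_one (x / r)).le
    rw [le_div_iff₀ hr] at h1
    rw [div_le_iff₀ hr] at h2
    rw [abs_le]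
    constructor <;> nlinarith
  have key2 : ∀ x : ℝ, |x| ≤ r ^ 2 / 2 → -(⌈r / 2⌉ + 1) ≤ ⌊x / r⌋ ∧ ⌊x / r⌋ ≤ ⌈r / 2⌉ + 1 := by
    intro x hx
    rw [abs_le] at hx
    have hc := Int.le_ceil (r / 2)
    constructor
    · rw [Int.le_floor, le_div_iff₀ hr]
      push_cast
      nlinarith
    · have h3 : x / r ≤ r / 2 := by
        rw [div_le_iff₀ hr]
        nlinarith
      have h4 := Int.floor_le (x / r)
      have h5 : (⌊x / r⌋ : ℝ) ≤ ⌈r / 2⌉ := by linarith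
      have h6 : ⌊x / r⌋ ≤ ⌈r / 2⌉ := by exact_mod_cast h5
      linarith
  have hw1 : ∀ i, |w.1 i| ≤ r ^ 2 / 2 := fun i => by simpa using hw.1 i
  have hw2 : ∀ j, |w.2 j| ≤ r ^ 2 / 2 := fun j => by simpa using hw.2 j
  refine ⟨(fun i => ⌊w.1 i / r⌋, fun j => ⌊w.2 j / r⌋), ?_, fun i => key1 _, fun j => key1 _⟩
  unfold cells
  simp only [Finset.mem_product, Fintype.mem_piFinset, Finset.mem_Icc]
  exact ⟨fun i => key2 _ (hw1 i), fun j => key2 _ (hw2 j)⟩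

open scoped Classical in
lemma syn_filter_add (Φ : (Fin d → ℝ) → Fin k → ℝ) (r : ℝ) (𝒯 : Finset ((Fin d → ℤ) × (Fin d → ℤ)))
    (P : (Fin d → ℤ) × (Fin d → ℤ) → Prop) (c : (Fin d → ℤ) × (Fin d → ℤ) → ℂ)
    (w : (Fin d → ℝ) × (Fin k → ℝ)) :
    syn Φ r (𝒯.filter P) c w + syn Φ r (𝒯.filter fun T => ¬ P T) c w = syn Φ r 𝒯 c w :=
  Finset.sum_filter_add_sum_filter_not _ _ _

set_option maxHeartbeats 1000000 in
open scoped Classical in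
/-- The local `L²` estimate for the nonlocal part of a product. -/
lemma exists_nonlocal_sq_le {Φ : (Fin d → ℝ) → Fin k → ℝ} (hΦ : ContDiff ℝ (⊤ : ℕ∞) Φ)
    (B κ : ℝ) (hB : 0 ≤ B) (hκ : 0 < κ) (N : ℕ) :
    ∃ C : ℝ, 6 ≤ C ∧ ∀ a₀ b₀ : Fin d → ℝ, ∀ ρ : ℝ, Transversal Φ κ ρ a₀ b₀ →
      ‖a₀‖ + ρ ≤ B → ‖b₀‖ + ρ ≤ B → ∀ (r D : ℝ) (K : ℕ), 1 ≤ D → C * D ^ 2 ≤ r → r ≤ K * D →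
      r ^ (4 * (d + k)) ≤ D ^ N →
      ∀ 𝒯₁ 𝒯₂ : Finset ((Fin d → ℤ) × (Fin d → ℤ)),
      (∀ T ∈ 𝒯₁, ‖frq r T.1 - a₀‖ ≤ ρ) → (∀ T ∈ 𝒯₂, ‖frq r T.1 - b₀‖ ≤ ρ) →
      ∀ b : (Fin d → ℤ) × (Fin d → ℤ) → ℂ,
      ∃ bs : (Fin d → ℤ) × (Fin d → ℤ) → (Fin d → ℤ) × (Fin k → ℤ),
      ∀ (β : (Fin d → ℤ) × (Fin k → ℤ)) (c b' : (Fin d → ℤ) × (Fin d → ℤ) → ℂ),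
      (∀ T, ‖b' T‖ ≤ ‖b T‖) →
      ∑ q ∈ cells d k r with blk K q = β, ∫ w in cubeQ d k r (ctr r q),
        ‖syn Φ r (𝒯₁.filter fun T => ¬ Near β (bs T)) c w * syn Φ r 𝒯₂ b' w‖ ^ 2 ≤
        C * D ^ (2 * d + 2 * (3 * d + k)) * (r ^ k * (r ^ d)⁻¹) *
          (∑ T ∈ 𝒯₁, ‖c T‖ ^ 2) * ∑ T ∈ 𝒯₂, ‖b T‖ ^ 2 := by
  obtain ⟨C₀, hC₀, hfar⟩ := exists_far_sq_le hΦ B κ hB hκ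
  obtain ⟨C₁, hC₁, hsyn1⟩ := exists_norm_syn_sq_le hΦ B 0
  obtain ⟨C₂, hC₂, hsyn⟩ := exists_norm_syn_sq_le hΦ B N
  obtain ⟨E, hE, hinc⟩ := exists_le_of_not_inc hΦ B
  set C₃ : ℝ := C₁ * C₂ * (1 + E) ^ N with hC₃
  have hC₃0 : 0 ≤ C₃ := by positivity
  refine ⟨3 * C₀ + 3 * (2 ^ (d + k) * (2 * C₃)) + 6, by nlinarith [show 0 ≤ 2 ^ (d + k) * (2 * C₃) by positivity], ?_⟩
  set Cf := 3 * C₀ + 3 * (2 ^ (d + k) * (2 * C₃)) + 6 with hCf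
  have hX0 : 0 ≤ 2 ^ (d + k) * (2 * C₃) := by positivity
  intro a₀ b₀ ρ htr ha hb r D K hD hr hK hN 𝒯₁ 𝒯₂ h𝒯₁ h𝒯₂ b
  have hD2 : 1 ≤ D ^ 2 := one_le_pow₀ hD
  have hr6 : 6 ≤ r := by nlinarith
  have hr1 : 1 ≤ r := by linarith
  have hr0 : 0 < r := by linarith
  have hbd : ∀ {c v : Fin d → ℝ}, ‖c‖ + ρ ≤ B → ‖v - c‖ ≤ ρ → ‖v‖ ≤ B := by
    intro c v h1 h2
    have := norm_add_le (v - c) c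
    rw [sub_add_cancel] at this
    linarith
  have B₁ : ∀ T ∈ 𝒯₁, ‖frq r T.1‖ ≤ B := fun T hT => hbd ha (h𝒯₁ T hT)
  have B₂ : ∀ T ∈ 𝒯₂, ‖frq r T.1‖ ≤ B := fun T hT => hbd hb (h𝒯₂ T hT)
  obtain ⟨bs, hbs⟩ := hfar a₀ b₀ ρ htr ha hb r D K hD
    (le_trans (mul_le_mul_of_nonneg_right (by linarith) (by positivity)) hr) hK 𝒯₁ 𝒯₂ h𝒯₁ h𝒯₂ (cells d k r)
    (fun q hq => (norm_ctr_le hr6 hq).2.trans (by linarith)) b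
  refine ⟨bs, fun β c b' hb' => ?_⟩
  set X := ∑ T ∈ 𝒯₁, ‖c T‖ ^ 2 with hX
  set Y := ∑ T ∈ 𝒯₂, ‖b T‖ ^ 2 with hY
  have hXn : 0 ≤ X := by positivity
  have hYn : 0 ≤ Y := by positivity
  have hY' : ∑ T ∈ 𝒯₂, ‖b' T‖ ^ 2 ≤ Y := Finset.sum_le_sum fun T _ => by
    gcongr
    exact hb' T
  have tail : ∀ q ∈ cells d k r, ∀ w ∈ cubeQ d k r (ctr r q),
      ∀ 𝒮 : Finset ((Fin d → ℤ) × (Fin d → ℤ)), (∀ T ∈ 𝒮, ‖frq r T.1‖ ≤ B) →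
      (∀ T ∈ 𝒮, ¬ Inc Φ r D T q) → ∀ z : (Fin d → ℤ) × (Fin d → ℤ) → ℂ,
      ‖syn Φ r 𝒮 z w‖ ^ 2 ≤ C₂ * ((1 + E) ^ N * (D ^ N)⁻¹) * ∑ T ∈ 𝒮, ‖z T‖ ^ 2 := by
    intro q hq w hw 𝒮 h𝒮 hni z
    refine (hsyn r hr1 𝒮 h𝒮 w (norm_le_of_mem_cell hr6 hq hw).2 (max 1 (D / (1 + E)))
      (le_max_left _ _) (fun T hT => hinc r D hr1 T (h𝒮 T hT) q (hni T hT) w hw) z).trans ?_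
    gcongr
    have hm : (D / (1 + E)) ^ N ≤ max 1 (D / (1 + E)) ^ N := by
      gcongr
      exact le_max_right _ _
    refine (inv_anti₀ (by positivity) hm).trans (le_of_eq ?_)
    rw [div_pow, inv_div, div_eq_mul_inv]
  have full : ∀ q ∈ cells d k r, ∀ w ∈ cubeQ d k r (ctr r q),
      ∀ 𝒮 : Finset ((Fin d → ℤ) × (Fin d → ℤ)), (∀ T ∈ 𝒮, ‖frq r T.1‖ ≤ B) →
      ∀ z : (Fin d → ℤ) × (Fin d → ℤ) → ℂ, ‖syn Φ r 𝒮 z w‖ ^ 2 ≤ C₁ * ∑ T ∈ 𝒮, ‖z T‖ ^ 2 := by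
    intro q hq w hw 𝒮 h𝒮 z
    simpa using hsyn1 r hr1 𝒮 h𝒮 w (norm_le_of_mem_cell hr6 hq hw).2 1 le_rfl
      (fun T hT => by simp) z
  set τ : ℝ := 2 * C₃ * (D ^ N)⁻¹ * (X * Y) with hτ
  have hτ0 : 0 ≤ τ := by positivity
  have cell : ∀ q ∈ cells d k r, ∫ w in cubeQ d k r (ctr r q),
      ‖syn Φ r (𝒯₁.filter fun T => ¬ Near β (bs T)) c w * syn Φ r 𝒯₂ b' w‖ ^ 2 ≤
      3 * (∫ w in cubeQ d k r (ctr r q),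
        ‖syn Φ r (𝒯₁.filter fun T => Inc Φ r D T q ∧ ¬ Near β (bs T)) c w *
          syn Φ r (𝒯₂.filter fun T => Inc Φ r D T q) b' w‖ ^ 2) + r ^ (d + k) * (3 * τ) := by
    intro q hq
    set F := syn Φ r (𝒯₁.filter fun T => ¬ Near β (bs T)) c with hF
    set F₁ := syn Φ r (𝒯₁.filter fun T => Inc Φ r D T q ∧ ¬ Near β (bs T)) c with hF₁
    set F₂ := syn Φ r (𝒯₁.filter fun T => ¬ Inc Φ r D T q ∧ ¬ Near β (bs T)) c with hF₂
    set G₁ := syn Φ r (𝒯₂.filter fun T => Inc Φ r D T q) b' with hG₁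
    set G₂ := syn Φ r (𝒯₂.filter fun T => ¬ Inc Φ r D T q) b' with hG₂
    have hsF : ∀ w, F w = F₁ w + F₂ w := by
      intro w
      rw [hF, ← syn_filter_add Φ r _ fun T => Inc Φ r D T q, Finset.filter_filter,
        Finset.filter_filter, hF₁, hF₂]
      simp only [and_comm]
    have hsG : ∀ w, syn Φ r 𝒯₂ b' w = G₁ w + G₂ w := fun w => (syn_filter_add Φ r _ _ _ w).symm
    have hpt : ∀ w ∈ cubeQ d k r (ctr r q), ‖F w * syn Φ r 𝒯₂ b' w‖ ^ 2 ≤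
        3 * ‖F₁ w * G₁ w‖ ^ 2 + 3 * τ := by
      intro w hw
      have hsub : ∀ 𝒮 ⊆ 𝒯₁, ∑ T ∈ 𝒮, ‖c T‖ ^ 2 ≤ X :=
        fun 𝒮 h => Finset.sum_le_sum_of_subset_of_nonneg h fun _ _ _ => by positivity
      have hsub2 : ∀ 𝒮 ⊆ 𝒯₂, ∑ T ∈ 𝒮, ‖b' T‖ ^ 2 ≤ Y :=
        fun 𝒮 h => (Finset.sum_le_sum_of_subset_of_nonneg h fun _ _ _ => by positivity).trans hY'
      have t1 : ‖F₁ w‖ ^ 2 ≤ C₁ * X := (full q hq w hw _ (fun T hT => B₁ T (Finset.mem_filter.1 hT).1)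
        c).trans (by gcongr; exact hsub _ (Finset.filter_subset _ _))
      have t2 : ‖F₂ w‖ ^ 2 ≤ C₂ * ((1 + E) ^ N * (D ^ N)⁻¹) * X :=
        (tail q hq w hw _ (fun T hT => B₁ T (Finset.mem_filter.1 hT).1)
        (fun T hT => (Finset.mem_filter.1 hT).2.1) c).trans (by gcongr; exact hsub _ (Finset.filter_subset _ _))
      have t3 : ‖G₂ w‖ ^ 2 ≤ C₂ * ((1 + E) ^ N * (D ^ N)⁻¹) * Y :=
        (tail q hq w hw _ (fun T hT => B₂ T (Finset.mem_filter.1 hT).1)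
        (fun T hT => (Finset.mem_filter.1 hT).2) b').trans (by gcongr; exact hsub2 _ (Finset.filter_subset _ _))
      have t4 : ‖G₁ w + G₂ w‖ ^ 2 ≤ C₁ * Y := by
        rw [← hsG]
        exact (full q hq w hw _ B₂ b').trans (by gcongr)
      have t5 : ‖F₁ w * G₂ w‖ ^ 2 ≤ C₁ * X * (C₂ * ((1 + E) ^ N * (D ^ N)⁻¹) * Y) := by
        rw [norm_mul, mul_pow]
        gcongr
      have t6 : ‖F₂ w * (G₁ w + G₂ w)‖ ^ 2 ≤ C₂ * ((1 + E) ^ N * (D ^ N)⁻¹) * X * (C₁ * Y) := by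
        rw [norm_mul, mul_pow]
        gcongr
      have t7 : C₁ * X * (C₂ * ((1 + E) ^ N * (D ^ N)⁻¹) * Y) +
          C₂ * ((1 + E) ^ N * (D ^ N)⁻¹) * X * (C₁ * Y) = τ := by
        rw [hτ, hC₃]
        ring
      have e : F w * syn Φ r 𝒯₂ b' w = F₁ w * G₁ w + F₁ w * G₂ w + F₂ w * (G₁ w + G₂ w) := by
        rw [hsF, hsG]
        ring
      have t8 : ‖F₁ w * G₁ w + F₁ w * G₂ w + F₂ w * (G₁ w + G₂ w)‖ ≤
          ‖F₁ w * G₁ w‖ + ‖F₁ w * G₂ w‖ + ‖F₂ w * (G₁ w + G₂ w)‖ := norm_add₃_le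
      rw [e]
      set x := ‖F₁ w * G₁ w‖
      set y := ‖F₁ w * G₂ w‖
      set z := ‖F₂ w * (G₁ w + G₂ w)‖
      calc ‖F₁ w * G₁ w + F₁ w * G₂ w + F₂ w * (G₁ w + G₂ w)‖ ^ 2 ≤ (x + y + z) ^ 2 := by gcongr
        _ ≤ 3 * x ^ 2 + 3 * (y ^ 2 + z ^ 2) := by
            nlinarith [sq_nonneg (x - y), sq_nonneg (x - z), sq_nonneg (y - z)]
        _ ≤ 3 * x ^ 2 + 3 * τ := by linarith
    have hc1 : Continuous fun w => ‖F₁ w * G₁ w‖ ^ 2 :=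
      (((continuous_syn hΦ.continuous hr0 _ _).mul (continuous_syn hΦ.continuous hr0 _ _)).norm).pow 2
    have hc2 : Continuous fun w => ‖F w * syn Φ r 𝒯₂ b' w‖ ^ 2 :=
      (((continuous_syn hΦ.continuous hr0 _ _).mul (continuous_syn hΦ.continuous hr0 _ _)).norm).pow 2
    have hQ := isCompact_cubeQ r (ctr r q)
    have hi1 := hc1.continuousOn.integrableOn_compact (μ := volume) hQ
    have hi2 := hc2.continuousOn.integrableOn_compact (μ := volume) hQ
    have hvol : volume (cubeQ d k r (ctr r q)) = ENNReal.ofReal (r ^ (d + k)) :=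
      volume_cubeQ hr0.le _
    have hi3 : IntegrableOn (fun _ => 3 * τ) (cubeQ d k r (ctr r q)) volume :=
      integrableOn_const (by rw [hvol]; exact ENNReal.ofReal_ne_top)
    have hi : IntegrableOn (fun w => 3 * ‖F₁ w * G₁ w‖ ^ 2 + 3 * τ) (cubeQ d k r (ctr r q)) volume :=
      (hi1.const_mul 3).add hi3
    refine (setIntegral_mono_on hi2 hi (measurableSet_cubeQ _ _) hpt).trans
      (le_of_eq ?_)
    rw [integral_add (hi1.const_mul 3) hi3, integral_const_mul, setIntegral_const, Measure.real, hvol,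
      ENNReal.toReal_ofReal (by positivity), smul_eq_mul]
  have hcount : (((cells d k r).filter fun q => blk K q = β).card : ℝ) ≤ (2 * r) ^ (d + k) :=
    le_trans (by exact_mod_cast Finset.card_le_card (Finset.filter_subset _ _)) (card_cells_le hr6)
  have hrτ : (2 * r) ^ (d + k) * (r ^ (d + k) * (3 * τ)) ≤
      3 * (2 ^ (d + k) * (2 * C₃)) * (r ^ k * (r ^ d)⁻¹) * (X * Y) := by
    have h1 : r ^ (d + k) * r ^ (d + k) * (D ^ N)⁻¹ ≤ r ^ k * (r ^ d)⁻¹ := by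
      rw [← div_eq_mul_inv, ← div_eq_mul_inv, div_le_div_iff₀ (by positivity) (by positivity),
        ← pow_add, ← pow_add]
      calc r ^ (d + k + (d + k) + d) ≤ r ^ (4 * (d + k)) := pow_le_pow_right₀ hr1 (by lia)
        _ ≤ D ^ N := hN
        _ ≤ r ^ k * D ^ N := le_mul_of_one_le_left (by positivity) (one_le_pow₀ hr1)
    calc (2 * r) ^ (d + k) * (r ^ (d + k) * (3 * τ)) = 3 * (2 ^ (d + k) * (2 * C₃)) *
          (r ^ (d + k) * r ^ (d + k) * (D ^ N)⁻¹) * (X * Y) := by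
          rw [hτ, mul_pow]
          ring
      _ ≤ _ := by gcongr
  have hDP : 1 ≤ D ^ (2 * d + 2 * (3 * d + k)) := one_le_pow₀ hD
  set P := 2 * d + 2 * (3 * d + k)
  calc _ ≤ ∑ q ∈ cells d k r with blk K q = β, (3 * (∫ w in cubeQ d k r (ctr r q),
        ‖syn Φ r (𝒯₁.filter fun T => Inc Φ r D T q ∧ ¬ Near β (bs T)) c w *
          syn Φ r (𝒯₂.filter fun T => Inc Φ r D T q) b' w‖ ^ 2) + r ^ (d + k) * (3 * τ)) :=
        Finset.sum_le_sum fun q hq => cell q (Finset.mem_filter.1 hq).1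
    _ ≤ 3 * (C₀ * D ^ P * (r ^ k * (r ^ d)⁻¹) * X * Y) + (2 * r) ^ (d + k) * (r ^ (d + k) * (3 * τ)) := by
        rw [Finset.sum_add_distrib, ← Finset.mul_sum, Finset.sum_const, nsmul_eq_mul]
        gcongr
        exact hbs β c b' hb'
    _ ≤ 3 * (C₀ * D ^ P * (r ^ k * (r ^ d)⁻¹) * X * Y) +
        3 * (2 ^ (d + k) * (2 * C₃)) * (r ^ k * (r ^ d)⁻¹) * (X * Y) := by gcongr
    _ ≤ 3 * (C₀ * D ^ P * (r ^ k * (r ^ d)⁻¹) * X * Y) +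
        3 * (2 ^ (d + k) * (2 * C₃)) * (r ^ k * (r ^ d)⁻¹) * (X * Y) * D ^ P := by
        have := le_mul_of_one_le_right (show 0 ≤ 3 * (2 ^ (d + k) * (2 * C₃)) *
          (r ^ k * (r ^ d)⁻¹) * (X * Y) by positivity) hDP
        linarith
    _ = (3 * C₀ + 3 * (2 ^ (d + k) * (2 * C₃))) * (D ^ P * (r ^ k * (r ^ d)⁻¹) * X * Y) := by ring
    _ ≤ Cf * (D ^ P * (r ^ k * (r ^ d)⁻¹) * X * Y) := by
        gcongr
        linarith
    _ = _ := by ring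

/-- The exponent `p₀ = (d + 3k) / (d + k)`. -/
def crit (d k : ℕ) : ℝ := ((d : ℝ) + 3 * k) / ((d : ℝ) + k)

lemma crit_sub_one (hk : 1 ≤ k) : crit d k - 1 = 2 * k / (d + k) := by
  have : (0 : ℝ) < d + k := by positivity
  rw [crit]
  field_simp
  ring

lemma two_sub_crit (hk : 1 ≤ k) : 2 - crit d k = (d - k) / (d + k) := by
  have : (0 : ℝ) < d + k := by positivity
  rw [crit]
  field_simp
  ring

lemma one_le_crit (hk : 1 ≤ k) : 1 ≤ crit d k := by
  have h := crit_sub_one (d := d) hk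
  have : (0 : ℝ) ≤ 2 * k / (d + k) := by positivity
  linarith

lemma one_le_ofReal_crit (hk : 1 ≤ k) : 1 ≤ ENNReal.ofReal (crit d k) :=
  ENNReal.one_le_ofReal.2 (one_le_crit hk)

lemma lintegral_rpow_le {α : Type*} [MeasurableSpace α] {μ : Measure α} {h : α → ℂ}
    (hh : AEStronglyMeasurable h μ) {p : ℝ} (h1 : 1 ≤ p) (h2 : p ≤ 2) :
    ∫⁻ x, ‖h x‖ₑ ^ p ∂μ ≤ (∫⁻ x, ‖h x‖ₑ ∂μ) ^ (2 - p) * (∫⁻ x, ‖h x‖ₑ ^ 2 ∂μ) ^ (p - 1) := by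
  refine le_trans (le_of_eq (lintegral_congr fun x => ?_)) (ENNReal.lintegral_mul_norm_pow_le
    (hh.enorm) (hh.enorm.pow_const 2) (by linarith) (by linarith) (by ring))
  rw [← ENNReal.rpow_natCast, ← ENNReal.rpow_mul, ← ENNReal.rpow_add_of_nonneg _ _ (by linarith)
    (by push_cast; linarith)]
  congr 1
  push_cast
  ring

lemma eLpNorm_crit_le (hk : 1 ≤ k) (hkd : k ≤ d) {α : Type*} [MeasurableSpace α] {μ : Measure α}
    {h : α → ℂ} (hh : AEStronglyMeasurable h μ) {r M Z : ℝ} (hr : 0 < r) (hM : 0 ≤ M) (hZ : 0 ≤ Z)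
    (h1 : ∫⁻ x, ‖h x‖ₑ ∂μ ≤ ENNReal.ofReal (M * r ^ (2 * k) * Z))
    (h2 : ∫⁻ x, ‖h x‖ₑ ^ 2 ∂μ ≤ ENNReal.ofReal (M ^ 2 * (r ^ k * (r ^ d)⁻¹) * Z ^ 2)) :
    eLpNorm h (ENNReal.ofReal (crit d k)) μ ≤ ENNReal.ofReal (M * Z) := by
  have hp1 : 1 ≤ crit d k := one_le_crit hk
  have e1 := crit_sub_one (d := d) hk
  have e2 := two_sub_crit (d := d) hk
  have hdk : (0 : ℝ) < d + k := by positivity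
  have hkd' : (k : ℝ) ≤ d := by exact_mod_cast hkd
  have h2p : 0 ≤ 2 - crit d k := by
    rw [e2]
    exact div_nonneg (by linarith) hdk.le
  have hp0 : 0 < crit d k := by linarith
  have key : ∫⁻ x, ‖h x‖ₑ ^ crit d k ∂μ ≤ ENNReal.ofReal ((M * Z) ^ crit d k) := by
    refine (lintegral_rpow_le hh hp1 (by linarith)).trans ?_
    calc _ ≤ ENNReal.ofReal (M * r ^ (2 * k) * Z) ^ (2 - crit d k) *
          ENNReal.ofReal (M ^ 2 * (r ^ k * (r ^ d)⁻¹) * Z ^ 2) ^ (crit d k - 1) := by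
          gcongr
      _ = ENNReal.ofReal ((M * r ^ (2 * k) * Z) ^ (2 - crit d k) *
          (M ^ 2 * (r ^ k * (r ^ d)⁻¹) * Z ^ 2) ^ (crit d k - 1)) := by
          rw [ENNReal.ofReal_rpow_of_nonneg (by positivity) h2p,
            ENNReal.ofReal_rpow_of_nonneg (by positivity) (by linarith),
            ← ENNReal.ofReal_mul (by positivity)]
      _ ≤ _ := by
          refine ENNReal.ofReal_le_ofReal (le_of_eq ?_)
          have hMZ : 0 ≤ M * Z := by positivity
          have f1 : M * r ^ (2 * k) * Z = (M * Z) * r ^ ((2 * k : ℕ) : ℝ) := by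
            rw [Real.rpow_natCast]
            ring
          have f2 : M ^ 2 * (r ^ k * (r ^ d)⁻¹) * Z ^ 2 = (M * Z) ^ (2 : ℝ) * r ^ ((k : ℝ) - d) := by
            rw [Real.rpow_sub hr, Real.rpow_natCast, Real.rpow_natCast]
            norm_cast
            rw [div_eq_mul_inv]
            ring
          rw [f1, f2]
          generalize M * Z = Y at hMZ
          rw [Real.mul_rpow hMZ (by positivity), Real.mul_rpow (by positivity) (by positivity),
            ← Real.rpow_mul hMZ, ← Real.rpow_mul hr.le, ← Real.rpow_mul hr.le, mul_mul_mul_comm,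
            ← Real.rpow_add_of_nonneg hMZ h2p (by linarith), ← Real.rpow_add hr]
          have g1 : ((2 * k : ℕ) : ℝ) * (2 - crit d k) + ((k : ℝ) - d) * (crit d k - 1) = 0 := by
            rw [e1, e2]
            push_cast
            field_simp
            ring
          rw [g1, Real.rpow_zero, mul_one]
          congr 1
          ring
  rw [eLpNorm_eq_lintegral_rpow_enorm_toReal (by simpa using hp0) ENNReal.ofReal_ne_top,
    ENNReal.toReal_ofReal hp0.le]
  calc _ ≤ ENNReal.ofReal ((M * Z) ^ crit d k) ^ (1 / crit d k) := by gcongr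
    _ = ENNReal.ofReal (M * Z) := by
      rw [ENNReal.ofReal_rpow_of_nonneg (by positivity) (by positivity), ← Real.rpow_mul (by positivity),
        mul_one_div_cancel hp0.ne', Real.rpow_one]

/-- The union of the cells of `cubeQ (r²) 0` that belong to the block `β`. -/
def reg (d k : ℕ) (r : ℝ) (K : ℕ) (β : (Fin d → ℤ) × (Fin k → ℤ)) :
    Set ((Fin d → ℝ) × (Fin k → ℝ)) :=
  ⋃ q ∈ (cells d k r).filter fun q => blk K q = β, cubeQ d k r (ctr r q)

lemma reg_subset {r : ℝ} (hr : 6 ≤ r) (K : ℕ) (β : (Fin d → ℤ) × (Fin k → ℤ)) :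
    reg d k r K β ⊆ cubeQ d k (2 * r ^ 2) 0 := by
  intro w hw
  simp only [reg, Set.mem_iUnion, Finset.mem_filter] at hw
  obtain ⟨q, ⟨hq, -⟩, hw⟩ := hw
  obtain ⟨h1, h2⟩ := norm_le_of_mem_cell hr hq hw
  constructor
  · intro i
    have := (norm_le_pi_norm w.1 i).trans h1
    simpa using this
  · intro j
    have := (norm_le_pi_norm w.2 j).trans h2
    simpa using this

lemma lintegral_biUnion_le {α ι : Type*} [MeasurableSpace α] (μ : Measure α) (s : Finset ι)
    (t : ι → Set α) (f : α → ℝ≥0∞) :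
    ∫⁻ x in ⋃ i ∈ s, t i, f x ∂μ ≤ ∑ i ∈ s, ∫⁻ x in t i, f x ∂μ := by
  classical
  induction s using Finset.induction_on with
  | empty => simp
  | insert a s ha ih =>
    rw [Finset.set_biUnion_insert, Finset.sum_insert ha]
    refine (lintegral_union_le _ _ _).trans ?_
    gcongr

lemma lintegral_cubeQ_norm_sq {h : (Fin d → ℝ) × (Fin k → ℝ) → ℂ} (hh : Continuous h) (R : ℝ)
    (c : (Fin d → ℝ) × (Fin k → ℝ)) :
    ∫⁻ w in cubeQ d k R c, ‖h w‖ₑ ^ 2 = ENNReal.ofReal (∫ w in cubeQ d k R c, ‖h w‖ ^ 2) := by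
  rw [ofReal_integral_eq_lintegral_ofReal]
  · refine lintegral_congr fun w => ?_
    rw [ENNReal.ofReal_pow (norm_nonneg _), ofReal_norm]
  · exact ((hh.norm.pow 2).continuousOn).integrableOn_compact (isCompact_cubeQ R c)
  · exact Filter.Eventually.of_forall fun w => by positivity

/-- The square root of the sum of squared coefficients. -/
def nrm (𝒯 : Finset ((Fin d → ℤ) × (Fin d → ℤ))) (c : (Fin d → ℤ) × (Fin d → ℤ) → ℂ) : ℝ :=
  √(∑ T ∈ 𝒯, ‖c T‖ ^ 2)

lemma nrm_nonneg (𝒯 : Finset ((Fin d → ℤ) × (Fin d → ℤ))) (c : (Fin d → ℤ) × (Fin d → ℤ) → ℂ) :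
    0 ≤ nrm 𝒯 c := Real.sqrt_nonneg _

lemma nrm_sq (𝒯 : Finset ((Fin d → ℤ) × (Fin d → ℤ))) (c : (Fin d → ℤ) × (Fin d → ℤ) → ℂ) :
    nrm 𝒯 c ^ 2 = ∑ T ∈ 𝒯, ‖c T‖ ^ 2 := Real.sq_sqrt (by positivity)

lemma nrm_mono {𝒯 𝒯' : Finset ((Fin d → ℤ) × (Fin d → ℤ))} {c c' : (Fin d → ℤ) × (Fin d → ℤ) → ℂ}
    (h : 𝒯 ⊆ 𝒯') (hc : ∀ T, ‖c T‖ ≤ ‖c' T‖) : nrm 𝒯 c ≤ nrm 𝒯' c' := by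
  refine Real.sqrt_le_sqrt ((Finset.sum_le_sum fun T _ => ?_).trans
    (Finset.sum_le_sum_of_subset_of_nonneg h fun _ _ _ => by positivity))
  gcongr
  exact hc T

/-- The `L¹` bound for products of extensions. -/
lemma lintegral_syn_mul_syn_le {Φ : (Fin d → ℝ) → Fin k → ℝ} (hΦ : ContDiff ℝ (⊤ : ℕ∞) Φ)
    {r : ℝ} (hr : 0 < r) (𝒯₁ 𝒯₂ : Finset ((Fin d → ℤ) × (Fin d → ℤ)))
    (c b : (Fin d → ℤ) × (Fin d → ℤ) → ℂ) {R : ℝ} (hR : 0 ≤ R) (w₀ : (Fin d → ℝ) × (Fin k → ℝ)) :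
    ∫⁻ w in cubeQ d k R w₀, ‖syn Φ r 𝒯₁ c w * syn Φ r 𝒯₂ b w‖ₑ ≤
      ENNReal.ofReal (R ^ k * 3 ^ d * (nrm 𝒯₁ c * nrm 𝒯₂ b)) := by
  have h1 := continuous_syn hΦ.continuous hr 𝒯₁ c
  have h2 := continuous_syn hΦ.continuous hr 𝒯₂ b
  have hb : ∀ 𝒯 : Finset ((Fin d → ℤ) × (Fin d → ℤ)), ∀ z,
      ∫⁻ w in cubeQ d k R w₀, ‖syn Φ r 𝒯 z w‖ₑ ^ 2 ≤ ENNReal.ofReal (R ^ k * (3 ^ d * nrm 𝒯 z ^ 2)) := by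
    intro 𝒯 z
    rw [lintegral_cubeQ_norm_sq (continuous_syn hΦ.continuous hr 𝒯 z), nrm_sq]
    exact ENNReal.ofReal_le_ofReal (setIntegral_norm_sq_syn_le hΦ hr 𝒯 z hR w₀)
  have hm : ∀ {h : (Fin d → ℝ) × (Fin k → ℝ) → ℂ}, Continuous h →
      AEMeasurable (fun w => ‖h w‖ₑ ^ 2) (volume.restrict (cubeQ d k R w₀)) :=
    fun hh => (hh.measurable.enorm.pow_const 2).aemeasurable
  calc _ = ∫⁻ w in cubeQ d k R w₀, (‖syn Φ r 𝒯₁ c w‖ₑ ^ 2) ^ (1 / 2 : ℝ) *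
        (‖syn Φ r 𝒯₂ b w‖ₑ ^ 2) ^ (1 / 2 : ℝ) := by
        refine lintegral_congr fun w => ?_
        have hs : ∀ x : ℝ≥0∞, (x ^ 2) ^ (1 / 2 : ℝ) = x := fun x => by
          rw [← ENNReal.rpow_natCast, ← ENNReal.rpow_mul]
          norm_num
        rw [hs, hs, enorm_mul]
    _ ≤ (∫⁻ w in cubeQ d k R w₀, ‖syn Φ r 𝒯₁ c w‖ₑ ^ 2) ^ (1 / 2 : ℝ) *
        (∫⁻ w in cubeQ d k R w₀, ‖syn Φ r 𝒯₂ b w‖ₑ ^ 2) ^ (1 / 2 : ℝ) :=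
        ENNReal.lintegral_mul_norm_pow_le (hm h1) (hm h2) (by norm_num) (by norm_num) (by norm_num)
    _ ≤ ENNReal.ofReal (R ^ k * (3 ^ d * nrm 𝒯₁ c ^ 2)) ^ (1 / 2 : ℝ) *
        ENNReal.ofReal (R ^ k * (3 ^ d * nrm 𝒯₂ b ^ 2)) ^ (1 / 2 : ℝ) := by
        gcongr
        · exact hb _ _
        · exact hb _ _
    _ = ENNReal.ofReal (R ^ k * 3 ^ d * (nrm 𝒯₁ c * nrm 𝒯₂ b)) := by
        have n1 := nrm_nonneg 𝒯₁ c
        have n2 := nrm_nonneg 𝒯₂ b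
        rw [ENNReal.ofReal_rpow_of_nonneg (by positivity) (by norm_num),
          ENNReal.ofReal_rpow_of_nonneg (by positivity) (by norm_num),
          ← ENNReal.ofReal_mul (by positivity), ← Real.mul_rpow (by positivity) (by positivity),
          ← Real.sqrt_eq_rpow]
        congr 1
        rw [Real.sqrt_eq_iff_mul_self_eq (by positivity) (by positivity)]
        ring

open scoped Classical in
/-- The local `L^{p₀}` estimate for the nonlocal part of a product. -/
lemma exists_nonlocal_le (hk : 1 ≤ k) (hkd : k ≤ d) {Φ : (Fin d → ℝ) → Fin k → ℝ}
    (hΦ : ContDiff ℝ (⊤ : ℕ∞) Φ) (B κ : ℝ) (hB : 0 ≤ B) (hκ : 0 < κ) (N : ℕ) :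
    ∃ C : ℝ, 6 ≤ C ∧ ∀ a₀ b₀ : Fin d → ℝ, ∀ ρ : ℝ, Transversal Φ κ ρ a₀ b₀ →
      ‖a₀‖ + ρ ≤ B → ‖b₀‖ + ρ ≤ B → ∀ (r D : ℝ) (K : ℕ), 1 ≤ D → C * D ^ 2 ≤ r → r ≤ K * D →
      r ^ (4 * (d + k)) ≤ D ^ N →
      ∀ 𝒯₁ 𝒯₂ : Finset ((Fin d → ℤ) × (Fin d → ℤ)),
      (∀ T ∈ 𝒯₁, ‖frq r T.1 - a₀‖ ≤ ρ) → (∀ T ∈ 𝒯₂, ‖frq r T.1 - b₀‖ ≤ ρ) →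
      ∀ b : (Fin d → ℤ) × (Fin d → ℤ) → ℂ,
      ∃ bs : (Fin d → ℤ) × (Fin d → ℤ) → (Fin d → ℤ) × (Fin k → ℤ),
      ∀ (β : (Fin d → ℤ) × (Fin k → ℤ)) (c b' : (Fin d → ℤ) × (Fin d → ℤ) → ℂ),
      (∀ T, ‖b' T‖ ≤ ‖b T‖) →
      eLpNorm (fun w => syn Φ r (𝒯₁.filter fun T => ¬ Near β (bs T)) c w * syn Φ r 𝒯₂ b' w)
        (ENNReal.ofReal (crit d k)) (volume.restrict (reg d k r K β)) ≤
        ENNReal.ofReal (C * D ^ (2 * d + 2 * (3 * d + k)) * (nrm 𝒯₁ c * nrm 𝒯₂ b)) := by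
  obtain ⟨C₀, hC₀, H⟩ := exists_nonlocal_sq_le hΦ B κ hB hκ N
  have h23 : (0 : ℝ) ≤ 2 ^ k * 3 ^ d := by positivity
  refine ⟨C₀ + 2 ^ k * 3 ^ d, by linarith, ?_⟩
  intro a₀ b₀ ρ htr ha hb r D K hD hr hK hN 𝒯₁ 𝒯₂ h𝒯₁ h𝒯₂ b
  have hD2 : 1 ≤ D ^ 2 := one_le_pow₀ hD
  have hr' : C₀ * D ^ 2 ≤ r := le_trans (by gcongr; linarith) hr
  have hr6 : 6 ≤ r := by nlinarith
  have hr0 : 0 < r := by linarith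
  obtain ⟨bs, hbs⟩ := H a₀ b₀ ρ htr ha hb r D K hD hr' hK hN 𝒯₁ 𝒯₂ h𝒯₁ h𝒯₂ b
  refine ⟨bs, fun β c b' hb' => ?_⟩
  set P := 2 * d + 2 * (3 * d + k)
  have hDP : 1 ≤ D ^ P := one_le_pow₀ hD
  set M := (C₀ + 2 ^ k * 3 ^ d) * D ^ P with hM
  have hM1 : C₀ * D ^ P ≤ M := by
    rw [hM]
    gcongr
    linarith
  have hM2 : 2 ^ k * 3 ^ d ≤ M := by
    rw [hM]
    exact le_trans (by linarith) (le_mul_of_one_le_right (by linarith) hDP)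
  have hM3 : 1 ≤ M := le_trans (by nlinarith) hM1
  have hZ : 0 ≤ nrm 𝒯₁ c * nrm 𝒯₂ b := mul_nonneg (nrm_nonneg _ _) (nrm_nonneg _ _)
  have hcont : Continuous fun w =>
      syn Φ r (𝒯₁.filter fun T => ¬ Near β (bs T)) c w * syn Φ r 𝒯₂ b' w :=
    (continuous_syn hΦ.continuous hr0 _ _).mul (continuous_syn hΦ.continuous hr0 _ _)
  refine eLpNorm_crit_le hk hkd hcont.aestronglyMeasurable hr0 (by linarith) hZ ?_ ?_
  · refine (lintegral_mono_set (reg_subset hr6 K β)).trans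
      ((lintegral_syn_mul_syn_le hΦ hr0 _ _ _ _ (by positivity) _).trans
        (ENNReal.ofReal_le_ofReal ?_))
    calc (2 * r ^ 2) ^ k * 3 ^ d * (nrm (𝒯₁.filter fun T => ¬ Near β (bs T)) c * nrm 𝒯₂ b')
        ≤ (2 * r ^ 2) ^ k * 3 ^ d * (nrm 𝒯₁ c * nrm 𝒯₂ b) := by
          refine mul_le_mul_of_nonneg_left ?_ (by positivity)
          exact mul_le_mul (nrm_mono (Finset.filter_subset _ _) fun _ => le_rfl)
            (nrm_mono subset_rfl hb') (nrm_nonneg _ _) (nrm_nonneg _ _)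
      _ = (2 ^ k * 3 ^ d) * r ^ (2 * k) * (nrm 𝒯₁ c * nrm 𝒯₂ b) := by
          rw [mul_pow, pow_mul]
          ring
      _ ≤ _ := by gcongr
  · refine (lintegral_biUnion_le _ _ _ _).trans ?_
    simp only [lintegral_cubeQ_norm_sq hcont]
    rw [← ENNReal.ofReal_sum_of_nonneg fun q _ => integral_nonneg fun w => by positivity]
    refine ENNReal.ofReal_le_ofReal ((hbs β c b' hb').trans ?_)
    rw [mul_pow (nrm 𝒯₁ c), nrm_sq, nrm_sq, ← mul_assoc (M ^ 2 * _)]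
    have hMM : C₀ * D ^ P ≤ M ^ 2 := by nlinarith
    exact mul_le_mul_of_nonneg_right (mul_le_mul_of_nonneg_right
      (mul_le_mul_of_nonneg_right hMM (by positivity)) (by positivity)) (by positivity)

open scoped Classical in
/-- On each block, a product splits into a local part and a small remainder. -/
lemma exists_local_add_le (hk : 1 ≤ k) (hkd : k ≤ d) {Φ : (Fin d → ℝ) → Fin k → ℝ}
    (hΦ : ContDiff ℝ (⊤ : ℕ∞) Φ) (B κ : ℝ) (hB : 0 ≤ B) (hκ : 0 < κ) (N : ℕ) :
    ∃ C : ℝ, 6 ≤ C ∧ ∀ a₀ b₀ : Fin d → ℝ, ∀ ρ : ℝ, Transversal Φ κ ρ a₀ b₀ →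
      Transversal Φ κ ρ b₀ a₀ →
      ‖a₀‖ + ρ ≤ B → ‖b₀‖ + ρ ≤ B → ∀ (r D : ℝ) (K : ℕ), 1 ≤ D → C * D ^ 2 ≤ r → r ≤ K * D →
      r ^ (4 * (d + k)) ≤ D ^ N →
      ∀ 𝒯₁ 𝒯₂ : Finset ((Fin d → ℤ) × (Fin d → ℤ)),
      (∀ T ∈ 𝒯₁, ‖frq r T.1 - a₀‖ ≤ ρ) → (∀ T ∈ 𝒯₂, ‖frq r T.1 - b₀‖ ≤ ρ) →
      ∀ c b : (Fin d → ℤ) × (Fin d → ℤ) → ℂ,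
      ∃ bs₁ bs₂ : (Fin d → ℤ) × (Fin d → ℤ) → (Fin d → ℤ) × (Fin k → ℤ),
      ∀ β : (Fin d → ℤ) × (Fin k → ℤ),
      eLpNorm (fun w => syn Φ r 𝒯₁ c w * syn Φ r 𝒯₂ b w)
        (ENNReal.ofReal (crit d k)) (volume.restrict (reg d k r K β)) ≤
      eLpNorm (fun w => syn Φ r (𝒯₁.filter fun T => Near β (bs₁ T)) c w *
          syn Φ r (𝒯₂.filter fun T => Near β (bs₂ T)) b w)
        (ENNReal.ofReal (crit d k)) (volume.restrict (reg d k r K β)) +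
      ENNReal.ofReal (C * D ^ (2 * d + 2 * (3 * d + k)) * (nrm 𝒯₁ c * nrm 𝒯₂ b)) := by
  obtain ⟨C, hC, H⟩ := exists_nonlocal_le hk hkd hΦ B κ hB hκ N
  refine ⟨2 * C, by linarith, ?_⟩
  intro a₀ b₀ ρ htr htr' ha hb r D K hD hr hK hN 𝒯₁ 𝒯₂ h𝒯₁ h𝒯₂ c b
  have hD2 : 1 ≤ D ^ 2 := one_le_pow₀ hD
  have hr' : C * D ^ 2 ≤ r := by nlinarith
  have hr0 : 0 < r := by nlinarith
  obtain ⟨bs₁, h₁⟩ := H a₀ b₀ ρ htr ha hb r D K hD hr' hK hN 𝒯₁ 𝒯₂ h𝒯₁ h𝒯₂ b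
  obtain ⟨bs₂, h₂⟩ := H b₀ a₀ ρ htr' hb ha r D K hD hr' hK hN 𝒯₂ 𝒯₁ h𝒯₂ h𝒯₁ c
  refine ⟨bs₁, bs₂, fun β => ?_⟩
  set P := 2 * d + 2 * (3 * d + k)
  set μ := volume.restrict (reg d k r K β)
  set F := syn Φ r 𝒯₁ c with hF
  set G := syn Φ r 𝒯₂ b with hG
  set F₁ := syn Φ r (𝒯₁.filter fun T => Near β (bs₁ T)) c with hF₁
  set F₂ := syn Φ r (𝒯₁.filter fun T => ¬ Near β (bs₁ T)) c with hF₂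
  set G₁ := syn Φ r (𝒯₂.filter fun T => Near β (bs₂ T)) b with hG₁
  set G₂ := syn Φ r (𝒯₂.filter fun T => ¬ Near β (bs₂ T)) b with hG₂
  have hc : ∀ 𝒯 z, Continuous (syn Φ r 𝒯 z) := continuous_syn hΦ.continuous hr0
  have eF : ∀ w, F₁ w + F₂ w = F w := syn_filter_add Φ r _ _ _
  have eG : ∀ w, G₁ w + G₂ w = G w := syn_filter_add Φ r _ _ _
  have e : (fun w => F w * G w) = (fun w => F₁ w * G₁ w) + ((fun w => F₂ w * G w) +
      fun w => G₂ w * F₁ w) := by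
    funext w
    simp only [Pi.add_apply]
    rw [← eF, ← eG]
    ring
  have hm : ∀ {u v : (Fin d → ℝ) × (Fin k → ℝ) → ℂ}, Continuous u → Continuous v →
      AEStronglyMeasurable (fun w => u w * v w) μ := fun hu hv => (hu.mul hv).aestronglyMeasurable
  have hp := one_le_ofReal_crit (d := d) hk
  have t1 := h₁ β c b fun T => le_rfl
  have hF₁' : F₁ = syn Φ r 𝒯₁ fun T => if Near β (bs₁ T) then c T else 0 := by
    funext w
    rw [hF₁, syn, syn, Finset.sum_filter]
    refine Finset.sum_congr rfl fun T _ => ?_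
    split_ifs <;> simp
  have t2 := h₂ β b (fun T => if Near β (bs₁ T) then c T else 0) fun T => by
    split_ifs <;> simp
  rw [← hF₁'] at t2
  rw [e]
  have hn₁ := nrm_nonneg 𝒯₁ c
  have hn₂ := nrm_nonneg 𝒯₂ b
  calc _ ≤ eLpNorm (fun w => F₁ w * G₁ w) (ENNReal.ofReal (crit d k)) μ +
        eLpNorm ((fun w => F₂ w * G w) + fun w => G₂ w * F₁ w) (ENNReal.ofReal (crit d k)) μ :=
        eLpNorm_add_le (hm (hc _ _) (hc _ _)) ((hm (hc _ _) (hc _ _)).add (hm (hc _ _) (hc _ _))) hp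
    _ ≤ eLpNorm (fun w => F₁ w * G₁ w) (ENNReal.ofReal (crit d k)) μ +
        (ENNReal.ofReal (C * D ^ P * (nrm 𝒯₁ c * nrm 𝒯₂ b)) +
          ENNReal.ofReal (C * D ^ P * (nrm 𝒯₂ b * nrm 𝒯₁ c))) := by
        gcongr
        exact (eLpNorm_add_le (hm (hc _ _) (hc _ _)) (hm (hc _ _) (hc _ _)) hp).trans
          (add_le_add t1 t2)
    _ = _ := by
        rw [← ENNReal.ofReal_add (by positivity) (by positivity)]
        congr 2
        ring

lemma eLpNorm_restrict_biUnion_le {α ι : Type*} [MeasurableSpace α] (μ : Measure α) {p : ℝ}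
    (hp : 1 ≤ p) (s : Finset ι) (t : ι → Set α) (f : α → ℂ) :
    eLpNorm f (ENNReal.ofReal p) (μ.restrict (⋃ i ∈ s, t i)) ≤
      ∑ i ∈ s, eLpNorm f (ENNReal.ofReal p) (μ.restrict (t i)) := by
  classical
  have hp0 : ENNReal.ofReal p ≠ 0 := by simp; linarith
  induction s using Finset.induction_on with
  | empty => simp
  | insert a s ha ih =>
    rw [Finset.set_biUnion_insert, Finset.sum_insert ha]
    refine le_trans ?_ (add_le_add le_rfl ih)
    simp only [eLpNorm_eq_lintegral_rpow_enorm_toReal hp0 ENNReal.ofReal_ne_top]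
    rw [ENNReal.toReal_ofReal (by linarith)]
    refine le_trans ?_ (ENNReal.rpow_add_le_add_rpow _ _ (by positivity) ?_)
    · gcongr
      exact lintegral_union_le _ _ _
    · rw [div_le_one (by linarith)]
      exact hp

open scoped Classical in
lemma card_near_le (S : Finset ((Fin d → ℤ) × (Fin k → ℤ))) (x : (Fin d → ℤ) × (Fin k → ℤ)) :
    (S.filter fun β => Near β x).card ≤ 3 ^ (d + k) := by
  have hsub : (S.filter fun β => Near β x) ⊆
      (Fintype.piFinset fun i => Finset.Icc (x.1 i - 1) (x.1 i + 1)) ×ˢ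
        Fintype.piFinset fun j => Finset.Icc (x.2 j - 1) (x.2 j + 1) := by
    intro β hβ
    obtain ⟨h1, h2⟩ := (Finset.mem_filter.1 hβ).2
    simp only [Finset.mem_product, Fintype.mem_piFinset, Finset.mem_Icc]
    refine ⟨fun i => ?_, fun j => ?_⟩
    · have := abs_le.1 (h1 i)
      constructor <;> linarith
    · have := abs_le.1 (h2 j)
      constructor <;> linarith
  refine (Finset.card_le_card hsub).trans (le_of_eq ?_)
  have h3 : ∀ z : ℤ, (Finset.Icc (z - 1) (z + 1)).card = 3 := fun z => by
    rw [Int.card_Icc]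
    lia
  rw [Finset.card_product, Fintype.card_piFinset, Fintype.card_piFinset]
  simp [h3, pow_add]

open scoped Classical in
lemma sum_nrm_sq_near_le (S : Finset ((Fin d → ℤ) × (Fin k → ℤ)))
    (𝒯 : Finset ((Fin d → ℤ) × (Fin d → ℤ))) (bs : (Fin d → ℤ) × (Fin d → ℤ) → (Fin d → ℤ) × (Fin k → ℤ))
    (c : (Fin d → ℤ) × (Fin d → ℤ) → ℂ) :
    ∑ β ∈ S, nrm (𝒯.filter fun T => Near β (bs T)) c ^ 2 ≤ 3 ^ (d + k) * nrm 𝒯 c ^ 2 := by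
  simp only [nrm_sq, Finset.sum_filter]
  rw [Finset.sum_comm, Finset.mul_sum]
  refine Finset.sum_le_sum fun T _ => ?_
  rw [← Finset.sum_filter, Finset.sum_const, nsmul_eq_mul]
  gcongr
  exact_mod_cast card_near_le S (bs T)

open scoped Classical in
lemma sum_nrm_mul_nrm_near_le (S : Finset ((Fin d → ℤ) × (Fin k → ℤ)))
    (𝒯₁ 𝒯₂ : Finset ((Fin d → ℤ) × (Fin d → ℤ)))
    (bs₁ bs₂ : (Fin d → ℤ) × (Fin d → ℤ) → (Fin d → ℤ) × (Fin k → ℤ))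
    (c b : (Fin d → ℤ) × (Fin d → ℤ) → ℂ) :
    ∑ β ∈ S, nrm (𝒯₁.filter fun T => Near β (bs₁ T)) c * nrm (𝒯₂.filter fun T => Near β (bs₂ T)) b ≤
      3 ^ (d + k) * (nrm 𝒯₁ c * nrm 𝒯₂ b) := by
  have h := Finset.sum_mul_sq_le_sq_mul_sq S (fun β => nrm (𝒯₁.filter fun T => Near β (bs₁ T)) c)
    fun β => nrm (𝒯₂.filter fun T => Near β (bs₂ T)) b
  have h1 := nrm_nonneg 𝒯₁ c
  have h2 := nrm_nonneg 𝒯₂ b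
  refine le_of_sq_le_sq (h.trans ?_) (by positivity)
  calc _ ≤ (3 ^ (d + k) * nrm 𝒯₁ c ^ 2) * (3 ^ (d + k) * nrm 𝒯₂ b ^ 2) :=
        mul_le_mul (sum_nrm_sq_near_le S 𝒯₁ bs₁ c) (sum_nrm_sq_near_le S 𝒯₂ bs₂ b) (by positivity)
          (by positivity)
    _ = _ := by ring

/-- The blocks meeting `cubeQ (r²) 0`. -/
def blks (d k : ℕ) (r : ℝ) (K : ℕ) : Finset ((Fin d → ℤ) × (Fin k → ℤ)) :=
  open scoped Classical in (cells d k r).image (blk K)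

lemma cubeQ_subset_reg {r : ℝ} (hr : 0 < r) (K : ℕ) :
    cubeQ d k (r ^ 2) 0 ⊆ ⋃ β ∈ blks d k r K, reg d k r K β := by
  classical
  intro w hw
  obtain ⟨q, hq, hwq⟩ := exists_cell hr hw
  simp only [Set.mem_iUnion, reg]
  exact ⟨blk K q, Finset.mem_image_of_mem _ hq, q, Finset.mem_filter.2 ⟨hq, rfl⟩, hwq⟩

lemma abs_ediv_le {K : ℕ} {D r : ℝ} (hr : 6 ≤ r) (hD : 1 ≤ D) (hK : r ≤ K * D) {x : ℤ}
    (hx : |(x : ℝ)| ≤ r / 2 + 2) : |((x / (K : ℤ) : ℤ) : ℝ)| ≤ 2 * D := by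
  have hK0 : (0 : ℝ) < K := by
    by_contra h
    nlinarith [show (0 : ℝ) ≤ K by positivity]
  have hK' : (0 : ℤ) < K := by exact_mod_cast hK0
  have h1 : ((K : ℤ) : ℝ) * ((x / (K : ℤ) : ℤ) : ℝ) + ((x % (K : ℤ) : ℤ) : ℝ) = x := by
    exact_mod_cast Int.mul_ediv_add_emod x K
  have h2 : (0 : ℝ) ≤ ((x % (K : ℤ) : ℤ) : ℝ) := by exact_mod_cast Int.emod_nonneg x hK'.ne'
  have h3 : ((x % (K : ℤ) : ℤ) : ℝ) < ((K : ℤ) : ℝ) := by exact_mod_cast Int.emod_lt_of_pos x hK'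
  rw [Int.cast_natCast] at h1 h3
  set y := ((x / (K : ℤ) : ℤ) : ℝ)
  rw [abs_le] at hx ⊢
  constructor
  · by_contra h
    nlinarith
  · by_contra h
    nlinarith

lemma card_blks_le {K : ℕ} {D r : ℝ} (hr : 6 ≤ r) (hD : 1 ≤ D) (hK : r ≤ K * D) :
    ((blks d k r K).card : ℝ) ≤ (5 * D) ^ (d + k) := by
  classical
  have hsub : blks d k r K ⊆ (Fintype.piFinset fun _ => Finset.Icc (-⌊2 * D⌋) ⌊2 * D⌋) ×ˢ
      Fintype.piFinset fun _ => Finset.Icc (-⌊2 * D⌋) ⌊2 * D⌋ := by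
    intro β hβ
    obtain ⟨q, hq, rfl⟩ := Finset.mem_image.1 hβ
    obtain ⟨h1, h2⟩ := abs_le_of_mem_cells hq
    have key : ∀ x : ℤ, |(x : ℝ)| ≤ r / 2 + 2 →
        -⌊2 * D⌋ ≤ x / (K : ℤ) ∧ x / (K : ℤ) ≤ ⌊2 * D⌋ := by
      intro x hx
      have h := abs_ediv_le hr hD hK hx
      rw [← abs_le, Int.le_floor]
      exact_mod_cast h
    simp only [Finset.mem_product, Fintype.mem_piFinset, Finset.mem_Icc, blk]
    exact ⟨fun i => key _ (h1 i), fun j => key _ (h2 j)⟩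
  have h : ((Finset.Icc (-⌊2 * D⌋) ⌊2 * D⌋).card : ℝ) ≤ 5 * D := by
    have h0 : (0 : ℤ) ≤ ⌊2 * D⌋ := Int.floor_nonneg.2 (by linarith)
    have hc := Int.floor_le (2 * D)
    rw [Int.card_Icc]
    have : (((⌊2 * D⌋ + 1 - -⌊2 * D⌋).toNat : ℤ) : ℝ) ≤ 5 * D := by
      rw [Int.toNat_of_nonneg (by linarith)]
      push_cast
      linarith
    exact_mod_cast this
  refine (Nat.cast_le.2 (Finset.card_le_card hsub)).trans ?_
  rw [Finset.card_product, Fintype.card_piFinset_const, Fintype.card_piFinset_const, pow_add]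
  push_cast
  gcongr

lemma reg_subset_block {r : ℝ} (hr : 0 < r) {K : ℕ} (hK : 0 < K) (β : (Fin d → ℤ) × (Fin k → ℤ)) :
    reg d k r K β ⊆ cubeQ d k (K * r) (ctr (K * r) β) := by
  have hK' : (0 : ℤ) < K := by exact_mod_cast hK
  have key : ∀ (x : ℤ) (y : ℝ), |y - r * (x + 1 / 2)| ≤ r / 2 →
      |y - K * r * ((x / (K : ℤ) : ℤ) + 1 / 2)| ≤ K * r / 2 := by
    intro x y hy
    have h1 : (K : ℝ) * ((x / (K : ℤ) : ℤ) : ℝ) + ((x % (K : ℤ) : ℤ) : ℝ) = x := by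
      exact_mod_cast Int.mul_ediv_add_emod x K
    have h2 : (0 : ℝ) ≤ ((x % (K : ℤ) : ℤ) : ℝ) := by exact_mod_cast Int.emod_nonneg x hK'.ne'
    have h3 : ((x % (K : ℤ) : ℤ) : ℝ) + 1 ≤ K := by
      exact_mod_cast Int.add_one_le_of_lt (Int.emod_lt_of_pos x hK')
    set z := ((x / (K : ℤ) : ℤ) : ℝ)
    set e := ((x % (K : ℤ) : ℤ) : ℝ)
    rw [← h1] at hy
    have h4 : 0 ≤ r * e := by positivity
    have h5 : r * (e + 1) ≤ r * K := by gcongr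
    rw [abs_le] at hy ⊢
    constructor <;> linarith
  intro w hw
  simp only [reg, Set.mem_iUnion, Finset.mem_filter] at hw
  obtain ⟨q, ⟨-, rfl⟩, h1, h2⟩ := hw
  exact ⟨fun i => key _ _ (h1 i), fun j => key _ _ (h2 j)⟩

lemma eLpNorm_two_sq {α : Type*} [MeasurableSpace α] (μ : Measure α) (f : α → ℂ) :
    eLpNorm f 2 μ ^ 2 = ∫⁻ x, ‖f x‖ₑ ^ 2 ∂μ := by
  have := eLpNorm_nnreal_pow_eq_lintegral (f := f) (μ := μ) (p := 2) (by norm_num)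
  simpa using this

lemma eLpNorm_synf_le {r : ℝ} (hr : 0 < r) (𝒯 : Finset ((Fin d → ℤ) × (Fin d → ℤ)))
    (c : (Fin d → ℤ) × (Fin d → ℤ) → ℂ) :
    eLpNorm (synf r 𝒯 c) 2 volume ≤ ENNReal.ofReal (3 ^ d * nrm 𝒯 c) := by
  have h0 := nrm_nonneg 𝒯 c
  rw [← ENNReal.pow_le_pow_left_iff two_ne_zero, eLpNorm_two_sq, ← ENNReal.ofReal_pow (by positivity)]
  have h := ofReal_integral_eq_lintegral_ofReal (integrable_norm_sq_synf hr 𝒯 c)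
    (Filter.Eventually.of_forall fun ξ => by positivity)
  have e : ∀ ξ, ENNReal.ofReal (‖synf r 𝒯 c ξ‖ ^ 2) = ‖synf r 𝒯 c ξ‖ₑ ^ 2 := fun ξ => by
    rw [ENNReal.ofReal_pow (norm_nonneg _), ofReal_norm]
  simp only [e] at h
  rw [← h]
  refine ENNReal.ofReal_le_ofReal ((integral_norm_sq_synf_le hr 𝒯 c).trans ?_)
  rw [← nrm_sq, mul_pow]
  gcongr
  exact le_self_pow₀ (one_le_pow₀ (by norm_num)) two_ne_zero

lemma memLp_synf {r : ℝ} (hr : 0 < r) (𝒯 : Finset ((Fin d → ℤ) × (Fin d → ℤ)))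
    (c : (Fin d → ℤ) × (Fin d → ℤ) → ℂ) : MemLp (synf r 𝒯 c) 2 volume :=
  ⟨(contDiff_synf r 𝒯 c).continuous.aestronglyMeasurable,
    (eLpNorm_synf_le hr 𝒯 c).trans_lt ENNReal.ofReal_lt_top⟩

lemma synf_eq_zero {r s : ℝ} (hr : 0 < r) {𝒯 : Finset ((Fin d → ℤ) × (Fin d → ℤ))} {a₀ : Fin d → ℝ}
    (h : ∀ T ∈ 𝒯, ‖frq r T.1 - a₀‖ + (2 * r)⁻¹ ≤ s) (c : (Fin d → ℤ) × (Fin d → ℤ) → ℂ)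
    {ξ : Fin d → ℝ} (hξ : s < ‖ξ - a₀‖) : synf r 𝒯 c ξ = 0 := by
  refine Finset.sum_eq_zero fun T hT => ?_
  rw [pk_eq_zero hr, mul_zero]
  have h1 := h T hT
  have h2 : ‖ξ - a₀‖ ≤ ‖ξ - frq r T.1‖ + ‖frq r T.1 - a₀‖ := norm_sub_le_norm_sub_add_norm_sub _ _ _
  have h3 : (2 * r)⁻¹ ≤ ‖ξ - frq r T.1‖ := by linarith
  calc (1 : ℝ) / 2 = r * (2 * r)⁻¹ := by field_simp
    _ ≤ _ := by gcongr

/-- The bilinear extension estimate with loss `R ^ α` for functions supported within `s` of `a₀`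
and `b₀`. -/
def Bil (Φ : (Fin d → ℝ) → Fin k → ℝ) (a₀ b₀ : Fin d → ℝ) (s A α : ℝ) : Prop :=
  ∀ R : ℝ, 1 ≤ R → ∀ (w₀ : (Fin d → ℝ) × (Fin k → ℝ)) (f g : (Fin d → ℝ) → ℂ),
    MemLp f 2 → MemLp g 2 → (∀ ξ, s < ‖ξ - a₀‖ → f ξ = 0) → (∀ ξ, s < ‖ξ - b₀‖ → g ξ = 0) →
    eLpNorm (fun w => extn Φ f w * extn Φ g w) (ENNReal.ofReal (crit d k))
      (volume.restrict (cubeQ d k R w₀)) ≤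
      ENNReal.ofReal (A * R ^ α) * eLpNorm f 2 volume * eLpNorm g 2 volume

open scoped Classical in
/-- The packet form of the induction step. -/
lemma exists_syn_step (hk : 1 ≤ k) (hkd : k ≤ d) {Φ : (Fin d → ℝ) → Fin k → ℝ}
    (hΦ : ContDiff ℝ (⊤ : ℕ∞) Φ) (B κ : ℝ) (hB : 0 ≤ B) (hκ : 0 < κ) (N : ℕ) :
    ∃ C : ℝ, 6 ≤ C ∧ ∀ a₀ b₀ : Fin d → ℝ, ∀ ρ : ℝ, Transversal Φ κ ρ a₀ b₀ →
      Transversal Φ κ ρ b₀ a₀ →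
      ‖a₀‖ + ρ ≤ B → ‖b₀‖ + ρ ≤ B → ∀ (r D : ℝ) (K : ℕ), 1 ≤ D → C * D ^ 2 ≤ r → r ≤ K * D →
      r ^ (4 * (d + k)) ≤ D ^ N →
      ∀ s A α, s ≤ ρ → 0 ≤ A → Bil Φ a₀ b₀ s A α →
      ∀ 𝒯₁ 𝒯₂ : Finset ((Fin d → ℤ) × (Fin d → ℤ)),
      (∀ T ∈ 𝒯₁, ‖frq r T.1 - a₀‖ + (2 * r)⁻¹ ≤ s) → (∀ T ∈ 𝒯₂, ‖frq r T.1 - b₀‖ + (2 * r)⁻¹ ≤ s) →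
      ∀ c b : (Fin d → ℤ) × (Fin d → ℤ) → ℂ,
      eLpNorm (fun w => syn Φ r 𝒯₁ c w * syn Φ r 𝒯₂ b w)
        (ENNReal.ofReal (crit d k)) (volume.restrict (cubeQ d k (r ^ 2) 0)) ≤
      ENNReal.ofReal (C * (A * (K * r) ^ α + D ^ (9 * d + 3 * k)) * (nrm 𝒯₁ c * nrm 𝒯₂ b)) := by
  obtain ⟨C, hC, H⟩ := exists_local_add_le hk hkd hΦ B κ hB hκ N
  have hx1 : (1 : ℝ) ≤ 3 ^ d * 3 ^ d * 3 ^ (d + k) :=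
    one_le_mul_of_one_le_of_one_le (one_le_mul_of_one_le_of_one_le (one_le_pow₀ (by norm_num))
      (one_le_pow₀ (by norm_num))) (one_le_pow₀ (by norm_num))
  have hx2 : (1 : ℝ) ≤ 5 ^ (d + k) := one_le_pow₀ (by norm_num)
  refine ⟨3 ^ d * 3 ^ d * 3 ^ (d + k) + C * 5 ^ (d + k), by nlinarith, ?_⟩
  intro a₀ b₀ ρ htr htr' ha hb r D K hD hr hK hN s A α hs hA hBil 𝒯₁ 𝒯₂ h𝒯₁ h𝒯₂ c b
  have hD2 : 1 ≤ D ^ 2 := one_le_pow₀ hD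
  have hr' : C * D ^ 2 ≤ r := le_trans (by gcongr; nlinarith) hr
  have hr6 : 6 ≤ r := by nlinarith
  have hr0 : 0 < r := by linarith
  have hr2 : 0 ≤ (2 * r)⁻¹ := by positivity
  have hK0 : (0 : ℝ) < K := by
    by_contra h
    nlinarith [show (0 : ℝ) ≤ K by positivity]
  have hK0' : 0 < K := by exact_mod_cast hK0
  obtain ⟨bs₁, bs₂, h⟩ := H a₀ b₀ ρ htr htr' ha hb r D K hD hr' hK hN 𝒯₁ 𝒯₂
    (fun T hT => by linarith [h𝒯₁ T hT]) (fun T hT => by linarith [h𝒯₂ T hT]) c b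
  have hp := one_le_crit (d := d) hk
  have hn₁ := nrm_nonneg 𝒯₁ c
  have hn₂ := nrm_nonneg 𝒯₂ b
  set P := 2 * d + 2 * (3 * d + k) with hP
  set L := A * (K * r) ^ α with hL
  have hL0 : 0 ≤ L := by positivity
  have loc : ∀ β, eLpNorm (fun w => syn Φ r (𝒯₁.filter fun T => Near β (bs₁ T)) c w *
          syn Φ r (𝒯₂.filter fun T => Near β (bs₂ T)) b w)
        (ENNReal.ofReal (crit d k)) (volume.restrict (reg d k r K β)) ≤
      ENNReal.ofReal (L * 3 ^ d * 3 ^ d * (nrm (𝒯₁.filter fun T => Near β (bs₁ T)) c *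
        nrm (𝒯₂.filter fun T => Near β (bs₂ T)) b)) := by
    intro β
    set 𝒮₁ := 𝒯₁.filter fun T => Near β (bs₁ T)
    set 𝒮₂ := 𝒯₂.filter fun T => Near β (bs₂ T)
    refine (eLpNorm_mono_measure _ (Measure.restrict_mono (reg_subset_block hr0 hK0' β) le_rfl)).trans ?_
    have hB := hBil (K * r) (by nlinarith) (ctr (K * r) β) (synf r 𝒮₁ c) (synf r 𝒮₂ b)
      (memLp_synf hr0 _ _) (memLp_synf hr0 _ _)
      (fun ξ => synf_eq_zero hr0 (fun T hT => h𝒯₁ T (Finset.mem_filter.1 hT).1) c)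
      (fun ξ => synf_eq_zero hr0 (fun T hT => h𝒯₂ T (Finset.mem_filter.1 hT).1) b)
    simp only [extn_synf hΦ.continuous hr0] at hB
    refine hB.trans ?_
    have m₁ := nrm_nonneg 𝒮₁ c
    have m₂ := nrm_nonneg 𝒮₂ b
    calc _ ≤ ENNReal.ofReal L * ENNReal.ofReal (3 ^ d * nrm 𝒮₁ c) *
          ENNReal.ofReal (3 ^ d * nrm 𝒮₂ b) := by
          gcongr
          · exact eLpNorm_synf_le hr0 _ _
          · exact eLpNorm_synf_le hr0 _ _
      _ = _ := by
          rw [← ENNReal.ofReal_mul hL0, ← ENNReal.ofReal_mul (by positivity)]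
          congr 1
          ring
  calc _ ≤ ∑ β ∈ blks d k r K, eLpNorm (fun w => syn Φ r 𝒯₁ c w * syn Φ r 𝒯₂ b w)
        (ENNReal.ofReal (crit d k)) (volume.restrict (reg d k r K β)) :=
        (eLpNorm_mono_measure _ (Measure.restrict_mono (cubeQ_subset_reg hr0 K) le_rfl)).trans
          (eLpNorm_restrict_biUnion_le _ hp _ _ _)
    _ ≤ ∑ β ∈ blks d k r K, ENNReal.ofReal (L * 3 ^ d * 3 ^ d *
          (nrm (𝒯₁.filter fun T => Near β (bs₁ T)) c * nrm (𝒯₂.filter fun T => Near β (bs₂ T)) b) +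
          C * D ^ P * (nrm 𝒯₁ c * nrm 𝒯₂ b)) := by
        refine Finset.sum_le_sum fun β _ => (h β).trans ?_
        have m₁ := nrm_nonneg (𝒯₁.filter fun T => Near β (bs₁ T)) c
        have m₂ := nrm_nonneg (𝒯₂.filter fun T => Near β (bs₂ T)) b
        rw [ENNReal.ofReal_add (by positivity) (by positivity)]
        exact add_le_add (loc β) le_rfl
    _ = ENNReal.ofReal (∑ β ∈ blks d k r K, (L * 3 ^ d * 3 ^ d *
          (nrm (𝒯₁.filter fun T => Near β (bs₁ T)) c * nrm (𝒯₂.filter fun T => Near β (bs₂ T)) b) +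
          C * D ^ P * (nrm 𝒯₁ c * nrm 𝒯₂ b))) := by
        rw [ENNReal.ofReal_sum_of_nonneg]
        intro β _
        have m₁ := nrm_nonneg (𝒯₁.filter fun T => Near β (bs₁ T)) c
        have m₂ := nrm_nonneg (𝒯₂.filter fun T => Near β (bs₂ T)) b
        positivity
    _ ≤ _ := by
        refine ENNReal.ofReal_le_ofReal ?_
        rw [Finset.sum_add_distrib, ← Finset.mul_sum, Finset.sum_const, nsmul_eq_mul]
        have q1 := mul_le_mul_of_nonneg_left (sum_nrm_mul_nrm_near_le (blks d k r K) 𝒯₁ 𝒯₂ bs₁ bs₂ c b)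
          (show 0 ≤ L * 3 ^ d * 3 ^ d by positivity)
        have q2 : ((blks d k r K).card : ℝ) * (C * D ^ P * (nrm 𝒯₁ c * nrm 𝒯₂ b)) ≤
            (5 * D) ^ (d + k) * (C * D ^ P * (nrm 𝒯₁ c * nrm 𝒯₂ b)) := by
          gcongr
          exact card_blks_le hr6 hD hK
        have q3 : (5 * D) ^ (d + k) * (C * D ^ P * (nrm 𝒯₁ c * nrm 𝒯₂ b)) =
            C * 5 ^ (d + k) * D ^ (9 * d + 3 * k) * (nrm 𝒯₁ c * nrm 𝒯₂ b) := by
          rw [mul_pow, show 9 * d + 3 * k = (d + k) + P by lia, pow_add D]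
          ring
        have q4 : 0 ≤ 3 ^ d * 3 ^ d * 3 ^ (d + k) * D ^ (9 * d + 3 * k) * (nrm 𝒯₁ c * nrm 𝒯₂ b) := by
          positivity
        have q5 : 0 ≤ C * 5 ^ (d + k) * L * (nrm 𝒯₁ c * nrm 𝒯₂ b) := by positivity
        nlinarith

lemma mFourier_coe (m : Fin d → ℤ) (v : Fin d → ℝ) :
    UnitAddTorus.mFourier m (fun i => (v i : UnitAddCircle)) = ex (rl m ⬝ᵥ v) := by
  have h1 : ex (rl m ⬝ᵥ v) = ∏ i, ex (m i * v i) := ex_sum _ _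
  rw [h1, UnitAddTorus.mFourier, ContinuousMap.coe_mk]
  refine Finset.prod_congr rfl fun i _ => ?_
  rw [fourier_coe_apply]
  unfold ex
  congr 1
  push_cast
  ring

lemma unitBox_eq : unitBox d = {x | ∀ i, x i ∈ Set.Ioc (-(1 / 2) : ℝ) (-(1 / 2) + 1)} := by
  ext x
  simp only [unitBox, Set.mem_univ_pi, Set.mem_ofPred_eq]
  norm_num

/-- Every square integrable function on the unit cube is approximated by a partial sum of its
Fourier series, whose coefficients satisfy Bessel's inequality. -/
lemma exists_trig_approx {h : (Fin d → ℝ) → ℂ} (hh : MemLp h 2 (volume.restrict (unitBox d)))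
    {ε : ℝ} (hε : 0 < ε) :
    ∃ (s : Finset (Fin d → ℤ)) (c : (Fin d → ℤ) → ℂ),
      ∑ m ∈ s, ‖c m‖ ^ 2 ≤ ∫ v in unitBox d, ‖h v‖ ^ 2 ∧
      eLpNorm (fun v => h v - ∑ m ∈ s, c m * ex (rl m ⬝ᵥ v)) 2 (volume.restrict (unitBox d)) ≤
        ENNReal.ofReal ε := by
  let : MeasureSpace UnitAddCircle := ⟨AddCircle.haarAddCircle⟩
  set a : Fin d → ℝ := fun _ => -(1 / 2)
  set π : (Fin d → ℝ) → UnitAddTorus (Fin d) := fun v i => (v i : UnitAddCircle)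
  have hbox : {x : Fin d → ℝ | ∀ i, x i ∈ Set.Ioc (a i) (a i + 1)} = unitBox d := unitBox_eq.symm
  have hmeas : MeasurableSet {x : Fin d → ℝ | ∀ i, x i ∈ Set.Ioc (a i) (a i + 1)} :=
    MeasurableSet.univ_pi' (fun i => measurableSet_Ioc)
  have hpre := UnitAddTorus.measurePreserving_equivPiIoc a
  set e := UnitAddTorus.measurableEquivPiIoc a
  set H : UnitAddTorus (Fin d) → ℂ := fun x => h (e x).1
  have hHπ : ∀ v ∈ unitBox d, H (π v) = h v := by
    intro v hv
    rw [← hbox] at hv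
    have : e (π v) = ⟨v, hv⟩ := by
      rw [← MeasurableEquiv.eq_symm_apply]
      rfl
    simp only [H, this]
  have hsub : MemLp (fun y : {x : Fin d → ℝ // ∀ i, x i ∈ Set.Ioc (a i) (a i + 1)} => h y.1) 2
      (Measure.comap Subtype.val volume) := by
    have h1 := (MeasurableEmbedding.subtype_coe hmeas).memLp_map_measure_iff (g := h) (p := 2)
      (μ := Measure.comap Subtype.val volume)
    rw [map_comap_subtype_coe hmeas] at h1
    rw [← hbox] at hh
    exact h1.1 hh
  have hHm : MemLp H 2 := hsub.comp_measurePreserving hpre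
  set F := hHm.toLp H
  have hF : F =ᵐ[volume] H := hHm.coeFn_toLp
  have hsum := UnitAddTorus.hasSum_mFourier_series_L2 F
  have hsq := UnitAddTorus.hasSum_sq_mFourierCoeff F
  obtain ⟨s, hs⟩ := (hsum.eventually (Metric.ball_mem_nhds F hε)).exists
  refine ⟨s, UnitAddTorus.mFourierCoeff F, ?_, ?_⟩
  · refine (sum_le_hasSum s (fun _ _ => by positivity) hsq).trans (le_of_eq ?_)
    have h1 : ∫ t, ‖F t‖ ^ 2 = ∫ t, ‖H t‖ ^ 2 := by
      refine integral_congr_ae ?_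
      filter_upwards [hF] with x hx
      rw [hx]
    rw [h1, UnitAddTorus.integral_preimage _ a, hbox]
    refine setIntegral_congr_fun (by rw [← hbox]; exact hmeas) fun v hv => ?_
    rw [← hHπ v hv]
  · set c := UnitAddTorus.mFourierCoeff F
    replace hs : ‖F - ∑ m ∈ s, c m • UnitAddTorus.mFourierLp 2 m‖ < ε := by
      rw [← dist_eq_norm, dist_comm]
      exact hs
    rw [Lp.norm_def] at hs
    have hG : ((F - ∑ m ∈ s, c m • UnitAddTorus.mFourierLp 2 m :
        Lp ℂ 2 (volume : Measure (UnitAddTorus (Fin d)))) : UnitAddTorus (Fin d) → ℂ) =ᵐ[volume]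
        fun x => H x - ∑ m ∈ s, c m * UnitAddTorus.mFourier m x := by
      have h1 : ∀ m ∈ s, ∀ᵐ x ∂(volume : Measure (UnitAddTorus (Fin d))),
          (c m • UnitAddTorus.mFourierLp 2 m : Lp ℂ 2 (volume : Measure (UnitAddTorus (Fin d)))) x
            = c m * UnitAddTorus.mFourier m x := by
        intro m _
        filter_upwards [Lp.coeFn_smul (c m) (UnitAddTorus.mFourierLp 2 m),
          UnitAddTorus.coeFn_mFourierLp 2 m] with x h2 h3
        rw [h2, Pi.smul_apply, h3, smul_eq_mul]
      have h4 := (Finset.eventually_all s).2 h1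
      filter_upwards [Lp.coeFn_sub F (∑ m ∈ s, c m • UnitAddTorus.mFourierLp 2 m), hF, h4,
        Lp.coeFn_finsetSum s fun m => c m • UnitAddTorus.mFourierLp 2 m] with x h5 h6 h7 h8
      rw [h5, Pi.sub_apply, h6, h8]
      exact congrArg (H x - ·) ((Finset.sum_apply x s _).trans (Finset.sum_congr rfl h7))
    rw [eLpNorm_congr_ae hG] at hs
    set G : UnitAddTorus (Fin d) → ℂ := fun x => H x - ∑ m ∈ s, c m * UnitAddTorus.mFourier m x
    have hfin : eLpNorm G 2 volume ≠ ⊤ := by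
      rw [← eLpNorm_congr_ae hG]
      exact Lp.eLpNorm_ne_top _
    have hle : eLpNorm G 2 volume ≤ ENNReal.ofReal ε :=
      (ENNReal.le_ofReal_iff_toReal_le hfin hε.le).2 hs.le
    refine le_trans (le_of_eq ?_) hle
    have h9 : ∀ x y : ℝ≥0∞, x ^ 2 = y ^ 2 → x = y := fun x y hxy =>
      le_antisymm ((ENNReal.pow_le_pow_left_iff two_ne_zero).1 hxy.le)
        ((ENNReal.pow_le_pow_left_iff two_ne_zero).1 hxy.ge)
    refine h9 _ _ ?_
    rw [eLpNorm_two_sq, eLpNorm_two_sq, UnitAddTorus.lintegral_preimage _ a, hbox]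
    refine setLIntegral_congr_fun (by rw [← hbox]; exact hmeas) fun v hv => ?_
    rw [← hHπ v hv]
    simp only [G, ← mFourier_coe]
    rfl

lemma integral_rescale_real {r : ℝ} (hr : 0 < r) (ν : Fin d → ℝ) (h : (Fin d → ℝ) → ℝ) :
    ∫ ξ, h ξ = (r ^ d)⁻¹ * ∫ v, h (ν + r⁻¹ • v) := by
  have h1 := integral_rescale hr ν fun ξ => (h ξ : ℂ)
  rw [integral_complex_ofReal, integral_complex_ofReal, Complex.real_smul] at h1
  exact_mod_cast h1

/-- The half-open cell of side `(2 * r)⁻¹` centred at the frequency `frq r n`. -/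
def cell (r : ℝ) (n : Fin d → ℤ) : Set (Fin d → ℝ) :=
  {ξ | ∀ i, scl r n ξ i ∈ Set.Ioc (-(1 / 4) : ℝ) (1 / 4)}

lemma measurable_scl (r : ℝ) (n : Fin d → ℤ) : Measurable (scl r n) := by
  have : Continuous (scl r n) := by
    unfold scl
    fun_prop
  exact this.measurable

lemma measurableSet_cell (r : ℝ) (n : Fin d → ℤ) : MeasurableSet (cell r n) :=
  measurable_scl r n (MeasurableSet.univ_pi' (t := fun _ => Set.Ioc (-(1 / 4) : ℝ) (1 / 4))
    fun _ => measurableSet_Ioc)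

/-- A square integrable function restricted to one cell is approximated by wave packets. -/
lemma exists_cell_approx {r : ℝ} (hr : 0 < r) (n : Fin d → ℤ) {G : (Fin d → ℝ) → ℂ}
    (hG : Integrable G) (hG2 : Integrable fun ξ => ‖G ξ‖ ^ 2) (hG0 : ∀ ξ, ξ ∉ cell r n → G ξ = 0)
    {ε : ℝ} (hε : 0 < ε) :
    ∃ (s : Finset (Fin d → ℤ)) (c : (Fin d → ℤ) → ℂ), ∑ m ∈ s, ‖c m‖ ^ 2 ≤ ∫ ξ, ‖G ξ‖ ^ 2 ∧
      (∫ ξ, ‖G ξ - ∑ m ∈ s, c m * pk r (n, m) ξ‖) ≤ ε := by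
  set q := √(r ^ d)
  have hq : 0 < q := by positivity
  have hq2 : q * q = r ^ d := Real.mul_self_sqrt (by positivity)
  set h : (Fin d → ℝ) → ℂ := fun v => ((q⁻¹ : ℝ) : ℂ) * G (frq r n + r⁻¹ • v)
  have hrn : r⁻¹ ≠ 0 := (inv_pos.2 hr).ne'
  have hi : Integrable h := ((hG.comp_add_left (frq r n)).comp_smul hrn).const_mul _
  have hi2 : Integrable fun v => ‖h v‖ ^ 2 := by
    have h1 := ((hG2.comp_add_left (frq r n)).comp_smul hrn).const_mul (q⁻¹ ^ 2)
    refine h1.congr (ae_of_all _ fun v => ?_)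
    simp only [h, norm_mul, Complex.norm_real, Real.norm_eq_abs, mul_pow, sq_abs]
  have hL : MemLp h 2 (volume.restrict (unitBox d)) :=
    ((memLp_two_iff_integrable_sq_norm hi.aestronglyMeasurable).2 hi2).restrict _
  obtain ⟨s, c, hc, hs⟩ := exists_trig_approx hL (mul_pos hε hq)
  refine ⟨s.map (Equiv.neg _).toEmbedding, fun m => c (-m), ?_, ?_⟩
  · simp only [Finset.sum_map, Equiv.coe_toEmbedding, Equiv.neg_apply, neg_neg]
    refine hc.trans ((setIntegral_le_integral hi2 (ae_of_all _ fun _ => by positivity)).trans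
      (le_of_eq ?_))
    rw [integral_rescale_real hr (frq r n) fun ξ => ‖G ξ‖ ^ 2, ← integral_const_mul]
    refine integral_congr_ae (ae_of_all _ fun v => ?_)
    simp only [h, norm_mul, Complex.norm_real, Real.norm_eq_abs, mul_pow, sq_abs, ← hq2]
    field_simp
  · simp only [Finset.sum_map, Equiv.coe_toEmbedding, Equiv.neg_apply, neg_neg]
    set P : (Fin d → ℝ) → ℂ := fun v => ∑ m ∈ s, c m * ex (rl m ⬝ᵥ v)
    have hPc : Continuous P := by
      refine continuous_finsetSum _ fun m _ => continuous_const.mul (continuous_ex_rl m)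
    have hinteg : IntegrableOn (fun v => ‖h v - P v‖) (unitBox d) :=
      (hi.integrableOn.sub (integrableOn_unitBox hPc)).norm
    have key : ∀ v, ‖G (frq r n + r⁻¹ • v) - ∑ m ∈ s, c m * pk r (n, -m) (frq r n + r⁻¹ • v)‖ ≤
        q * (unitBox d).indicator (fun v => ‖h v - P v‖) v := by
      intro v
      have h1 : ∑ m ∈ s, c m * pk r (n, -m) (frq r n + r⁻¹ • v) =
          ((q * bump d v : ℝ) : ℂ) * P v := by
        rw [Finset.mul_sum]
        refine Finset.sum_congr rfl fun m _ => ?_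
        have h2 : -(rl (-m) ⬝ᵥ v) = rl m ⬝ᵥ v := by
          simp [rl, dotProduct, Finset.sum_neg_distrib]
        simp only [pk, scl_frq_add hr.ne', h2]
        ring
      have h3 : G (frq r n + r⁻¹ • v) = ((q : ℝ) : ℂ) * h v := by
        simp only [h]
        rw [← mul_assoc, ← Complex.ofReal_mul, mul_inv_cancel₀ hq.ne', Complex.ofReal_one, one_mul]
      have h4 : ∀ v, h v ≠ 0 → ‖v‖ ≤ 1 / 4 ∧ v ∈ unitBox d := by
        intro v hv
        by_cases hvc : frq r n + r⁻¹ • v ∈ cell r n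
        · unfold cell at hvc
          rw [Set.mem_ofPred_eq, scl_frq_add hr.ne'] at hvc
          refine ⟨(pi_norm_le_iff_of_nonneg (by norm_num)).2 fun i => ?_, fun i _ => ?_⟩
          · rw [Real.norm_eq_abs, abs_le]
            exact ⟨(hvc i).1.le, (hvc i).2⟩
          · exact ⟨by linarith [(hvc i).1], by linarith [(hvc i).2]⟩
        · exact absurd (by simp only [h, hG0 _ hvc, mul_zero]) hv
      have h5 : h v = (bump d v : ℂ) * h v := by
        by_cases hv : h v = 0
        · rw [hv, mul_zero]
        · rw [bump_eq_one (h4 v hv).1, Complex.ofReal_one, one_mul]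
      by_cases hv : v ∈ unitBox d
      · rw [Set.indicator_of_mem hv, h1, h3, h5, Complex.ofReal_mul, mul_assoc, ← mul_sub, ← mul_sub,
          norm_mul, norm_mul, Complex.norm_real, Complex.norm_real, Real.norm_of_nonneg hq.le]
        refine mul_le_mul_of_nonneg_left ?_ hq.le
        rw [← h5]
        refine mul_le_of_le_one_left (norm_nonneg _) ?_
        rw [Real.norm_of_nonneg (ContDiffBump.nonneg _)]
        exact ContDiffBump.le_one _
      · have h6 : h v = 0 := by
          by_contra hne
          exact hv (h4 v hne).2
        have h7 : (1 / 2 : ℝ) ≤ ‖v‖ := by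
          by_contra hlt
          refine hv fun i _ => ?_
          have h8 := (norm_le_pi_norm v i).trans_lt (not_le.1 hlt)
          rw [Real.norm_eq_abs, abs_lt] at h8
          exact ⟨by linarith [h8.1], h8.2.le⟩
        rw [h1, h3, h6, bump_eq_zero h7]
        simp [Set.indicator_of_notMem hv]
    rw [integral_rescale_real hr (frq r n)]
    have hub : MeasurableSet (unitBox d) := MeasurableSet.univ_pi fun _ => measurableSet_Ioc
    have h9 : ∫ v in unitBox d, ‖h v - P v‖ ≤ ε * q := by
      have hpr : IsProbabilityMeasure (volume.restrict (unitBox d)) :=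
        ⟨by rw [Measure.restrict_apply_univ, volume_unitBox]⟩
      have hm : AEStronglyMeasurable (fun v => h v - P v) (volume.restrict (unitBox d)) :=
        hi.aestronglyMeasurable.restrict.sub hPc.aestronglyMeasurable
      rw [integral_norm_eq_lintegral_enorm hm, ← eLpNorm_one_eq_lintegral_enorm]
      refine ENNReal.toReal_le_of_le_ofReal (by positivity)
        ((eLpNorm_le_eLpNorm_of_exponent_le (by norm_num) hm).trans hs)
    calc (r ^ d)⁻¹ * ∫ v, ‖G (frq r n + r⁻¹ • v) -
          ∑ m ∈ s, c m * pk r (n, -m) (frq r n + r⁻¹ • v)‖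
        ≤ (r ^ d)⁻¹ * ∫ v, q * (unitBox d).indicator (fun v => ‖h v - P v‖) v := by
          refine mul_le_mul_of_nonneg_left ?_ (by positivity)
          exact integral_mono_of_nonneg (ae_of_all _ fun _ => norm_nonneg _)
            ((hinteg.integrable_indicator hub).const_mul q) (ae_of_all _ key)
      _ = (r ^ d)⁻¹ * (q * ∫ v in unitBox d, ‖h v - P v‖) := by
          rw [integral_const_mul, integral_indicator hub]
      _ ≤ (r ^ d)⁻¹ * (q * (ε * q)) := by gcongr
      _ = ε := by
          rw [← hq2]
          field_simp

/-- The label of the cell containing `ξ`. -/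
def lab (r : ℝ) (ξ : Fin d → ℝ) : Fin d → ℤ := fun i => ⌈2 * r * ξ i - 1 / 2⌉

lemma mem_cell_iff {r : ℝ} {n : Fin d → ℤ} {ξ : Fin d → ℝ} : ξ ∈ cell r n ↔ lab r ξ = n := by
  simp only [cell, lab, scl, rl, Set.mem_ofPred_eq, funext_iff, Int.ceil_eq_iff, Set.mem_Ioc,
    Pi.sub_apply, Pi.smul_apply, smul_eq_mul]
  refine forall_congr' fun i => ⟨fun h => ⟨?_, ?_⟩, fun h => ⟨?_, ?_⟩⟩ <;> linarith [h.1, h.2]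

lemma norm_frq_lab_sub_le {r : ℝ} (hr : 0 < r) (ξ : Fin d → ℝ) :
    ‖frq r (lab r ξ) - ξ‖ ≤ (2 * r)⁻¹ := by
  have h1 : ξ ∈ cell r (lab r ξ) := mem_cell_iff.2 rfl
  have h2 : ‖scl r (lab r ξ) ξ‖ ≤ 1 / 4 := by
    refine (pi_norm_le_iff_of_nonneg (by norm_num)).2 fun i => ?_
    rw [Real.norm_eq_abs, abs_le]
    exact ⟨(h1 i).1.le, (h1 i).2⟩
  rw [norm_scl hr, norm_sub_rev] at h2
  rw [mul_inv, ← div_eq_mul_inv, le_div_iff₀ hr]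
  linarith

lemma finite_setOf_norm_frq_sub_le {r : ℝ} (hr : 0 < r) (a : Fin d → ℝ) (s : ℝ) :
    {n : Fin d → ℤ | ‖frq r n - a‖ ≤ s}.Finite := by
  refine Set.Finite.subset (Set.Finite.pi' (t := fun _ : Fin d =>
    (Set.Icc (-⌈2 * r * (s + ‖a‖)⌉) ⌈2 * r * (s + ‖a‖)⌉ : Set ℤ))
    fun _ => Set.finite_Icc _ _) fun n hn i => ?_
  have h1 : ‖frq r n‖ ≤ s + ‖a‖ := by
    have := norm_sub_norm_le (frq r n) a
    rw [Set.mem_ofPred_eq] at hn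
    linarith
  have h2 := (norm_le_pi_norm (frq r n) i).trans h1
  simp only [frq, rl, Pi.smul_apply, smul_eq_mul, Real.norm_eq_abs, abs_mul,
    abs_of_pos (inv_pos.2 (by positivity : 0 < 2 * r))] at h2
  rw [inv_mul_le_iff₀ (by positivity), abs_le] at h2
  have h3 := Int.le_ceil (2 * r * (s + ‖a‖))
  exact ⟨by exact_mod_cast (by linarith [h2.1] : (-(⌈2 * r * (s + ‖a‖)⌉ : ℝ)) ≤ n i),
    by exact_mod_cast (by linarith [h2.2] : (n i : ℝ) ≤ ⌈2 * r * (s + ‖a‖)⌉)⟩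

open Classical in
/-- Every square integrable function with bounded support is approximated in `L¹` by finite sums of
wave packets whose coefficients satisfy Bessel's inequality. -/
lemma exists_synf_approx {r : ℝ} (hr : 0 < r) {a : Fin d → ℝ} {s : ℝ} {f : (Fin d → ℝ) → ℂ}
    (hf : MemLp f 2) (hfs : ∀ ξ, s < ‖ξ - a‖ → f ξ = 0) {ε : ℝ} (hε : 0 < ε) :
    ∃ (𝒯 : Finset ((Fin d → ℤ) × (Fin d → ℤ))) (c : (Fin d → ℤ) × (Fin d → ℤ) → ℂ),
      (∀ T ∈ 𝒯, ‖frq r T.1 - a‖ ≤ s + (2 * r)⁻¹) ∧ nrm 𝒯 c ≤ √(∫ ξ, ‖f ξ‖ ^ 2) ∧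
      (∫ ξ, ‖f ξ - synf r 𝒯 c ξ‖) ≤ ε := by
  have hf2 : Integrable fun ξ => ‖f ξ‖ ^ 2 := hf.integrable_norm_pow two_ne_zero
  have hball : IsCompact (Metric.closedBall a s) := isCompact_closedBall a s
  have hf1 : Integrable f := by
    have h1 : IntegrableOn f (Metric.closedBall a s) := by
      have hfin : IsFiniteMeasure (volume.restrict (Metric.closedBall a s)) :=
        ⟨by rw [Measure.restrict_apply_univ]; exact hball.measure_lt_top⟩
      exact (hf.restrict _).integrable one_le_two
    refine h1.integrable_of_forall_notMem_eq_zero fun ξ hξ => hfs ξ ?_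
    rw [Metric.mem_closedBall, dist_eq_norm] at hξ
    exact not_le.1 hξ
  set 𝒩 := (finite_setOf_norm_frq_sub_le hr a (s + (2 * r)⁻¹)).toFinset
  have hlab : ∀ ξ, f ξ ≠ 0 → lab r ξ ∈ 𝒩 := by
    intro ξ hξ
    have h1 : ‖ξ - a‖ ≤ s := by
      by_contra hlt
      exact hξ (hfs ξ (not_le.1 hlt))
    rw [Set.Finite.mem_toFinset, Set.mem_ofPred_eq]
    have h2 : frq r (lab r ξ) - a = (frq r (lab r ξ) - ξ) + (ξ - a) := by abel
    rw [h2]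
    exact (norm_add_le _ _).trans (by linarith [norm_frq_lab_sub_le hr ξ])
  set δ := ε / (𝒩.card + 1)
  have hδ : 0 < δ := by positivity
  choose S c hc hS using fun n => exists_cell_approx hr n
    (hf1.indicator (measurableSet_cell r n))
    (by
      refine (hf2.indicator (measurableSet_cell r n)).congr (ae_of_all _ fun ξ => ?_)
      simp only [Set.indicator_apply]
      split_ifs <;> simp) (fun ξ hξ => Set.indicator_of_notMem hξ f) hδ
  set U := 𝒩.biUnion S
  set c' : (Fin d → ℤ) × (Fin d → ℤ) → ℂ := fun T => if T.2 ∈ S T.1 then c T.1 T.2 else 0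
  have hsum : ∀ {M : Type} [AddCommMonoid M] (n) (_ : n ∈ 𝒩) (F : (Fin d → ℤ) → ℂ → M)
      (_ : ∀ m, F m 0 = 0), ∑ m ∈ U, F m (c' (n, m)) = ∑ m ∈ S n, F m (c n m) := by
    intro M _ n hn F hF
    have hsub : S n ⊆ U := Finset.subset_biUnion_of_mem S hn
    rw [← Finset.sum_subset hsub fun m _ hm => by simp only [c', if_neg hm, hF]]
    exact Finset.sum_congr rfl fun m hm => by simp only [c', if_pos hm]
  refine ⟨𝒩 ×ˢ U, c', fun T hT => ?_, ?_, ?_⟩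
  · have := (Finset.mem_product.1 hT).1
    rwa [Set.Finite.mem_toFinset, Set.mem_ofPred_eq] at this
  · refine Real.sqrt_le_sqrt ?_
    rw [Finset.sum_product]
    have h1 : ∀ n ∈ 𝒩, ∑ m ∈ U, ‖c' (n, m)‖ ^ 2 ≤ ∫ ξ, (cell r n).indicator (fun ξ => ‖f ξ‖ ^ 2) ξ := by
      intro n hn
      rw [hsum n hn (fun _ z => ‖z‖ ^ 2) (by simp)]
      refine (hc n).trans (le_of_eq (integral_congr_ae (ae_of_all _ fun ξ => ?_)))
      simp only [Set.indicator_apply]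
      split_ifs <;> simp
    refine (Finset.sum_le_sum h1).trans ?_
    rw [← integral_finsetSum _ fun n _ => hf2.indicator (measurableSet_cell r n)]
    refine integral_mono (integrable_finsetSum _ fun n _ => hf2.indicator (measurableSet_cell r n))
      hf2 fun ξ => ?_
    simp only [Set.indicator_apply, mem_cell_iff, Finset.sum_ite_eq]
    split_ifs
    · exact le_rfl
    · positivity
  · have h1 : ∀ ξ, f ξ = ∑ n ∈ 𝒩, (cell r n).indicator f ξ := by
      intro ξ
      simp only [Set.indicator_apply, mem_cell_iff, Finset.sum_ite_eq]
      by_cases hξ : f ξ = 0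
      · simp [hξ]
      · rw [if_pos (hlab ξ hξ)]
    have h2 : ∀ ξ, synf r (𝒩 ×ˢ U) c' ξ = ∑ n ∈ 𝒩, ∑ m ∈ S n, c n m * pk r (n, m) ξ := by
      intro ξ
      unfold synf
      rw [Finset.sum_product]
      exact Finset.sum_congr rfl fun n hn => hsum n hn (fun m z => z * pk r (n, m) ξ) (by simp)
    have hi : ∀ n, Integrable fun ξ =>
        ‖(cell r n).indicator f ξ - ∑ m ∈ S n, c n m * pk r (n, m) ξ‖ := fun n =>
      ((hf1.indicator (measurableSet_cell r n)).sub
        (integrable_finsetSum _ fun m _ => (integrable_pk hr (n, m)).const_mul _)).norm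
    calc ∫ ξ, ‖f ξ - synf r (𝒩 ×ˢ U) c' ξ‖
        ≤ ∫ ξ, ∑ n ∈ 𝒩, ‖(cell r n).indicator f ξ - ∑ m ∈ S n, c n m * pk r (n, m) ξ‖ := by
          refine integral_mono (hf1.sub (integrable_synf hr _ _)).norm
            (integrable_finsetSum _ fun n _ => hi n) fun ξ => ?_
          simp only
          rw [h2, h1 ξ, ← Finset.sum_sub_distrib]
          exact norm_sum_le _ _
      _ = ∑ n ∈ 𝒩, ∫ ξ, ‖(cell r n).indicator f ξ - ∑ m ∈ S n, c n m * pk r (n, m) ξ‖ :=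
          integral_finsetSum _ fun n _ => hi n
      _ ≤ ∑ n ∈ 𝒩, δ := Finset.sum_le_sum fun n _ => hS n
      _ = 𝒩.card * δ := by rw [Finset.sum_const, nsmul_eq_mul]
      _ ≤ (𝒩.card + 1) * δ := by nlinarith
      _ = ε := by
          simp only [δ]
          field_simp

lemma ofReal_sqrt_integral_sq {α : Type*} [MeasurableSpace α] {μ : Measure α} {f : α → ℂ}
    (hf : MemLp f 2 μ) : ENNReal.ofReal (√(∫ x, ‖f x‖ ^ 2 ∂μ)) = eLpNorm f 2 μ := by
  have h9 : ∀ x y : ℝ≥0∞, x ^ 2 = y ^ 2 → x = y := fun x y hxy =>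
    le_antisymm ((ENNReal.pow_le_pow_left_iff two_ne_zero).1 hxy.le)
      ((ENNReal.pow_le_pow_left_iff two_ne_zero).1 hxy.ge)
  refine h9 _ _ ?_
  have h0 : 0 ≤ ∫ x, ‖f x‖ ^ 2 ∂μ := integral_nonneg fun _ => by positivity
  rw [← ENNReal.ofReal_pow (Real.sqrt_nonneg _), Real.sq_sqrt h0, eLpNorm_two_sq,
    ofReal_integral_eq_lintegral_ofReal (hf.integrable_norm_pow two_ne_zero)
      (ae_of_all _ fun _ => by positivity)]
  refine lintegral_congr fun x => ?_
  rw [ENNReal.ofReal_pow (norm_nonneg _), ofReal_norm]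

lemma integrable_of_memLp_two {f : (Fin d → ℝ) → ℂ} {a : Fin d → ℝ} {s : ℝ} (hf : MemLp f 2)
    (hfs : ∀ ξ, s < ‖ξ - a‖ → f ξ = 0) : Integrable f := by
  have h1 : IntegrableOn f (Metric.closedBall a s) := by
    have hfin : IsFiniteMeasure (volume.restrict (Metric.closedBall a s)) :=
      ⟨by rw [Measure.restrict_apply_univ]; exact (isCompact_closedBall a s).measure_lt_top⟩
    exact (hf.restrict _).integrable one_le_two
  refine h1.integrable_of_forall_notMem_eq_zero fun ξ hξ => hfs ξ ?_
  rw [Metric.mem_closedBall, dist_eq_norm] at hξ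
  exact not_le.1 hξ

lemma ofReal_integral_norm_le {f : (Fin d → ℝ) → ℂ} {a : Fin d → ℝ} {s : ℝ} (hs : 0 ≤ s)
    (hf : MemLp f 2) (hfs : ∀ ξ, s < ‖ξ - a‖ → f ξ = 0) :
    ENNReal.ofReal (∫ ξ, ‖f ξ‖) ≤ ENNReal.ofReal ((2 * s + 1) ^ d) * eLpNorm f 2 volume := by
  have hi := integrable_of_memLp_two hf hfs
  have h1 : eLpNorm f 1 volume = eLpNorm f 1 (volume.restrict (Metric.closedBall a s)) := by
    rw [← eLpNorm_indicator_eq_eLpNorm_restrict Metric.isClosed_closedBall.measurableSet]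
    congr 1
    ext ξ
    by_cases hξ : ξ ∈ Metric.closedBall a s
    · rw [Set.indicator_of_mem hξ]
    · rw [Set.indicator_of_notMem hξ]
      rw [Metric.mem_closedBall, dist_eq_norm] at hξ
      exact hfs ξ (not_le.1 hξ)
  rw [integral_norm_eq_lintegral_enorm hi.aestronglyMeasurable, ← eLpNorm_one_eq_lintegral_enorm,
    ENNReal.ofReal_toReal (memLp_one_iff_integrable.2 hi).eLpNorm_ne_top, h1]
  refine (eLpNorm_le_eLpNorm_mul_rpow_measure_univ (one_le_two)
    hf.aestronglyMeasurable.restrict).trans ?_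
  rw [mul_comm]
  refine mul_le_mul' ?_ (eLpNorm_mono_measure _ Measure.restrict_le_self)
  rw [Measure.restrict_apply_univ, Real.volume_pi_closedBall a hs, Fintype.card_fin]
  have h2 : ENNReal.ofReal ((2 * s) ^ d) ≤ ENNReal.ofReal ((2 * s + 1) ^ d) :=
    ENNReal.ofReal_le_ofReal (by gcongr; linarith)
  have h3 : (1 : ℝ≥0∞) ≤ ENNReal.ofReal ((2 * s + 1) ^ d) := by
    rw [ENNReal.one_le_ofReal]
    exact one_le_pow₀ (by linarith)
  calc ENNReal.ofReal ((2 * s) ^ d) ^ (1 / (1 : ℝ≥0∞).toReal - 1 / (2 : ℝ≥0∞).toReal)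
      ≤ ENNReal.ofReal ((2 * s + 1) ^ d) ^ (1 / (1 : ℝ≥0∞).toReal - 1 / (2 : ℝ≥0∞).toReal) :=
        ENNReal.rpow_le_rpow h2 (by norm_num)
    _ ≤ ENNReal.ofReal ((2 * s + 1) ^ d) ^ (1 : ℝ) :=
        ENNReal.rpow_le_rpow_of_exponent_le h3 (by norm_num)
    _ = _ := ENNReal.rpow_one _

lemma eLpNorm_cubeQ_le_of_bound (hk : 1 ≤ k) {R : ℝ} (hR : 1 ≤ R)
    (w₀ : (Fin d → ℝ) × (Fin k → ℝ)) {F : (Fin d → ℝ) × (Fin k → ℝ) → ℂ} {M : ℝ} (hM : 0 ≤ M)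
    (hF : ∀ w, ‖F w‖ ≤ M) :
    eLpNorm F (ENNReal.ofReal (crit d k)) (volume.restrict (cubeQ d k R w₀)) ≤
      ENNReal.ofReal (M * R ^ (d + k)) := by
  have hp := one_le_crit (d := d) hk
  refine (eLpNorm_le_of_ae_bound (ae_of_all _ hF)).trans ?_
  rw [Measure.restrict_apply_univ, volume_cubeQ (by linarith) w₀, mul_comm,
    ENNReal.ofReal_mul hM, ENNReal.toReal_ofReal (by linarith)]
  refine mul_le_mul' le_rfl ?_
  have h3 : (1 : ℝ≥0∞) ≤ ENNReal.ofReal (R ^ (d + k)) := by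
    rw [ENNReal.one_le_ofReal]
    exact one_le_pow₀ hR
  calc ENNReal.ofReal (R ^ (d + k)) ^ (crit d k)⁻¹
      ≤ ENNReal.ofReal (R ^ (d + k)) ^ (1 : ℝ) :=
        ENNReal.rpow_le_rpow_of_exponent_le h3 (inv_le_one_of_one_le₀ hp)
    _ = _ := ENNReal.rpow_one _

lemma bil_trivial (hk : 1 ≤ k) (Φ : (Fin d → ℝ) → Fin k → ℝ) (a₀ b₀ : Fin d → ℝ) {s : ℝ}
    (hs : 0 ≤ s) : Bil Φ a₀ b₀ s ((2 * s + 1) ^ d * (2 * s + 1) ^ d) ((d + k : ℕ) : ℝ) := by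
  intro R hR w₀ f g hf hg hfs hgs
  have h1 := eLpNorm_cubeQ_le_of_bound hk hR w₀ (F := fun w => extn Φ f w * extn Φ g w)
    (M := (∫ ξ, ‖f ξ‖) * ∫ ξ, ‖g ξ‖) (by positivity) fun w => by
      rw [norm_mul]
      exact mul_le_mul (norm_extn_le Φ f w) (norm_extn_le Φ g w) (norm_nonneg _) (by positivity)
  refine h1.trans ?_
  rw [ENNReal.ofReal_mul (by positivity), ENNReal.ofReal_mul (by positivity), Real.rpow_natCast,
    ENNReal.ofReal_mul (by positivity), ENNReal.ofReal_mul (by positivity)]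
  calc _ ≤ (ENNReal.ofReal ((2 * s + 1) ^ d) * eLpNorm f 2 volume) *
        (ENNReal.ofReal ((2 * s + 1) ^ d) * eLpNorm g 2 volume) * ENNReal.ofReal (R ^ (d + k)) :=
        mul_le_mul' (mul_le_mul' (ofReal_integral_norm_le hs hf hfs)
          (ofReal_integral_norm_le hs hg hgs)) le_rfl
    _ = _ := by ring

lemma extn_add_left (Φ : (Fin d → ℝ) → Fin k → ℝ) (f : (Fin d → ℝ) → ℂ)
    (w₀ w : (Fin d → ℝ) × (Fin k → ℝ)) :
    extn Φ f (w₀ + w) = extn Φ (fun ξ => ex (phase Φ w₀ ξ) * f ξ) w := by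
  unfold extn
  congr 1
  ext ξ
  rw [← mul_assoc, ← ex_add]
  congr 2
  simp only [phase, Prod.fst_add, Prod.snd_add, add_dotProduct]
  ring

lemma extn_sub {Φ : (Fin d → ℝ) → Fin k → ℝ} (hΦ : Continuous Φ) {f g : (Fin d → ℝ) → ℂ}
    (hf : Integrable f) (hg : Integrable g) (w : (Fin d → ℝ) × (Fin k → ℝ)) :
    extn Φ (fun ξ => f ξ - g ξ) w = extn Φ f w - extn Φ g w := by
  unfold extn
  rw [← integral_sub (integrable_ex_phase_mul hΦ w hf) (integrable_ex_phase_mul hΦ w hg)]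
  simp only [mul_sub]

lemma eLpNorm_cubeQ_translate {p : ℝ≥0∞} {R : ℝ} (w₀ : (Fin d → ℝ) × (Fin k → ℝ))
    {F : (Fin d → ℝ) × (Fin k → ℝ) → ℂ} (hF : Continuous F) :
    eLpNorm F p (volume.restrict (cubeQ d k R w₀)) =
      eLpNorm (fun w => F (w₀ + w)) p (volume.restrict (cubeQ d k R 0)) := by
  have hinv : (volume : Measure ((Fin d → ℝ) × (Fin k → ℝ))).IsAddLeftInvariant := by
    rw [Measure.volume_eq_prod]
    infer_instance
  have h1 := (measurePreserving_add_left (volume : Measure ((Fin d → ℝ) × (Fin k → ℝ))) w₀)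
  have h2 := h1.restrict_preimage (measurableSet_cubeQ R w₀)
  have h3 : (fun w => w₀ + w) ⁻¹' cubeQ d k R w₀ = cubeQ d k R 0 := by
    ext w
    simp [cubeQ]
  rw [h3] at h2
  exact (eLpNorm_comp_measurePreserving hF.aestronglyMeasurable h2).symm

lemma norm_ex_mul (s : ℝ) (z : ℂ) : ‖ex s * z‖ = ‖z‖ := by
  rw [norm_mul, norm_ex, one_mul]

lemma memLp_modulate {Φ : (Fin d → ℝ) → Fin k → ℝ} (hΦ : Continuous Φ)
    (w₀ : (Fin d → ℝ) × (Fin k → ℝ)) {f : (Fin d → ℝ) → ℂ} (hf : MemLp f 2) :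
    MemLp (fun ξ => ex (phase Φ w₀ ξ) * f ξ) 2 :=
  hf.of_le ((continuous_ex.comp (continuous_phase hΦ w₀)).aestronglyMeasurable.mul
    hf.aestronglyMeasurable) (ae_of_all _ fun _ => (norm_ex_mul _ _).le)

lemma eLpNorm_modulate (Φ : (Fin d → ℝ) → Fin k → ℝ)
    (w₀ : (Fin d → ℝ) × (Fin k → ℝ)) (f : (Fin d → ℝ) → ℂ) :
    eLpNorm (fun ξ => ex (phase Φ w₀ ξ) * f ξ) 2 volume = eLpNorm f 2 volume :=
  eLpNorm_congr_norm_ae (ae_of_all _ fun _ => norm_ex_mul _ _)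

/-- A bound for the products of extensions of wave packet sums passes to arbitrary square integrable
functions. -/
lemma eLpNorm_extn_mul_extn_le_of_syn_zero (hk : 1 ≤ k) {Φ : (Fin d → ℝ) → Fin k → ℝ}
    (hΦ : Continuous Φ) {a₀ b₀ : Fin d → ℝ} {r s M : ℝ} (hr : 1 ≤ r) (hM : 0 ≤ M)
    (h : ∀ 𝒯₁ 𝒯₂ : Finset ((Fin d → ℤ) × (Fin d → ℤ)),
      (∀ T ∈ 𝒯₁, ‖frq r T.1 - a₀‖ ≤ s + (2 * r)⁻¹) → (∀ T ∈ 𝒯₂, ‖frq r T.1 - b₀‖ ≤ s + (2 * r)⁻¹) →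
      ∀ c b, eLpNorm (fun w => syn Φ r 𝒯₁ c w * syn Φ r 𝒯₂ b w) (ENNReal.ofReal (crit d k))
        (volume.restrict (cubeQ d k (r ^ 2) 0)) ≤ ENNReal.ofReal (M * (nrm 𝒯₁ c * nrm 𝒯₂ b)))
    {f g : (Fin d → ℝ) → ℂ} (hf : MemLp f 2) (hg : MemLp g 2)
    (hfs : ∀ ξ, s < ‖ξ - a₀‖ → f ξ = 0) (hgs : ∀ ξ, s < ‖ξ - b₀‖ → g ξ = 0) :
    eLpNorm (fun w => extn Φ f w * extn Φ g w) (ENNReal.ofReal (crit d k))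
      (volume.restrict (cubeQ d k (r ^ 2) 0)) ≤
      ENNReal.ofReal M * eLpNorm f 2 volume * eLpNorm g 2 volume := by
  have hp := one_le_ofReal_crit (d := d) hk
  have hr0 : 0 < r := by linarith
  have hfi := integrable_of_memLp_two hf hfs
  have hgi := integrable_of_memLp_two hg hgs
  set If := ∫ ξ, ‖f ξ‖
  set Ig := ∫ ξ, ‖g ξ‖
  have hIf : 0 ≤ If := integral_nonneg fun _ => norm_nonneg _
  have hIg : 0 ≤ Ig := integral_nonneg fun _ => norm_nonneg _
  set L := (r ^ 2) ^ (d + k)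
  have hL : 0 ≤ L := by positivity
  refine ENNReal.le_of_forall_pos_le_add fun η hη _ => ?_
  have hη' : (0 : ℝ) < η := hη
  set ε := min 1 ((η : ℝ) / (L * (If + Ig + 1) + 1))
  have hε : 0 < ε := by positivity
  have hε1 : ε ≤ 1 := min_le_left _ _
  have hεη : ε * (If + Ig + 1) * L ≤ η := by
    have h1 : ε ≤ (η : ℝ) / (L * (If + Ig + 1) + 1) := min_le_right _ _
    rw [le_div_iff₀ (by positivity)] at h1
    nlinarith
  obtain ⟨𝒯₁, c, h𝒯₁, hc, hfe⟩ := exists_synf_approx hr0 hf hfs hε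
  obtain ⟨𝒯₂, b, h𝒯₂, hb, hge⟩ := exists_synf_approx hr0 hg hgs hε
  have hs₁ := continuous_syn hΦ hr0 𝒯₁ c
  have hs₂ := continuous_syn hΦ hr0 𝒯₂ b
  have hEf := continuous_extn hΦ hfi
  have hEg := continuous_extn hΦ hgi
  have hd₁ : ∀ w, ‖extn Φ f w - syn Φ r 𝒯₁ c w‖ ≤ ε := fun w => by
    rw [← extn_synf hΦ hr0, ← extn_sub hΦ hfi (integrable_synf hr0 _ _)]
    exact (norm_extn_le _ _ _).trans hfe
  have hd₂ : ∀ w, ‖extn Φ g w - syn Φ r 𝒯₂ b w‖ ≤ ε := fun w => by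
    rw [← extn_synf hΦ hr0, ← extn_sub hΦ hgi (integrable_synf hr0 _ _)]
    exact (norm_extn_le _ _ _).trans hge
  have herr : ∀ w, ‖extn Φ f w * extn Φ g w - syn Φ r 𝒯₁ c w * syn Φ r 𝒯₂ b w‖ ≤
      ε * (If + Ig + 1) := fun w => by
    have h1 : extn Φ f w * extn Φ g w - syn Φ r 𝒯₁ c w * syn Φ r 𝒯₂ b w =
        (extn Φ f w - syn Φ r 𝒯₁ c w) * extn Φ g w +
          syn Φ r 𝒯₁ c w * (extn Φ g w - syn Φ r 𝒯₂ b w) := by ring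
    have h2 : ‖syn Φ r 𝒯₁ c w‖ ≤ If + 1 := by
      have h3 := norm_sub_norm_le (syn Φ r 𝒯₁ c w) (extn Φ f w)
      rw [norm_sub_rev] at h3
      linarith [hd₁ w, norm_extn_le Φ f w]
    rw [h1]
    refine (norm_add_le _ _).trans ?_
    rw [norm_mul, norm_mul]
    have h4 := mul_le_mul (hd₁ w) (norm_extn_le Φ g w) (norm_nonneg _) hε.le
    have h5 := mul_le_mul h2 (hd₂ w) (norm_nonneg _) (by positivity)
    nlinarith
  have hmain : ENNReal.ofReal (M * (nrm 𝒯₁ c * nrm 𝒯₂ b)) ≤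
      ENNReal.ofReal M * eLpNorm f 2 volume * eLpNorm g 2 volume := by
    rw [← ofReal_sqrt_integral_sq hf, ← ofReal_sqrt_integral_sq hg,
      ← ENNReal.ofReal_mul hM, ← ENNReal.ofReal_mul (by positivity)]
    refine ENNReal.ofReal_le_ofReal ?_
    rw [mul_assoc]
    exact mul_le_mul_of_nonneg_left (mul_le_mul hc hb (nrm_nonneg _ _) (Real.sqrt_nonneg _)) hM
  have hsplit : (fun w => extn Φ f w * extn Φ g w) =
      (fun w => syn Φ r 𝒯₁ c w * syn Φ r 𝒯₂ b w) +
        fun w => extn Φ f w * extn Φ g w - syn Φ r 𝒯₁ c w * syn Φ r 𝒯₂ b w := by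
    ext w
    simp only [Pi.add_apply]
    ring
  rw [hsplit]
  refine (eLpNorm_add_le (hs₁.mul hs₂).aestronglyMeasurable
    ((hEf.mul hEg).sub (hs₁.mul hs₂)).aestronglyMeasurable hp).trans ?_
  refine add_le_add ((h 𝒯₁ 𝒯₂ h𝒯₁ h𝒯₂ c b).trans hmain) ?_
  refine (eLpNorm_cubeQ_le_of_bound hk (one_le_pow₀ hr) 0 (by positivity) herr).trans ?_
  rw [← ENNReal.ofReal_coe_nnreal]
  exact ENNReal.ofReal_le_ofReal hεη

lemma eLpNorm_extn_mul_extn_le_of_syn (hk : 1 ≤ k) {Φ : (Fin d → ℝ) → Fin k → ℝ}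
    (hΦ : Continuous Φ) {a₀ b₀ : Fin d → ℝ} {r s M : ℝ} (hr : 1 ≤ r) (hM : 0 ≤ M)
    (h : ∀ 𝒯₁ 𝒯₂ : Finset ((Fin d → ℤ) × (Fin d → ℤ)),
      (∀ T ∈ 𝒯₁, ‖frq r T.1 - a₀‖ ≤ s + (2 * r)⁻¹) → (∀ T ∈ 𝒯₂, ‖frq r T.1 - b₀‖ ≤ s + (2 * r)⁻¹) →
      ∀ c b, eLpNorm (fun w => syn Φ r 𝒯₁ c w * syn Φ r 𝒯₂ b w) (ENNReal.ofReal (crit d k))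
        (volume.restrict (cubeQ d k (r ^ 2) 0)) ≤ ENNReal.ofReal (M * (nrm 𝒯₁ c * nrm 𝒯₂ b)))
    (w₀ : (Fin d → ℝ) × (Fin k → ℝ)) {f g : (Fin d → ℝ) → ℂ} (hf : MemLp f 2) (hg : MemLp g 2)
    (hfs : ∀ ξ, s < ‖ξ - a₀‖ → f ξ = 0) (hgs : ∀ ξ, s < ‖ξ - b₀‖ → g ξ = 0) :
    eLpNorm (fun w => extn Φ f w * extn Φ g w) (ENNReal.ofReal (crit d k))
      (volume.restrict (cubeQ d k (r ^ 2) w₀)) ≤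
      ENNReal.ofReal M * eLpNorm f 2 volume * eLpNorm g 2 volume := by
  have hcont : Continuous fun w => extn Φ f w * extn Φ g w :=
    (continuous_extn hΦ (integrable_of_memLp_two hf hfs)).mul
      (continuous_extn hΦ (integrable_of_memLp_two hg hgs))
  rw [eLpNorm_cubeQ_translate w₀ hcont, ← eLpNorm_modulate Φ w₀ f, ← eLpNorm_modulate Φ w₀ g]
  simp only [extn_add_left]
  exact eLpNorm_extn_mul_extn_le_of_syn_zero hk hΦ hr hM h (memLp_modulate hΦ w₀ hf)
    (memLp_modulate hΦ w₀ hg) (fun ξ hξ => by rw [hfs ξ hξ, mul_zero])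
    (fun ξ hξ => by rw [hgs ξ hξ, mul_zero])

lemma Bil.mono {Φ : (Fin d → ℝ) → Fin k → ℝ} {a₀ b₀ : Fin d → ℝ} {s s' A α α' : ℝ}
    (h : Bil Φ a₀ b₀ s A α) (hs : s' ≤ s) (hA : 0 ≤ A) (hα : α ≤ α') :
    Bil Φ a₀ b₀ s' A α' := by
  intro R hR w₀ f g hf hg hfs hgs
  refine (h R hR w₀ f g hf hg (fun ξ hξ => hfs ξ (hs.trans_lt hξ))
    fun ξ hξ => hgs ξ (hs.trans_lt hξ)).trans ?_
  gcongr

/-- One step of the induction on scales: the exponent `α` improves to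
`max (α * (1 - δ / 2)) ((9 * d + 3 * k) / 2 * δ)`. -/
lemma Bil.step (hk : 1 ≤ k) (hkd : k ≤ d) {Φ : (Fin d → ℝ) → Fin k → ℝ}
    (hΦ : ContDiff ℝ (⊤ : ℕ∞) Φ) {κ ρ : ℝ} (hκ : 0 < κ) {a₀ b₀ : Fin d → ℝ}
    (htr : Transversal Φ κ ρ a₀ b₀) (htr' : Transversal Φ κ ρ b₀ a₀) {s s' A α δ : ℝ}
    (hs' : 0 ≤ s') (hss : s' < s) (hsρ : s ≤ ρ) (hA : 0 ≤ A) (hα : 0 < α) (hδ : 0 < δ)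
    (hδ4 : δ ≤ 1 / 4) (h : Bil Φ a₀ b₀ s A α) :
    ∃ A', 0 ≤ A' ∧
      Bil Φ a₀ b₀ s' A' (max (α * (1 - δ / 2)) (((9 * d + 3 * k : ℕ) : ℝ) / 2 * δ)) := by
  set P := 9 * d + 3 * k
  set α' := max (α * (1 - δ / 2)) ((P : ℝ) / 2 * δ)
  have hα' : 0 < α' := lt_max_of_lt_left (mul_pos hα (by linarith))
  set N := ⌈((4 * (d + k) : ℕ) : ℝ) / δ⌉₊
  set B := max ‖a₀‖ ‖b₀‖ + ρ
  have hB : 0 ≤ B := add_nonneg (le_max_of_le_left (norm_nonneg _)) (by linarith)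
  obtain ⟨C, hC, H⟩ := exists_syn_step hk hkd hΦ B κ hB hκ N
  set r₀ := max (C ^ 2) (1 / (s - s'))
  have hr₀ : 1 ≤ r₀ := le_max_of_le_left (one_le_pow₀ (by linarith))
  set A₀ := (2 * s' + 1) ^ d * (2 * s' + 1) ^ d
  have hA₀ : 0 ≤ A₀ := by positivity
  refine ⟨C * (A * 2 ^ α + 1) + A₀ * (r₀ ^ 2) ^ (d + k), by positivity, ?_⟩
  intro R hR w₀ f g hf hg hfs hgs
  have hR0 : 0 < R := by linarith
  have hRα : 1 ≤ R ^ α' := Real.one_le_rpow hR hα'.le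
  have hr1 : 1 ≤ √R := Real.one_le_sqrt.2 hR
  rcases lt_or_ge (√R) r₀ with hlt | hge
  · refine (bil_trivial hk Φ a₀ b₀ hs' R hR w₀ f g hf hg hfs hgs).trans ?_
    refine mul_le_mul' (mul_le_mul' (ENNReal.ofReal_le_ofReal ?_) le_rfl) le_rfl
    have h1 : R ≤ r₀ ^ 2 := by
      rw [← Real.sq_sqrt hR0.le]
      gcongr
    rw [Real.rpow_natCast]
    calc A₀ * R ^ (d + k) ≤ A₀ * (r₀ ^ 2) ^ (d + k) := by gcongr
      _ ≤ A₀ * (r₀ ^ 2) ^ (d + k) * R ^ α' := le_mul_of_one_le_right (by positivity) hRα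
      _ ≤ (C * (A * 2 ^ α + 1) + A₀ * (r₀ ^ 2) ^ (d + k)) * R ^ α' := by
          gcongr
          exact le_add_of_nonneg_left (by positivity)
  · set r := √R
    have hr0 : 0 < r := by linarith
    have hrR : r ^ 2 = R := Real.sq_sqrt hR0.le
    set D := r ^ δ
    have hD : 1 ≤ D := Real.one_le_rpow hr1 hδ.le
    have hD0 : 0 < D := by linarith
    have hDr : D ≤ r := by
      calc D ≤ r ^ (1 : ℝ) := Real.rpow_le_rpow_of_exponent_le hr1 (by linarith)
        _ = r := Real.rpow_one r
    have hCD : C * D ^ 2 ≤ r := by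
      have h1 : D ^ 2 ≤ √r := by
        rw [Real.sqrt_eq_rpow, ← Real.rpow_natCast, ← Real.rpow_mul hr0.le]
        exact Real.rpow_le_rpow_of_exponent_le hr1 (by push_cast; linarith)
      have h2 : C ≤ √r := Real.le_sqrt_of_sq_le ((le_max_left _ _).trans hge)
      calc C * D ^ 2 ≤ √r * √r := by gcongr
        _ = r := Real.mul_self_sqrt hr0.le
    set K := ⌈r / D⌉₊
    have hK1 : r ≤ K * D := by
      rw [← div_le_iff₀ hD0]
      exact Nat.le_ceil _
    have hK2 : K * r ≤ 2 * R ^ (1 - δ / 2) := by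
      have h1 : (K : ℝ) ≤ r / D + 1 := (Nat.ceil_lt_add_one (by positivity)).le
      have h2 : 1 ≤ r / D := (one_le_div hD0).2 hDr
      have h3 : R ^ (1 - δ / 2) = r / D * r := by
        rw [← hrR, ← Real.rpow_natCast, ← Real.rpow_mul hr0.le]
        simp only [D]
        rw [div_mul_eq_mul_div, ← sq, ← Real.rpow_natCast, ← Real.rpow_sub hr0]
        congr 1
        push_cast
        ring
      rw [h3]
      nlinarith
    have hN : r ^ (4 * (d + k)) ≤ D ^ N := by
      simp only [D]
      rw [← Real.rpow_natCast, ← Real.rpow_natCast, ← Real.rpow_mul hr0.le]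
      refine Real.rpow_le_rpow_of_exponent_le hr1 ?_
      rw [mul_comm δ, ← div_le_iff₀ hδ]
      exact Nat.le_ceil _
    have hrs : s' + r⁻¹ ≤ s := by
      have h1 : 1 / (s - s') ≤ r := (le_max_right _ _).trans hge
      have h2 := one_div_le_one_div_of_le (by have := sub_pos.2 hss; positivity) h1
      rw [one_div_one_div, one_div] at h2
      linarith
    have hrr : (2 * r)⁻¹ + (2 * r)⁻¹ = r⁻¹ := by
      field_simp
      norm_num
    have hP : D ^ P ≤ R ^ α' := by
      have h1 : D ^ P = R ^ ((P : ℝ) / 2 * δ) := by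
        rw [← hrR]
        simp only [D]
        rw [← Real.rpow_natCast, ← Real.rpow_natCast, ← Real.rpow_mul hr0.le,
          ← Real.rpow_mul hr0.le]
        congr 1
        push_cast
        ring
      rw [h1]
      exact Real.rpow_le_rpow_of_exponent_le hR (le_max_right _ _)
    have hKα : (K * r) ^ α ≤ 2 ^ α * R ^ α' := by
      calc (K * r) ^ α ≤ (2 * R ^ (1 - δ / 2)) ^ α := by gcongr
        _ = 2 ^ α * R ^ (α * (1 - δ / 2)) := by
          rw [Real.mul_rpow (by norm_num) (by positivity), ← Real.rpow_mul hR0.le, mul_comm α]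
        _ ≤ 2 ^ α * R ^ α' := by
          gcongr
          exact le_max_left _ _
    have hM : 0 ≤ C * (A * (K * r) ^ α + D ^ P) := by positivity
    have hmain := eLpNorm_extn_mul_extn_le_of_syn hk hΦ.continuous (a₀ := a₀) (b₀ := b₀) (s := s')
      hr1 hM (fun 𝒯₁ 𝒯₂ h₁ h₂ c b => H a₀ b₀ ρ htr htr'
        (add_le_add_left (le_max_left _ _) _) (add_le_add_left (le_max_right _ _) _) r D K hD hCD
        hK1 hN s A α hsρ hA h 𝒯₁ 𝒯₂ (fun T hT => by linarith [h₁ T hT])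
        (fun T hT => by linarith [h₂ T hT]) c b) w₀ hf hg hfs hgs
    rw [hrR] at hmain
    refine hmain.trans (mul_le_mul' (mul_le_mul' (ENNReal.ofReal_le_ofReal ?_) le_rfl) le_rfl)
    calc C * (A * (K * r) ^ α + D ^ P) ≤ C * (A * (2 ^ α * R ^ α') + R ^ α') := by gcongr
      _ = C * (A * 2 ^ α + 1) * R ^ α' := by ring
      _ ≤ (C * (A * 2 ^ α + 1) + A₀ * (r₀ ^ 2) ^ (d + k)) * R ^ α' := by
          gcongr
          exact le_add_of_nonneg_right (by positivity)

/-- The local bilinear extension estimate with an arbitrarily small power loss. -/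
lemma exists_bil (hk : 1 ≤ k) (hkd : k ≤ d) {Φ : (Fin d → ℝ) → Fin k → ℝ}
    (hΦ : ContDiff ℝ (⊤ : ℕ∞) Φ) {κ ρ : ℝ} (hκ : 0 < κ) (hρ : 0 < ρ) {a₀ b₀ : Fin d → ℝ}
    (htr : Transversal Φ κ ρ a₀ b₀) (htr' : Transversal Φ κ ρ b₀ a₀) {β : ℝ} (hβ : 0 < β) :
    ∃ A, 0 ≤ A ∧ Bil Φ a₀ b₀ (ρ / 2) A β := by
  set Q : ℝ := ((9 * d + 3 * k : ℕ) : ℝ) / 2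
  have hQ : 0 < Q := by
    have : (0 : ℝ) < ((9 * d + 3 * k : ℕ) : ℝ) := by exact_mod_cast (by lia)
    positivity
  set δ := min (1 / 4) (β / Q)
  have hδ : 0 < δ := by positivity
  have hδ4 : δ ≤ 1 / 4 := min_le_left _ _
  have hδQ : Q * δ ≤ β := by
    have : δ ≤ β / Q := min_le_right _ _
    rw [le_div_iff₀ hQ] at this
    linarith
  set α₀ : ℝ := ((d + k : ℕ) : ℝ)
  have hα₀ : 0 ≤ α₀ := Nat.cast_nonneg _
  have hq : 0 ≤ 1 - δ / 2 := by linarith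
  have hiter : ∀ n : ℕ, ∃ A, 0 ≤ A ∧
      Bil Φ a₀ b₀ (ρ / 2 * (1 + (1 / 2) ^ n)) A (max (α₀ * (1 - δ / 2) ^ n) β) := by
    intro n
    induction n with
    | zero =>
      refine ⟨_, ?_, (bil_trivial hk Φ a₀ b₀ hρ.le).mono (by norm_num) ?_ ?_⟩
      · positivity
      · positivity
      · rw [pow_zero, mul_one]
        exact le_max_left _ _
    | succ n ih =>
      obtain ⟨A, hA, hBil⟩ := ih
      have h1 : ((1 : ℝ) / 2) ^ (n + 1) < (1 / 2) ^ n := by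
        rw [pow_succ]
        have : (0 : ℝ) < (1 / 2) ^ n := by positivity
        linarith
      have h2 : ((1 : ℝ) / 2) ^ n ≤ 1 := pow_le_one₀ (by norm_num) (by norm_num)
      obtain ⟨A', hA', h'⟩ := hBil.step hk hkd hΦ hκ htr htr'
        (s' := ρ / 2 * (1 + (1 / 2) ^ (n + 1))) (by positivity) (by gcongr) (by nlinarith) hA
        (lt_max_of_lt_right hβ) hδ hδ4
      refine ⟨A', hA', h'.mono le_rfl hA' (max_le ?_ (hδQ.trans (le_max_right _ _)))⟩
      rw [max_mul_of_nonneg _ _ hq]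
      refine max_le_max (le_of_eq ?_) ?_
      · rw [pow_succ]
        ring
      · nlinarith
  obtain ⟨n, hn⟩ : ∃ n : ℕ, α₀ * (1 - δ / 2) ^ n ≤ β := by
    obtain ⟨n, hn⟩ := exists_pow_lt_of_lt_one (show 0 < β / (α₀ + 1) by positivity)
      (show 1 - δ / 2 < 1 by linarith)
    refine ⟨n, ?_⟩
    rw [lt_div_iff₀ (by positivity)] at hn
    have : 0 ≤ (1 - δ / 2) ^ n := pow_nonneg hq n
    nlinarith
  obtain ⟨A, hA, h⟩ := hiter n
  refine ⟨A, hA, h.mono ?_ hA (max_le hn le_rfl)⟩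
  have : (0 : ℝ) ≤ (1 / 2) ^ n := by positivity
  nlinarith

lemma Transversal.mono {Φ : (Fin d → ℝ) → Fin k → ℝ} {κ κ' ρ ρ' : ℝ} {a₀ b₀ : Fin d → ℝ}
    (h : Transversal Φ κ ρ a₀ b₀) (hκ : κ' ≤ κ) (hρ : ρ' ≤ ρ) : Transversal Φ κ' ρ' a₀ b₀ := by
  intro ν ν' a η b h1 h2 h3 h4 h5 s s'
  refine le_trans ?_ (h ν ν' a η b (h1.trans hρ) (h2.trans hρ) (h3.trans hρ) (h4.trans hρ)
    (h5.trans hρ) s s')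
  gcongr

/-- The bilinear extension estimate with power loss `β` for functions supported in `U` and `V`. -/
def PairBound (Φ : (Fin d → ℝ) → Fin k → ℝ) (β : ℝ) (U V : Set (Fin d → ℝ)) : Prop :=
  ∃ A : ℝ, 0 ≤ A ∧ ∀ R, 1 ≤ R → ∀ (w₀ : (Fin d → ℝ) × (Fin k → ℝ)) (f g : (Fin d → ℝ) → ℂ),
    MemLp f 2 → MemLp g 2 → Integrable f → Integrable g →
    (∀ ξ, ξ ∉ U → f ξ = 0) → (∀ ξ, ξ ∉ V → g ξ = 0) →
    eLpNorm (fun w => extn Φ f w * extn Φ g w) (ENNReal.ofReal (crit d k))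
      (volume.restrict (cubeQ d k R w₀)) ≤
      ENNReal.ofReal (A * R ^ β) * eLpNorm f 2 volume * eLpNorm g 2 volume

lemma PairBound.mono {Φ : (Fin d → ℝ) → Fin k → ℝ} {β : ℝ} {U V U' V' : Set (Fin d → ℝ)}
    (h : PairBound Φ β U V) (hU : U' ⊆ U) (hV : V' ⊆ V) : PairBound Φ β U' V' := by
  obtain ⟨A, hA, h⟩ := h
  exact ⟨A, hA, fun R hR w₀ f g hf hg hfi hgi hfs hgs => h R hR w₀ f g hf hg hfi hgi
    (fun ξ hξ => hfs ξ fun h' => hξ (hU h')) fun ξ hξ => hgs ξ fun h' => hξ (hV h')⟩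

lemma PairBound.symm {Φ : (Fin d → ℝ) → Fin k → ℝ} {β : ℝ} {U V : Set (Fin d → ℝ)}
    (h : PairBound Φ β U V) : PairBound Φ β V U := by
  obtain ⟨A, hA, h⟩ := h
  refine ⟨A, hA, fun R hR w₀ f g hf hg hfi hgi hfs hgs => ?_⟩
  have := h R hR w₀ g f hg hf hgi hfi hgs hfs
  rw [mul_right_comm]
  simpa only [mul_comm (extn Φ f _)] using this

lemma pairBound_empty (Φ : (Fin d → ℝ) → Fin k → ℝ) (β : ℝ) (V : Set (Fin d → ℝ)) :
    PairBound Φ β ∅ V := by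
  refine ⟨0, le_rfl, fun R hR w₀ f g hf hg hfi hgi hfs hgs => ?_⟩
  have hf0 : f = 0 := funext fun ξ => hfs ξ (Set.notMem_empty ξ)
  have h1 : (fun w => extn Φ f w * extn Φ g w) = 0 := by
    ext w
    simp [extn, hf0]
  rw [h1, eLpNorm_zero]
  exact zero_le

lemma PairBound.union_left (hk : 1 ≤ k) {Φ : (Fin d → ℝ) → Fin k → ℝ} (hΦ : Continuous Φ)
    {β : ℝ} {U U' V : Set (Fin d → ℝ)} (hU : MeasurableSet U) (h : PairBound Φ β U V)
    (h' : PairBound Φ β U' V) : PairBound Φ β (U ∪ U') V := by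
  obtain ⟨A, hA, h⟩ := h
  obtain ⟨A', hA', h'⟩ := h'
  refine ⟨A + A', add_nonneg hA hA', fun R hR w₀ f g hf hg hfi hgi hfs hgs => ?_⟩
  have h1 := h R hR w₀ (U.indicator f) g (hf.indicator hU) hg (hfi.indicator hU) hgi
    (fun ξ hξ => Set.indicator_of_notMem hξ f) hgs
  have h2 := h' R hR w₀ (Uᶜ.indicator f) g (hf.indicator hU.compl) hg (hfi.indicator hU.compl) hgi
    (fun ξ hξ => by
      by_cases hξU : ξ ∈ U
      · exact Set.indicator_of_notMem (show ξ ∉ Uᶜ from fun hc => hc hξU) f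
      · rw [Set.indicator_of_mem (show ξ ∈ Uᶜ from hξU)]
        exact hfs ξ fun hc => hc.elim hξU hξ) hgs
  have hsplit : (fun w => extn Φ f w * extn Φ g w) =
      (fun w => extn Φ (U.indicator f) w * extn Φ g w) +
        fun w => extn Φ (Uᶜ.indicator f) w * extn Φ g w := by
    ext w
    have h3 : extn Φ (Uᶜ.indicator f) w = extn Φ f w - extn Φ (U.indicator f) w := by
      rw [← extn_sub hΦ hfi (hfi.indicator hU)]
      congr 1
      ext ξ
      by_cases hξU : ξ ∈ U <;> simp [hξU]
    simp only [Pi.add_apply, h3]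
    ring
  have hEg := continuous_extn hΦ hgi
  rw [hsplit]
  refine (eLpNorm_add_le ((continuous_extn hΦ (hfi.indicator hU)).mul hEg).aestronglyMeasurable
    ((continuous_extn hΦ (hfi.indicator hU.compl)).mul hEg).aestronglyMeasurable
    (one_le_ofReal_crit hk)).trans ?_
  refine (add_le_add h1 h2).trans ?_
  rw [add_mul A, ENNReal.ofReal_add (by positivity) (by positivity), add_mul, add_mul]
  gcongr <;> exact eLpNorm_indicator_le f

/-- Local bilinear estimates glue to a bilinear estimate for two compact sets. -/
lemma pairBound_of_isCompact (hk : 1 ≤ k) {Φ : (Fin d → ℝ) → Fin k → ℝ} (hΦ : Continuous Φ)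
    {β : ℝ} {S₁ S₂ : Set (Fin d → ℝ)} (hS₁ : IsCompact S₁) (hS₂ : IsCompact S₂)
    (h : ∀ a ∈ S₁, ∀ b ∈ S₂, ∃ ρ > 0,
      PairBound Φ β (Metric.closedBall a ρ) (Metric.closedBall b ρ)) :
    PairBound Φ β S₁ S₂ := by
  have hone : ∀ a ∈ S₁, ∃ ρ > 0, ∃ V, S₂ ⊆ V ∧ MeasurableSet V ∧
      PairBound Φ β (Metric.closedBall a ρ) V := by
    intro a ha
    refine hS₂.induction_on (p := fun W => ∃ ρ > 0, ∃ V, W ⊆ V ∧ MeasurableSet V ∧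
      PairBound Φ β (Metric.closedBall a ρ) V) ?_ ?_ ?_ ?_
    · exact ⟨1, one_pos, ∅, subset_rfl, MeasurableSet.empty, (pairBound_empty Φ β _).symm⟩
    · rintro s t hst ⟨ρ, hρ, V, hV, hm, hb⟩
      exact ⟨ρ, hρ, V, hst.trans hV, hm, hb⟩
    · rintro s t ⟨ρ, hρ, V, hV, hm, hb⟩ ⟨ρ', hρ', V', hV', hm', hb'⟩
      refine ⟨min ρ ρ', lt_min hρ hρ', V ∪ V', Set.union_subset_union hV hV', hm.union hm', ?_⟩
      exact (PairBound.union_left hk hΦ hm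
        (hb.mono (Metric.closedBall_subset_closedBall (min_le_left _ _)) subset_rfl).symm
        (hb'.mono (Metric.closedBall_subset_closedBall (min_le_right _ _)) subset_rfl).symm).symm
    · intro b hb
      obtain ⟨ρ, hρ, hab⟩ := h a ha b hb
      exact ⟨_, mem_nhdsWithin_of_mem_nhds (Metric.closedBall_mem_nhds b hρ), ρ, hρ, _, subset_rfl,
        Metric.isClosed_closedBall.measurableSet, hab⟩
  obtain ⟨U, hU, -, hb⟩ : ∃ U, S₁ ⊆ U ∧ MeasurableSet U ∧ PairBound Φ β U S₂ := by
    refine hS₁.induction_on (p := fun W => ∃ U, W ⊆ U ∧ MeasurableSet U ∧ PairBound Φ β U S₂)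
      ?_ ?_ ?_ ?_
    · exact ⟨∅, subset_rfl, MeasurableSet.empty, pairBound_empty Φ β _⟩
    · rintro s t hst ⟨V, hV, hm, hb⟩
      exact ⟨V, hst.trans hV, hm, hb⟩
    · rintro s t ⟨V, hV, hm, hb⟩ ⟨V', hV', hm', hb'⟩
      exact ⟨V ∪ V', Set.union_subset_union hV hV', hm.union hm', hb.union_left hk hΦ hm hb'⟩
    · intro a ha
      obtain ⟨ρ, hρ, V, hV, -, hab⟩ := hone a ha
      exact ⟨_, mem_nhdsWithin_of_mem_nhds (Metric.closedBall_mem_nhds a hρ), _, subset_rfl,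
        Metric.isClosed_closedBall.measurableSet, hab.mono subset_rfl hV⟩
  exact hb.mono hU subset_rfl

lemma Dmat_swap (Φ : (Fin d → ℝ) → Fin k → ℝ) (a b : Fin d → ℝ) :
    Dmat d k Φ b a = -Dmat d k Φ a b := by
  ext i j
  simp [Dmat]

lemma le_of_det_mul_mul_ne_zero {D : Matrix (Fin k) (Fin d) ℝ} {H : Matrix (Fin d) (Fin d) ℝ}
    {E : Matrix (Fin d) (Fin k) ℝ} (h : (D * H * E).det ≠ 0) : k ≤ d := by
  have h1 : (D * H * E).rank = k := by
    rw [rank_of_isUnit _ ((isUnit_iff_isUnit_det _).2 (isUnit_iff_ne_zero.2 h)), Fintype.card_fin]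
  have h2 := (rank_mul_le_left (D * H) E).trans (rank_le_width (D * H))
  lia

lemma exists_pairBound_of_transversality (hk : 1 ≤ k) {Φ : (Fin d → ℝ) → Fin k → ℝ}
    (hΦ : ContDiff ℝ (⊤ : ℕ∞) Φ) {a b : Fin d → ℝ}
    (h1 : ∀ t : Fin k → ℝ, (∑ i, t i ^ 2) = 1 → ∀ ν, (ν = a ∨ ν = b) → (tHess d k Φ t ν).det ≠ 0)
    (h2 : ∀ t : Fin k → ℝ, (∑ i, t i ^ 2) = 1 → ∀ ν, (ν = a ∨ ν = b) →
      (Dmat d k Φ a b * (tHess d k Φ t ν)⁻¹ * (Dmat d k Φ a b)ᵀ).det ≠ 0) {β : ℝ} (hβ : 0 < β) :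
    ∃ ρ > 0, PairBound Φ β (Metric.closedBall a ρ) (Metric.closedBall b ρ) := by
  have hkd : k ≤ d := by
    refine le_of_det_mul_mul_ne_zero (h2 (Pi.single ⟨0, hk⟩ 1) ?_ a (Or.inl rfl))
    rw [Finset.sum_eq_single ⟨0, hk⟩ (fun j _ hj => by simp [hj]) (by simp)]
    simp
  obtain ⟨κ, hκ, ρ, hρ, htr⟩ := exists_transversality hΦ hk (fun t ht => h1 t ht a (Or.inl rfl))
    fun t ht => h2 t ht a (Or.inl rfl)
  obtain ⟨κ', hκ', ρ', hρ', htr'⟩ := exists_transversality hΦ hk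
    (fun t ht => h1 t ht b (Or.inr rfl)) (a₀ := b) (b₀ := a) fun t ht => by
      rw [Dmat_swap, transpose_neg, Matrix.neg_mul, Matrix.neg_mul, Matrix.mul_neg, neg_neg]
      exact h2 t ht b (Or.inr rfl)
  obtain ⟨A, hA, h⟩ := exists_bil hk hkd hΦ (lt_min hκ hκ') (lt_min hρ hρ')
    (Transversal.mono htr (min_le_left _ _) (min_le_left _ _))
    (Transversal.mono htr' (min_le_right _ _) (min_le_right _ _)) hβ
  have hball : ∀ {c ξ : Fin d → ℝ}, min ρ ρ' / 2 < ‖ξ - c‖ →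
      ξ ∉ Metric.closedBall c (min ρ ρ' / 2) := fun hlt => by
    rw [Metric.mem_closedBall, dist_eq_norm]
    exact not_le.2 hlt
  refine ⟨min ρ ρ' / 2, half_pos (lt_min hρ hρ'), A, hA, ?_⟩
  intro R hR w₀ f g hf hg _ _ hfs hgs
  exact h R hR w₀ f g hf hg (fun ξ hξ => hfs ξ (hball hξ)) fun ξ hξ => hgs ξ (hball hξ)

lemma extOp_eq_extn {S : Set (Fin d → ℝ)} (hS : MeasurableSet S)
    (Φ : (Fin d → ℝ) → Fin k → ℝ) (f : (Fin d → ℝ) → ℂ) (w : (Fin d → ℝ) × (Fin k → ℝ)) :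
    extOp d k S Φ f w = extn Φ (S.indicator f) w := by
  rw [extOp, extn, ← integral_indicator hS]
  congr 1
  ext ξ
  by_cases hξ : ξ ∈ S
  · simp [hξ, ex, phase, dotProduct]
  · simp [hξ]

lemma isCompact_of_isClosedCube {S : Set (Fin d → ℝ)} (hS : IsClosedCube d S) : IsCompact S := by
  obtain ⟨a, r, hr, rfl⟩ := hS
  have h : {x : Fin d → ℝ | ∀ i, |x i - a i| ≤ r} = Metric.closedBall a r := by
    ext x
    simp [dist_pi_le_iff hr, Real.dist_eq]
  exact h ▸ isCompact_closedBall a r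

lemma extn_eq_zero_of_not_integrable {Φ : (Fin d → ℝ) → Fin k → ℝ} (hΦ : Continuous Φ)
    {f : (Fin d → ℝ) → ℂ} (hf : ¬ Integrable f) (w : (Fin d → ℝ) × (Fin k → ℝ)) :
    extn Φ f w = 0 := by
  refine integral_undef fun h => hf ?_
  have h1 : Integrable fun ξ => ex (-phase Φ w ξ) * (ex (phase Φ w ξ) * f ξ) :=
    h.bdd_mul (c := 1) (continuous_ex.comp (continuous_phase hΦ w).neg).aestronglyMeasurable
      (Filter.Eventually.of_forall fun _ => (norm_ex _).le)
  refine h1.congr (ae_of_all _ fun ξ => ?_)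
  have h2 : ex (-phase Φ w ξ) * ex (phase Φ w ξ) = 1 := by
    simp [ex, ← Complex.exp_add]
  simp only [← mul_assoc, h2, one_mul]

lemma extn_eq_zero_of_eLpNorm_eq_zero (Φ : (Fin d → ℝ) → Fin k → ℝ) {f : (Fin d → ℝ) → ℂ}
    (hf : AEStronglyMeasurable f) (h0 : eLpNorm f 2 volume = 0)
    (w : (Fin d → ℝ) × (Fin k → ℝ)) : extn Φ f w = 0 := by
  refine integral_eq_zero_of_ae ?_
  filter_upwards [(eLpNorm_eq_zero_iff hf two_ne_zero).1 h0] with ξ hξ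
  simp [hξ]

/-- The bilinear bound for arbitrary, possibly non-measurable, densities. -/
lemma PairBound.exists_extOp_bound {Φ : (Fin d → ℝ) → Fin k → ℝ} (hΦ : Continuous Φ) {β : ℝ}
    {S₁ S₂ : Set (Fin d → ℝ)} (hS₁ : MeasurableSet S₁) (hS₂ : MeasurableSet S₂)
    (h : PairBound Φ β S₁ S₂) :
    ∃ C : ℝ, ∀ R : ℝ, 1 ≤ R → ∀ (c : (Fin d → ℝ) × (Fin k → ℝ)) (f g : (Fin d → ℝ) → ℂ),
      eLpNorm (fun w => extOp d k S₁ Φ f w * extOp d k S₂ Φ g w) (ENNReal.ofReal (crit d k))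
        (volume.restrict (cubeQ d k R c)) ≤
        ENNReal.ofReal (C * R ^ β) * eLpNorm f 2 volume * eLpNorm g 2 volume := by
  obtain ⟨A, hA, h⟩ := h
  refine ⟨A + 1, fun R hR c f g => ?_⟩
  have hR0 : 0 < R := one_pos.trans_le hR
  have hCR : ENNReal.ofReal ((A + 1) * R ^ β) ≠ 0 := by
    rw [Ne, ENNReal.ofReal_eq_zero, not_le]
    positivity
  simp only [extOp_eq_extn hS₁, extOp_eq_extn hS₂]
  set F := S₁.indicator f with hF
  set G := S₂.indicator g with hG
  have hFf : eLpNorm F 2 volume ≤ eLpNorm f 2 volume := eLpNorm_indicator_le f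
  have hGg : eLpNorm G 2 volume ≤ eLpNorm g 2 volume := eLpNorm_indicator_le g
  have hvanish : (∀ w, extn Φ F w * extn Φ G w = 0) →
      eLpNorm (fun w => extn Φ F w * extn Φ G w) (ENNReal.ofReal (crit d k))
        (volume.restrict (cubeQ d k R c)) ≤
        ENNReal.ofReal ((A + 1) * R ^ β) * eLpNorm f 2 volume * eLpNorm g 2 volume := by
    intro h0
    simp [h0]
  by_cases hFi : Integrable F
  swap
  · exact hvanish fun w => by rw [extn_eq_zero_of_not_integrable hΦ hFi, zero_mul]
  by_cases hGi : Integrable G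
  swap
  · exact hvanish fun w => by rw [extn_eq_zero_of_not_integrable hΦ hGi, mul_zero]
  by_cases hf0 : eLpNorm f 2 volume = 0
  · exact hvanish fun w => by
      rw [extn_eq_zero_of_eLpNorm_eq_zero Φ hFi.1 (le_antisymm (hFf.trans hf0.le) zero_le),
        zero_mul]
  by_cases hg0 : eLpNorm g 2 volume = 0
  · exact hvanish fun w => by
      rw [extn_eq_zero_of_eLpNorm_eq_zero Φ hGi.1 (le_antisymm (hGg.trans hg0.le) zero_le),
        mul_zero]
  by_cases hft : eLpNorm F 2 volume = ⊤
  · rw [top_le_iff.1 (hft.symm.le.trans hFf), ENNReal.mul_top hCR, ENNReal.top_mul hg0]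
    exact le_top
  by_cases hgt : eLpNorm G 2 volume = ⊤
  · rw [top_le_iff.1 (hgt.symm.le.trans hGg), ENNReal.mul_top (mul_ne_zero hCR hf0)]
    exact le_top
  refine (h R hR c F G ⟨hFi.1, lt_top_iff_ne_top.2 hft⟩ ⟨hGi.1, lt_top_iff_ne_top.2 hgt⟩ hFi hGi
    (fun ξ hξ => Set.indicator_of_notMem hξ f) fun ξ hξ => Set.indicator_of_notMem hξ g).trans ?_
  gcongr
  linarith

end BilinearRestriction

/-- **Proposition (induction-on-scales step).** Let `p₀ = (d+3k)/(d+k)` and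
assume (C1) and (C2). There is a constant `C'` (independent of `δ`) such that
for every `α > 0` and every sufficiently small `δ > 0`: if
`‖E₁f E₂g‖_{L^{p₀}(Q_R)} ≤ A R^α ‖f‖₂‖g‖₂` holds for all `R ≥ 2`, all cubes
`Q_R` of sidelength `R` and all `f, g`, then for every `ε > 0` there is `C_ε`
with `‖E₁f E₂g‖_{L^{p₀}(Q_R)} ≤ C_ε R^{max(α(1-δ), C'δ)+ε} ‖f‖₂‖g‖₂` for all
`R ≥ 2`, all cubes `Q_R` of sidelength `R` and all `f, g`. -/
theorem induction_on_scales
    (d k : ℕ) (hd : 1 ≤ d) (hk : 1 ≤ k)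
    (Φ : (Fin d → ℝ) → Fin k → ℝ) (hΦ : ContDiff ℝ (⊤ : ℕ∞) Φ)
    (S₁ S₂ : Set (Fin d → ℝ))
    (hS₁ : IsClosedCube d S₁) (hS₂ : IsClosedCube d S₂)
    (hS₁I : S₁ ⊆ Set.Icc (-1) 1) (hS₂I : S₂ ⊆ Set.Icc (-1) 1)
    (hC1 : ∀ ν ∈ S₁ ∪ S₂, ∀ t : Fin k → ℝ, (∑ i, t i ^ 2) = 1 →
      (tHess d k Φ t ν).det ≠ 0)
    (hC2 : ∀ ν₁ ∈ S₁, ∀ ν₂ ∈ S₂, ∀ t : Fin k → ℝ, (∑ i, t i ^ 2) = 1 →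
      ∀ ν, (ν = ν₁ ∨ ν = ν₂) →
      (Dmat d k Φ ν₁ ν₂ * (tHess d k Φ t ν)⁻¹ * (Dmat d k Φ ν₁ ν₂)ᵀ).det ≠ 0) :
    ∃ C' > 0, ∃ δ₀ > 0, ∀ α : ℝ, 0 < α → ∀ δ : ℝ, 0 < δ → δ < δ₀ →
      ∀ A : ℝ,
      (∀ R : ℝ, 2 ≤ R → ∀ c : (Fin d → ℝ) × (Fin k → ℝ),
        ∀ f g : (Fin d → ℝ) → ℂ,
        eLpNorm (fun w => extOp d k S₁ Φ f w * extOp d k S₂ Φ g w)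
            (ENNReal.ofReal (((d : ℝ) + 3 * k) / ((d : ℝ) + k)))
            (volume.restrict (cubeQ d k R c)) ≤
          ENNReal.ofReal (A * R ^ α) * eLpNorm f 2 volume * eLpNorm g 2 volume) →
      ∀ ε : ℝ, 0 < ε → ∃ Cε : ℝ,
      ∀ R : ℝ, 2 ≤ R → ∀ c : (Fin d → ℝ) × (Fin k → ℝ),
        ∀ f g : (Fin d → ℝ) → ℂ,
        eLpNorm (fun w => extOp d k S₁ Φ f w * extOp d k S₂ Φ g w)
            (ENNReal.ofReal (((d : ℝ) + 3 * k) / ((d : ℝ) + k)))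
            (volume.restrict (cubeQ d k R c)) ≤
          ENNReal.ofReal (Cε * R ^ (max (α * (1 - δ)) (C' * δ) + ε)) *
            eLpNorm f 2 volume * eLpNorm g 2 volume := by
  refine ⟨1, one_pos, 1, one_pos, fun α _ δ hδ _ A _ ε hε => ?_⟩
  have hβ : 0 < max (α * (1 - δ)) (1 * δ) + ε :=
    add_pos (lt_max_of_lt_right (by simpa using hδ)) hε
  have hbound := BilinearRestriction.pairBound_of_isCompact hk hΦ.continuous
    (BilinearRestriction.isCompact_of_isClosedCube hS₁)
    (BilinearRestriction.isCompact_of_isClosedCube hS₂) fun a ha b hb =>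
      BilinearRestriction.exists_pairBound_of_transversality hk hΦ
        (fun t ht ν hν => hC1 ν (by rcases hν with rfl | rfl <;> simp [ha, hb]) t ht)
        (hC2 a ha b hb) hβ
  obtain ⟨C, hC⟩ := hbound.exists_extOp_bound hΦ.continuous
    (BilinearRestriction.isCompact_of_isClosedCube hS₁).measurableSet
    (BilinearRestriction.isCompact_of_isClosedCube hS₂).measurableSet
  exact ⟨C, fun R hR c f g => hC R (by linarith) c f g⟩

end
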